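/- arXiv:2011.03576 — 2 statements merged into one kernel-verified Lean document; each statement's English description precedes it below -/
import Mathlib

section
/- Suppose the finite simplicial graph Γ has no SIL. Then IA_Γ is generated by the images in Out(A_Γ) of all partial conjugations of A_Γ, and IA_Γ is a free abelian group. -/
open SimpleGraph

namespace RaagPaper

/-- The star of a vertex: the vertex together with its neighbours. -/
def star {V : Type} (G : SimpleGraph V) (v : V) : Set V := insert v (G.neighborSet v)

/-- Domination: `u ≤ v` iff `lk(u) ⊆ st(v)`. -/
def Dom {V : Type} (G : SimpleGraph V) (u v : V) : Prop := G.neighborSet u ⊆ star G v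

/-- Domination-equivalence of vertices. -/
def EquivDom {V : Type} (G : SimpleGraph V) (u v : V) : Prop := Dom G u v ∧ Dom G v u

/-- The domination-equivalence class of a vertex. -/
def eqClass {V : Type} (G : SimpleGraph V) (x : V) : Set V := {v | EquivDom G v x}

/-- `C` is (the vertex set of) a connected component of the subgraph of `G` induced on `S`. -/
def IsCC {V : Type} (G : SimpleGraph V) (S : Set V) (C : Set V) : Prop :=
  ∃ v : S, C = {w : V | ∃ h : w ∈ S, (G.induce S).Reachable ⟨w, h⟩ v}

/-- `(x,y|z)` is a separating intersection of links (SIL). -/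
def IsSIL {V : Type} (G : SimpleGraph V) (x y z : V) : Prop :=
  x ≠ y ∧ x ≠ z ∧ y ≠ z ∧ ¬ G.Adj x y ∧ ¬ G.Adj x z ∧ ¬ G.Adj y z ∧
  ∀ C : Set V, IsCC G ((G.neighborSet x ∩ G.neighborSet y)ᶜ) C → z ∈ C → x ∉ C ∧ y ∉ C

/-- The graph has no SIL. -/
def HasNoSIL {V : Type} (G : SimpleGraph V) : Prop := ∀ x y z, ¬ IsSIL G x y z

/-- `D` is a (possibly empty) union of connected components of `Γ ∖ st(x)`. -/
def IsUnionCC {V : Type} (G : SimpleGraph V) (x : V) (D : Set V) : Prop :=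
  ∃ 𝒞 : Set (Set V), (∀ C ∈ 𝒞, IsCC G ((star G x)ᶜ) C) ∧ D = ⋃₀ 𝒞


/-- Defining relators of the RAAG: commutators of adjacent vertices. -/
def Rels {V : Type} (G : SimpleGraph V) : Set (FreeGroup V) :=
  {r | ∃ u v : V, G.Adj u v ∧
    r = FreeGroup.of u * FreeGroup.of v * (FreeGroup.of u)⁻¹ * (FreeGroup.of v)⁻¹}

/-- The right-angled Artin group on `G`. -/
abbrev Raag {V : Type} (G : SimpleGraph V) : Type := PresentedGroup (Rels G)

/-- The generator of `Raag G` corresponding to a vertex. -/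
def gen {V : Type} (G : SimpleGraph V) (v : V) : Raag G := PresentedGroup.of v

/-- `φ` is the partial conjugation conjugating the vertices of `C` by `x`. -/
def IsPartialConj {V : Type} (G : SimpleGraph V) (x : V) (C : Set V)
    (φ : MulAut (Raag G)) : Prop :=
  (∀ v ∈ C, φ (gen G v) = (gen G x)⁻¹ * gen G v * gen G x) ∧
  (∀ v ∉ C, φ (gen G v) = gen G v)

/-- `φ` is the transvection `R_u^v`, sending `u ↦ uv` and fixing all other vertices. -/
def IsTransvection {V : Type} (G : SimpleGraph V) (u v : V)
    (φ : MulAut (Raag G)) : Prop :=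
  φ (gen G u) = gen G u * gen G v ∧ ∀ w : V, w ≠ u → φ (gen G w) = gen G w

/-- The subgroup of inner automorphisms of a group. -/
def Inn (H : Type*) [Group H] : Subgroup (MulAut H) := (MulAut.conj : H →* MulAut H).range

instance Inn.normal (H : Type*) [Group H] : (Inn H).Normal := by
  constructor
  rintro a ⟨g, rfl⟩ f
  refine ⟨f g, ?_⟩
  ext x
  simp [MulAut.conj_apply, map_mul, map_inv]

/-- The outer automorphism group. -/
abbrev Out (H : Type*) [Group H] : Type _ := MulAut H ⧸ Inn H

/-- Projection from automorphisms to outer automorphisms. -/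
def toOut (H : Type*) [Group H] : MulAut H →* Out H := QuotientGroup.mk' (Inn H)

/-- The homomorphism sending an automorphism to the induced automorphism of the
abelianization. -/
def abAut (H : Type*) [Group H] : MulAut H →* MulAut (Abelianization H) where
  toFun e := MulEquiv.abelianizationCongr e
  map_one' := by
    apply MulEquiv.toMonoidHom_injective
    apply Abelianization.hom_ext
    ext x
    simp [abelianizationCongr_of]
  map_mul' f g := by
    apply MulEquiv.toMonoidHom_injective
    apply Abelianization.hom_ext
    ext x
    simp [abelianizationCongr_of, MulAut.mul_apply]

lemma abAut_inn (H : Type*) [Group H] : ∀ a ∈ Inn H, abAut H a = 1 := by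
  rintro a ⟨g, rfl⟩
  apply MulEquiv.toMonoidHom_injective
  apply Abelianization.hom_ext
  ext x
  simp [abAut, abelianizationCongr_of, MulAut.conj_apply, mul_comm]

/-- The standard map `ρ : Out(H) → Aut(Hᵃᵇ)` induced by acting on the abelianization. -/
def rhoOut (H : Type*) [Group H] : Out H →* MulAut (Abelianization H) :=
  QuotientGroup.lift (Inn H) (abAut H) (abAut_inn H)

end RaagPaper

open SimpleGraph

namespace RaagPaper

section Basics

variable {V : Type} {G : SimpleGraph V}

lemma gen_comm {u v : V} (h : G.Adj u v) : Commute (gen G u) (gen G v) := by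
  have : (PresentedGroup.mk (Rels G) (FreeGroup.of u * FreeGroup.of v * (FreeGroup.of u)⁻¹ * (FreeGroup.of v)⁻¹)) = 1 := by
    apply PresentedGroup.one_of_mem
    exact ⟨u, v, h, rfl⟩
  simp only [map_mul, map_inv] at this
  have h2 : gen G u * gen G v * (gen G u)⁻¹ * (gen G v)⁻¹ = 1 := this
  show gen G u * gen G v = gen G v * gen G u
  rw [mul_inv_eq_one, mul_inv_eq_iff_eq_mul] at h2
  exact h2

/-- universal property -/
def liftHom {H : Type*} [Group H] (G : SimpleGraph V) (f : V → H)
    (hf : ∀ u v, G.Adj u v → Commute (f u) (f v)) : Raag G →* H :=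
  PresentedGroup.toGroup (f := f) (rels := Rels G) (by
    rintro r ⟨u, v, h, rfl⟩
    simp [(hf u v h).eq])

@[simp] lemma liftHom_gen {H : Type*} [Group H] (f : V → H)
    (hf : ∀ u v, G.Adj u v → Commute (f u) (f v)) (v : V) :
    liftHom G f hf (gen G v) = f v := by
  simp [liftHom, gen]

lemma closure_gen : Subgroup.closure (Set.range (gen G)) = ⊤ :=
  PresentedGroup.closure_range_of _

lemma raag_hom_ext {H : Type*} [Monoid H] {f g : Raag G →* H}
    (h : ∀ v, f (gen G v) = g (gen G v)) : f = g := by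
  apply MonoidHom.eq_of_eqOn_dense closure_gen
  rintro _ ⟨v, rfl⟩
  exact h v

open Classical in
/-- retraction -/
noncomputable def ret (G : SimpleGraph V) (S : Set V) : Raag G →* Raag G :=
  liftHom G (fun v => if v ∈ S then gen G v else 1) (by
    intro u v h
    split_ifs <;> simp [gen_comm h])

lemma ret_gen_mem {S : Set V} {v : V} (h : v ∈ S) : ret G S (gen G v) = gen G v := by
  simp [ret, h]

lemma ret_gen_not_mem {S : Set V} {v : V} (h : v ∉ S) : ret G S (gen G v) = 1 := by
  simp [ret, h]

lemma ret_ret (S T : Set V) (g : Raag G) : ret G S (ret G T g) = ret G (S ∩ T) g := by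
  have : (ret G S).comp (ret G T) = ret G (S ∩ T) := by
    apply raag_hom_ext
    intro v
    by_cases hT : v ∈ T <;> by_cases hS : v ∈ S <;>
      simp [ret, hS, hT]
  exact DFunLike.congr_fun this g

lemma ret_univ (g : Raag G) : ret G Set.univ g = g := by
  have : ret G Set.univ = MonoidHom.id _ := by
    apply raag_hom_ext
    intro v
    simp [ret]
  rw [this]; rfl

lemma ret_empty (g : Raag G) : ret G ∅ g = 1 := by
  have : ret G ∅ = 1 := by
    apply raag_hom_ext
    intro v
    simp [ret]
  rw [this]; rfl

/-- parabolic subgroup -/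
noncomputable def par (G : SimpleGraph V) (S : Set V) : Subgroup (Raag G) := (ret G S).range

lemma mem_par {S : Set V} {g : Raag G} : g ∈ par G S ↔ ret G S g = g := by
  constructor
  · rintro ⟨h, rfl⟩
    rw [ret_ret, Set.inter_self]
  · intro h
    exact ⟨g, h⟩

lemma ret_mem_par (S : Set V) (g : Raag G) : ret G S g ∈ par G S := ⟨g, rfl⟩

lemma ret_mem_par_inter {S T : Set V} {g : Raag G} (h : g ∈ par G T) :
    ret G S g ∈ par G (S ∩ T) := by
  rw [← mem_par.1 h, ret_ret]; exact ret_mem_par _ _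

lemma par_mono {S T : Set V} (h : S ⊆ T) : par G S ≤ par G T := by
  intro g hg
  rw [mem_par, ← mem_par.1 hg, ret_ret, Set.inter_eq_self_of_subset_right h]

lemma mem_par_inter {S T : Set V} {g : Raag G} (h : g ∈ par G S) (h' : g ∈ par G T) :
    g ∈ par G (S ∩ T) := by
  rw [mem_par, ← ret_ret, mem_par.1 h', mem_par.1 h]

lemma gen_mem_par {S : Set V} {v : V} (h : v ∈ S) : gen G v ∈ par G S :=
  mem_par.2 (ret_gen_mem h)

lemma par_univ : par G (Set.univ : Set V) = ⊤ := by
  ext g; simp [mem_par, ret_univ]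

lemma mem_par_empty {g : Raag G} : g ∈ par G ∅ ↔ g = 1 := by
  rw [mem_par, ret_empty]; exact eq_comm

lemma par_eq_closure (S : Set V) : par G S = Subgroup.closure (gen G '' S) := by
  apply le_antisymm
  · rw [par, MonoidHom.range_eq_map, ← closure_gen, MonoidHom.map_closure, Subgroup.closure_le]
    rintro _ ⟨_, ⟨v, rfl⟩, rfl⟩
    by_cases h : v ∈ S
    · rw [ret_gen_mem h]; exact Subgroup.subset_closure ⟨v, h, rfl⟩
    · rw [ret_gen_not_mem h]; exact one_mem _
  · rw [Subgroup.closure_le]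
    rintro _ ⟨v, hv, rfl⟩
    exact gen_mem_par hv

open Classical in
/-- exponent hom -/
noncomputable def exHom (G : SimpleGraph V) (a : V) : Raag G →* Multiplicative ℤ :=
  liftHom G (fun v => if v = a then Multiplicative.ofAdd 1 else 1) (fun _ _ _ => Commute.all _ _)

/-- exponent sum -/
noncomputable def ex (a : V) (g : Raag G) : ℤ := (exHom G a g).toAdd

@[simp] lemma ex_mul (a : V) (g h : Raag G) : ex a (g * h) = ex a g + ex a h := by simp [ex]
@[simp] lemma ex_one (a : V) : ex a (1 : Raag G) = 0 := by simp [ex]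
@[simp] lemma ex_inv (a : V) (g : Raag G) : ex a (g⁻¹) = - ex a g := by simp [ex]
@[simp] lemma ex_pow (a : V) (g : Raag G) (n : ℕ) : ex a (g ^ n) = n * ex a g := by simp [ex]
@[simp] lemma ex_zpow (a : V) (g : Raag G) (n : ℤ) : ex a (g ^ n) = n * ex a g := by simp [ex]
@[simp] lemma ex_gen_self (a : V) : ex a (gen G a) = 1 := by simp [ex, exHom]
lemma ex_gen_ne {a v : V} (h : v ≠ a) : ex a (gen G v) = 0 := by simp [ex, exHom, h]

lemma ex_ret_mem {S : Set V} {a : V} (h : a ∈ S) (g : Raag G) : ex a (ret G S g) = ex a g := by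
  have : (exHom G a).comp (ret G S) = exHom G a := by
    apply raag_hom_ext
    intro v
    by_cases hv : v ∈ S
    · simp [ret_gen_mem hv]
    · simp only [MonoidHom.comp_apply, ret_gen_not_mem hv, map_one]
      have : v ≠ a := by rintro rfl; exact hv h
      simp [exHom, this]
  have h2 := DFunLike.congr_fun this g
  simp only [MonoidHom.comp_apply] at h2
  simp only [ex, h2]

lemma ex_ret_not_mem {S : Set V} {a : V} (h : a ∉ S) (g : Raag G) : ex a (ret G S g) = 0 := by
  have : (exHom G a).comp (ret G S) = 1 := by
    apply raag_hom_ext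
    intro v
    by_cases hv : v ∈ S
    · have : v ≠ a := by rintro rfl; exact h hv
      simp [ret_gen_mem hv, exHom, this]
    · simp only [MonoidHom.comp_apply, ret_gen_not_mem hv, map_one, MonoidHom.one_apply]
  have h2 := DFunLike.congr_fun this g
  simp only [MonoidHom.comp_apply, MonoidHom.one_apply] at h2
  simp [ex, h2]

lemma ex_of_par {S : Set V} {a : V} (h : a ∉ S) {g : Raag G} (hg : g ∈ par G S) : ex a g = 0 := by
  rw [← mem_par.1 hg]; exact ex_ret_not_mem h g

lemma ret_singleton (a : V) (g : Raag G) : ret G {a} g = gen G a ^ ex a g := by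
  have : ret G {a} = (zpowersHom (Raag G) (gen G a)).comp (exHom G a) := by
    apply raag_hom_ext
    intro v
    by_cases h : v = a
    · subst h; simp [ret_gen_mem, exHom]
    · rw [ret_gen_not_mem (by simpa using h)]
      simp [exHom, h]
  rw [this]
  simp [ex]

lemma par_commute {T₁ T₂ : Set V} (h : ∀ u ∈ T₁, ∀ v ∈ T₂, G.Adj u v) {g k : Raag G}
    (hg : g ∈ par G T₁) (hk : k ∈ par G T₂) : Commute g k := by
  rw [par_eq_closure] at hg hk
  induction hg using Subgroup.closure_induction with
  | mem x hx =>
    obtain ⟨u, hu, rfl⟩ := hx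
    induction hk using Subgroup.closure_induction with
    | mem y hy =>
      obtain ⟨v, hv, rfl⟩ := hy
      exact gen_comm (h u hu v hv)
    | one => exact Commute.one_right _
    | mul a b _ _ ha hb => exact ha.mul_right hb
    | inv a _ ha => exact ha.inv_right
  | one => exact Commute.one_left _
  | mul a b _ _ ha hb => exact ha.mul_left hb
  | inv a _ ha => exact ha.inv_left

lemma ret_join {T₁ T₂ : Set V} (h : ∀ u ∈ T₁, ∀ v ∈ T₂, G.Adj u v) (g : Raag G) :
    ret G (T₁ ∪ T₂) g = ret G T₁ g * ret G T₂ g := by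
  let F : Raag G →* Raag G :=
    { toFun := fun g => ret G T₁ g * ret G T₂ g
      map_one' := by simp
      map_mul' := by
        intro x y
        have := par_commute h (ret_mem_par T₁ y) (ret_mem_par T₂ x)
        simp only [map_mul]
        rw [mul_assoc, mul_assoc, ← mul_assoc (ret G T₁ y), this.eq]
        simp only [mul_assoc] }
  have : ret G (T₁ ∪ T₂) = F := by
    apply raag_hom_ext
    intro v
    show _ = ret G T₁ (gen G v) * ret G T₂ (gen G v)
    by_cases h1 : v ∈ T₁ <;> by_cases h2 : v ∈ T₂
    · exact absurd (h v h1 v h2) (G.loopless.irrefl v)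
    all_goals simp [ret, h1, h2]
  rw [this]; rfl

lemma ret_clique [Finite V] {Q : Set V} (hQ : ∀ u ∈ Q, ∀ v ∈ Q, u ≠ v → G.Adj u v)
    {g : Raag G} (hg : ∀ q ∈ Q, ex q g = 0) : ret G Q g = 1 := by
  classical
  have hfin : Q.Finite := Set.toFinite Q
  induction Q, hfin using Set.Finite.induction_on with
  | empty => exact ret_empty g
  | @insert a s ha hs ih =>
    have e : insert a s = {a} ∪ s := rfl
    rw [e, ret_join, ret_singleton, hg a (by simp), ih]
    · simp
    · intro u hu v hv huv
      exact hQ u (by simp [hu]) v (by simp [hv]) huv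
    · intro q hq
      exact hg q (by simp [hq])
    · rintro u hu v hv
      rw [Set.mem_singleton_iff] at hu
      subst hu
      exact hQ u (by simp) v (by simp [hv]) (by rintro rfl; exact ha hv)

lemma clique_eq_one [Finite V] {Q : Set V} (hQ : ∀ u ∈ Q, ∀ v ∈ Q, u ≠ v → G.Adj u v)
    {g : Raag G} (hgQ : g ∈ par G Q) (hg : ∀ q ∈ Q, ex q g = 0) : g = 1 := by
  rw [← mem_par.1 hgQ]; exact ret_clique hQ hg

/-- IA automorphisms, expressed by exponent sums. -/
def IsIA (φ : MulAut (Raag G)) : Prop := ∀ a g, ex a (φ g) = ex a g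

lemma isIA_of_abAut {φ : MulAut (Raag G)} (h : abAut (Raag G) φ = 1) : IsIA φ := by
  intro a g
  have h1 : Abelianization.of (φ g) = Abelianization.of g := by
    have := DFunLike.congr_fun h (Abelianization.of g)
    simpa [abAut, abelianizationCongr_of] using this
  have h2 := congrArg (Abelianization.lift (exHom G a)) h1
  simp only [Abelianization.lift_apply_of] at h2
  simp [ex, h2]

lemma IsIA.mul {φ ψ : MulAut (Raag G)} (h : IsIA φ) (h' : IsIA ψ) : IsIA (φ * ψ) := by
  intro a g
  rw [MulAut.mul_apply, h, h']

lemma IsIA.inv {φ : MulAut (Raag G)} (h : IsIA φ) : IsIA φ⁻¹ := by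
  intro a g
  rw [← h a (φ⁻¹ g), MulAut.apply_inv_self]

lemma isIA_conj (k : Raag G) : IsIA (MulAut.conj k) := by
  intro a g
  simp [MulAut.conj_apply]

end Basics

end RaagPaper

open SimpleGraph

namespace RaagPaper

section Crossed

variable {V : Type} {G : SimpleGraph V}

/-- permutation module action -/
noncomputable def act {A X : Type*} [Group A] [MulAction A X] (g : A) : (X →₀ ℤ) →+ (X →₀ ℤ) :=
  Finsupp.mapDomain.addMonoidHom (fun x : X => g • x)

lemma act_def {A X : Type*} [Group A] [MulAction A X] (g : A) (n : X →₀ ℤ) :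
    act g n = Finsupp.mapDomain (fun x : X => g • x) n := rfl

lemma act_one {A X : Type*} [Group A] [MulAction A X] (n : X →₀ ℤ) : act (1 : A) n = n := by
  have : (fun x : X => (1 : A) • x) = id := by funext x; simp
  rw [act_def, this, Finsupp.mapDomain_id]

lemma act_mul {A X : Type*} [Group A] [MulAction A X] (g h : A) (n : X →₀ ℤ) :
    act (g * h) n = act g (act h n) := by
  rw [act_def, act_def, act_def, ← Finsupp.mapDomain_comp]
  congr 1
  funext x
  simp [mul_smul]

lemma act_single {A X : Type*} [Group A] [MulAction A X] (g : A) (x : X) (c : ℤ) :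
    act g (Finsupp.single x c) = Finsupp.single (g • x) c := by
  simp [act_def]

/-- affine permutation -/
noncomputable def affPerm {A X : Type*} [Group A] [MulAction A X] (g : A) (c : X →₀ ℤ) :
    Equiv.Perm (X →₀ ℤ) where
  toFun n := act g n + c
  invFun n := act g⁻¹ (n - c)
  left_inv n := by simp [← act_mul, act_one]
  right_inv n := by simp [← act_mul, act_one]

lemma affPerm_apply {A X : Type*} [Group A] [MulAction A X] (g : A) (c n : X →₀ ℤ) :
    affPerm g c n = act g n + c := rfl

lemma exists_crossed {X : Type} [MulAction (Raag G) X] (x₀ : X) (y : V)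
    (hx : ∀ z, G.Adj y z → gen G z • x₀ = x₀) :
    ∃ d : Raag G → (X →₀ ℤ), (∀ g h, d (g * h) = d g + act g (d h)) ∧
      d (gen G y) = Finsupp.single x₀ 1 ∧ ∀ z, z ≠ y → d (gen G z) = 0 := by
  classical
  let c : V → (X →₀ ℤ) := fun v => if v = y then Finsupp.single x₀ 1 else 0
  have hcomm : ∀ u v, G.Adj u v → Commute (affPerm (gen G u) (c u)) (affPerm (gen G v) (c v)) := by
    intro u v huv
    apply Equiv.ext
    intro n
    simp only [Equiv.Perm.mul_apply, affPerm_apply, map_add, ← act_mul, (gen_comm huv).eq]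
    by_cases hu : u = y
    · have hv : v ≠ y := by rintro rfl; subst hu; exact G.loopless.irrefl _ huv
      subst hu
      simp [c, hv, act_single, hx v huv]
    · by_cases hv : v = y
      · subst hv
        simp [c, hu, act_single, hx u huv.symm]
      · simp [c, hu, hv]
  let F : Raag G →* Equiv.Perm (X →₀ ℤ) := liftHom G _ hcomm
  have hF : ∀ g n, F g n = act g n + F g 0 := by
    intro g
    have hg : g ∈ Subgroup.closure (Set.range (gen G)) := by rw [closure_gen]; trivial
    induction hg using Subgroup.closure_induction with
    | mem x hx =>
      obtain ⟨v, rfl⟩ := hx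
      intro n
      simp [F, affPerm_apply]
    | one => intro n; simp [act_one]
    | mul a b _ _ ha hb =>
      intro n
      rw [map_mul, Equiv.Perm.mul_apply, Equiv.Perm.mul_apply, hb n, ha (_ + _), ha (F b 0), act_mul,
        map_add, add_assoc]
    | inv a _ ha =>
      intro n
      rw [map_inv, Equiv.Perm.inv_eq_iff_eq, ha]
      have := ha ((F a)⁻¹ 0)
      rw [← Equiv.Perm.mul_apply, mul_inv_cancel, Equiv.Perm.one_apply] at this
      rw [map_add, ← act_mul, mul_inv_cancel, act_one, add_assoc, ← this, add_zero]
  refine ⟨fun g => F g 0, ?_, ?_, ?_⟩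
  · intro g h
    simp only [map_mul, Equiv.Perm.mul_apply]
    rw [hF, add_comm]
  · simp [F, affPerm_apply, c]
  · intro z hz
    simp [F, affPerm_apply, c, hz]

lemma crossed_one {X : Type} [MulAction (Raag G) X] {d : Raag G → (X →₀ ℤ)}
    (hd : ∀ g h, d (g * h) = d g + act g (d h)) : d 1 = 0 := by
  have := hd 1 1
  simpa [act_one] using this

lemma crossed_inv {X : Type} [MulAction (Raag G) X] {d : Raag G → (X →₀ ℤ)}
    (hd : ∀ g h, d (g * h) = d g + act g (d h)) (g : Raag G) : d g⁻¹ = - act g⁻¹ (d g) := by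
  have := hd g⁻¹ g
  rw [inv_mul_cancel, crossed_one hd] at this
  exact eq_neg_of_add_eq_zero_left this.symm

/-- two crossed homs agreeing on generators are equal, in equivariant-map form -/
lemma crossed_unique {X : Type} [MulAction (Raag G) X] {d e : Raag G → (X →₀ ℤ)}
    (hd : ∀ g h, d (g * h) = d g + act g (d h)) (he : ∀ g h, e (g * h) = e g + act g (e h))
    (h : ∀ v, d (gen G v) = e (gen G v)) (g : Raag G) : d g = e g := by
  have hg : g ∈ Subgroup.closure (Set.range (gen G)) := by rw [closure_gen]; trivial
  induction hg using Subgroup.closure_induction with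
  | mem x hx => obtain ⟨v, rfl⟩ := hx; exact h v
  | one => rw [crossed_one hd, crossed_one he]
  | mul a b _ _ ha hb => rw [hd, he, ha, hb]
  | inv a _ ha => rw [crossed_inv hd, crossed_inv he, ha]

/-- augmentation -/
noncomputable def aug {X : Type*} : (X →₀ ℤ) →+ ℤ := Finsupp.liftAddHom (fun _ => AddMonoidHom.id ℤ)

lemma aug_single {X : Type*} (x : X) (c : ℤ) : aug (Finsupp.single x c) = c := by simp [aug]

lemma aug_mapDomain {X Y : Type*} (f : X → Y) (n : X →₀ ℤ) :
    aug (Finsupp.mapDomain f n) = aug n := by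
  induction n using Finsupp.induction_linear with
  | zero => simp
  | add a b ha hb => rw [Finsupp.mapDomain_add, map_add, map_add, ha, hb]
  | single a c => rw [Finsupp.mapDomain_single, aug_single, aug_single]

lemma aug_crossed {X : Type} [MulAction (Raag G) X] {d : Raag G → (X →₀ ℤ)} {x₀ : X} {y : V}
    (hd : ∀ g h, d (g * h) = d g + act g (d h)) (h1 : d (gen G y) = Finsupp.single x₀ 1)
    (h2 : ∀ z, z ≠ y → d (gen G z) = 0) (g : Raag G) : aug (d g) = ex y g := by
  let F : Raag G →* Multiplicative ℤ :=
    { toFun := fun g => Multiplicative.ofAdd (aug (d g))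
      map_one' := by simp [crossed_one hd]
      map_mul' := by
        intro a b
        rw [hd, map_add, act_def, aug_mapDomain, ofAdd_add] }
  have : F = exHom G y := by
    apply raag_hom_ext
    intro v
    show Multiplicative.ofAdd (aug (d (gen G v))) = _
    by_cases h : v = y
    · subst h; simp [h1, aug_single, exHom]
    · simp [h2 v h, exHom, h]
  have h3 := DFunLike.congr_fun this g
  show (F g).toAdd = _
  rw [h3]; rfl

lemma exists_cycle {Y : Type*} (f : Y → Y) (n : Y →₀ ℤ) (hn : n ≠ 0)
    (h : Finsupp.mapDomain f n = n) : ∃ y ∈ n.support, ∃ i i' : ℕ, i < i' ∧ f^[i] y = f^[i'] y := by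
  classical
  have hsub : n.support ⊆ n.support.image f := by
    conv_lhs => rw [← h]
    exact Finsupp.mapDomain_support
  have heq : n.support = n.support.image f :=
    Finset.eq_of_subset_of_card_le hsub Finset.card_image_le
  obtain ⟨y, hy⟩ := Finsupp.support_nonempty_iff.2 hn
  have hit : ∀ i, f^[i] y ∈ n.support := by
    intro i
    induction i with
    | zero => exact hy
    | succ k ih =>
      rw [Function.iterate_succ_apply', heq]
      exact Finset.mem_image_of_mem f ih
  let φ : ℕ → n.support := fun i => ⟨f^[i] y, hit i⟩
  obtain ⟨i, j, hij, he⟩ := Finite.exists_ne_map_eq_of_infinite φ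
  have he' : f^[i] y = f^[j] y := congrArg Subtype.val he
  rcases lt_or_gt_of_ne hij with h' | h'
  · exact ⟨y, hy, i, j, h', he'⟩
  · exact ⟨y, hy, j, i, h', he'.symm⟩

lemma smul_iterate {A X : Type*} [Group A] [MulAction A X] (w : A) (i : ℕ) (x : X) :
    (fun x : X => w • x)^[i] x = w ^ i • x := by
  induction i with
  | zero => simp
  | succ k ih => rw [Function.iterate_succ_apply', ih, pow_succ', mul_smul]

lemma exists_vertex_crossed (y : V) :
    ∃ d : Raag G → ((Raag G ⧸ par G (G.neighborSet y)) →₀ ℤ),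
      (∀ g h, d (g * h) = d g + act g (d h)) ∧
      d (gen G y) = Finsupp.single ((1 : Raag G) : Raag G ⧸ par G (G.neighborSet y)) 1 ∧
      ∀ z, z ≠ y → d (gen G z) = 0 := by
  apply exists_crossed
  intro z hz
  show (((gen G z * 1 : Raag G)) : Raag G ⧸ par G (G.neighborSet y)) = _
  rw [mul_one, QuotientGroup.eq]
  simpa using gen_mem_par (G := G) (S := G.neighborSet y) hz

lemma exists_crossed_L {a : V} {d : Raag G → ((Raag G ⧸ par G (G.neighborSet a)) →₀ ℤ)}
    (hd : ∀ g h, d (g * h) = d g + act g (d h))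
    (h1 : d (gen G a) = Finsupp.single ((1 : Raag G) : Raag G ⧸ par G (G.neighborSet a)) 1)
    (h2 : ∀ z, z ≠ a → d (gen G z) = 0) :
    ∃ L : ((Raag G ⧸ par G (G.neighborSet a)) →₀ ℤ) →+ ((Raag G ⧸ par G ({a}ᶜ : Set V)) →₀ ℤ),
      (∀ (g : Raag G) n, L (act g n) = act g (L n)) ∧ (∀ n, aug (L n) = 0) ∧
      ∀ t, L (d t) = Finsupp.single (t : Raag G ⧸ par G ({a}ᶜ : Set V)) 1 -
        Finsupp.single ((1 : Raag G) : Raag G ⧸ par G ({a}ᶜ : Set V)) 1 := by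
  have hsub : G.neighborSet a ⊆ ({a}ᶜ : Set V) := by
    intro z hz
    rw [Set.mem_compl_singleton_iff]
    rintro rfl
    exact G.loopless.irrefl _ hz
  let L₀ : (Raag G ⧸ par G (G.neighborSet a)) → ((Raag G ⧸ par G ({a}ᶜ : Set V)) →₀ ℤ) :=
    Quotient.lift (fun k : Raag G => (Finsupp.single ((k * gen G a : Raag G) : Raag G ⧸ par G ({a}ᶜ : Set V)) 1
        - Finsupp.single ((k : Raag G) : Raag G ⧸ par G ({a}ᶜ : Set V)) 1)) (by
      intro k k' hkk
      have hkk' : k⁻¹ * k' ∈ par G (G.neighborSet a) := QuotientGroup.leftRel_apply.1 hkk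
      have e1 : ((k : Raag G) : Raag G ⧸ par G ({a}ᶜ : Set V)) = k' := by
        rw [QuotientGroup.eq]; exact par_mono hsub hkk'
      have hc : Commute (gen G a) (k⁻¹ * k') := by
        refine par_commute (T₁ := {a}) (T₂ := G.neighborSet a) ?_ (gen_mem_par rfl) hkk'
        rintro u rfl v hv
        exact hv
      have e2 : ((k * gen G a : Raag G) : Raag G ⧸ par G ({a}ᶜ : Set V)) = (k' * gen G a : Raag G) := by
        rw [QuotientGroup.eq]
        have : (k * gen G a)⁻¹ * (k' * gen G a) = k⁻¹ * k' := by
          have := hc.eq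
          rw [mul_inv_rev]
          calc (gen G a)⁻¹ * k⁻¹ * (k' * gen G a) = (gen G a)⁻¹ * ((k⁻¹ * k') * gen G a) := by group
            _ = k⁻¹ * k' := by rw [← this]; group
        rw [this]; exact par_mono hsub hkk'
      simp only [e1, e2])
  have hL₀ : ∀ k : Raag G, L₀ (k : Raag G ⧸ par G (G.neighborSet a)) =
      (Finsupp.single ((k * gen G a : Raag G) : Raag G ⧸ par G ({a}ᶜ : Set V)) 1
        - Finsupp.single ((k : Raag G) : Raag G ⧸ par G ({a}ᶜ : Set V)) 1) := fun k => rfl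
  let L : ((Raag G ⧸ par G (G.neighborSet a)) →₀ ℤ) →+ ((Raag G ⧸ par G ({a}ᶜ : Set V)) →₀ ℤ) :=
    Finsupp.liftAddHom (fun x => (zmultiplesHom _ (L₀ x)))
  have hLs : ∀ x c, L (Finsupp.single x c) = c • L₀ x := by
    intro x c; simp [L]
  have hLact : ∀ (g : Raag G) n, L (act g n) = act g (L n) := by
    intro g n
    induction n using Finsupp.induction_linear with
    | zero => simp
    | add a b ha hb => simp only [map_add, ha, hb]
    | single x c =>
      rw [act_single, hLs, hLs, map_zsmul]
      congr 1
      induction x using QuotientGroup.induction_on with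
      | H k =>
        have : g • (k : Raag G ⧸ par G (G.neighborSet a)) = ((g * k : Raag G) : Raag G ⧸ par G (G.neighborSet a)) := rfl
        rw [this, hL₀, hL₀, map_sub, act_single, act_single]
        rw [mul_assoc]
        rfl
  let e : Raag G → ((Raag G ⧸ par G ({a}ᶜ : Set V)) →₀ ℤ) := fun t =>
    Finsupp.single (t : Raag G ⧸ par G ({a}ᶜ : Set V)) 1 -
      Finsupp.single ((1 : Raag G) : Raag G ⧸ par G ({a}ᶜ : Set V)) 1
  have key : ∀ t, L (d t) = e t := by
    intro t
    refine crossed_unique (d := fun t => L (d t)) (e := e) ?_ ?_ ?_ t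
    · intro g h
      simp only [hd, map_add, hLact]
    · intro g h
      simp only [e, map_sub, act_single]
      have e1 : g • (h : Raag G ⧸ par G ({a}ᶜ : Set V)) = ((g * h : Raag G) : Raag G ⧸ par G ({a}ᶜ : Set V)) := rfl
      have e2 : g • ((1 : Raag G) : Raag G ⧸ par G ({a}ᶜ : Set V)) = ((g : Raag G) : Raag G ⧸ par G ({a}ᶜ : Set V)) := by
        show ((g * 1 : Raag G) : Raag G ⧸ par G ({a}ᶜ : Set V)) = _
        rw [mul_one]
      rw [e1, e2]
      abel
    · intro v
      by_cases hv : v = a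
      · subst hv
        simp only [h1, hLs, hL₀, e, one_smul, one_mul]
      · simp only [h2 v hv, map_zero, e]
        symm
        rw [sub_eq_zero]
        congr 1
        rw [QuotientGroup.eq]
        simpa using gen_mem_par (G := G) (S := ({a}ᶜ : Set V)) hv
  refine ⟨L, hLact, ?_, key⟩
  intro n
  induction n using Finsupp.induction_linear with
  | zero => simp
  | add a b ha hb => simp only [map_add, ha, hb, add_zero]
  | single x c =>
    induction x using QuotientGroup.induction_on with
    | H k => rw [hLs, hL₀, map_zsmul, map_sub, aug_single, aug_single, sub_self, smul_zero]

lemma mem_par_of_crossed_zero {a : V} {d : Raag G → ((Raag G ⧸ par G (G.neighborSet a)) →₀ ℤ)}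
    (hd : ∀ g h, d (g * h) = d g + act g (d h))
    (h1 : d (gen G a) = Finsupp.single ((1 : Raag G) : Raag G ⧸ par G (G.neighborSet a)) 1)
    (h2 : ∀ z, z ≠ a → d (gen G z) = 0) {t : Raag G} (ht : d t = 0) : t ∈ par G {a}ᶜ := by
  obtain ⟨L, -, -, key⟩ := exists_crossed_L hd h1 h2
  have h3 := key t
  rw [ht, map_zero] at h3
  have h4 := (sub_eq_zero.1 h3.symm)
  have h5 := Finsupp.single_left_injective (one_ne_zero) h4
  rw [QuotientGroup.eq] at h5
  simpa using h5

lemma mem_par_of_forall [Finite V] {S : Set V} {t : Raag G} (h : ∀ a ∉ S, t ∈ par G {a}ᶜ) :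
    t ∈ par G S := by
  have key : ∀ F : Set V, F.Finite → F ⊆ Sᶜ → t ∈ par G Fᶜ := by
    intro F hF
    induction F, hF using Set.Finite.induction_on with
    | empty => intro _; rw [Set.compl_empty, par_univ]; trivial
    | @insert a s ha hs ih =>
      intro hsub
      have : (insert a s)ᶜ = ({a}ᶜ ∩ sᶜ : Set V) := by
        ext x; simp
      rw [this]
      exact mem_par_inter (h a (hsub (by simp))) (ih (fun x hx => hsub (by simp [hx])))
  have := key Sᶜ (Set.toFinite _) le_rfl
  rwa [compl_compl] at this

/-- Centralizers of generators. -/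
lemma mem_par_star_of_commute_pow [Finite V] {v : V} {t : Raag G} {j : ℕ} (hj : 1 ≤ j)
    (h : Commute t (gen G v ^ j)) : t ∈ par G (star G v) := by
  apply mem_par_of_forall
  intro a ha
  have hav : v ≠ a := by rintro rfl; exact ha (Set.mem_insert _ _)
  have hadj : ¬ G.Adj v a := fun h => ha (Set.mem_insert_of_mem _ h)
  obtain ⟨d, hd, h1, h2⟩ := exists_vertex_crossed (G := G) a
  apply mem_par_of_crossed_zero hd h1 h2
  by_contra hne
  have hvj : d (gen G v ^ j) = 0 := by
    clear h hj
    induction j with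
    | zero => simpa using crossed_one hd
    | succ n ih => rw [pow_succ, hd, ih, h2 v hav, map_zero, add_zero]
  have hinv : Finsupp.mapDomain (fun x => gen G v ^ j • x) (d t) = d t := by
    have e1 := hd t (gen G v ^ j)
    rw [h.eq, hd, hvj] at e1
    simpa [act_def] using e1
  obtain ⟨x, -, i, i', hii, hx⟩ := exists_cycle _ _ hne hinv
  rw [smul_iterate, smul_iterate] at hx
  induction x using QuotientGroup.induction_on with
  | H k =>
    have hx' : (((gen G v ^ j) ^ i * k : Raag G) : Raag G ⧸ par G (G.neighborSet a)) = ((gen G v ^ j) ^ i' * k : Raag G) := hx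
    rw [QuotientGroup.eq] at hx'
    have := ex_of_par (a := v) (fun hh => hadj (G.adj_symm hh)) hx'
    simp at this
    have h5 : ((i' : ℤ) - i) * j = 0 := by linarith
    rcases mul_eq_zero.1 h5 with h6 | h6 <;> omega

lemma mem_par_star_of_commute [Finite V] {v : V} {t : Raag G} (h : Commute t (gen G v)) :
    t ∈ par G (star G v) :=
  mem_par_star_of_commute_pow (j := 1) le_rfl (by simpa using h)

lemma commute_of_mem_par_star {v : V} {t : Raag G} (h : t ∈ par G (star G v)) :
    Commute t (gen G v) := by
  rw [par_eq_closure] at h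
  induction h using Subgroup.closure_induction with
  | mem x hx =>
    obtain ⟨u, hu, rfl⟩ := hx
    rcases hu with rfl | hu
    · exact Commute.refl _
    · exact (gen_comm hu).symm
  | one => exact Commute.one_left _
  | mul a b _ _ ha hb => exact ha.mul_left hb
  | inv a _ ha => exact ha.inv_left

lemma lemmaC {y : V} {g w : Raag G} (h : Commute g w) (hw : ex y w = 0) (hg : ex y g = 1) :
    ∃ (j : ℕ) (k : Raag G), 1 ≤ j ∧ k⁻¹ * w ^ j * k ∈ par G (G.neighborSet y) := by
  obtain ⟨d, hd, h1, h2⟩ := exists_vertex_crossed (G := G) y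
  let r : Setoid (Raag G ⧸ par G (G.neighborSet y)) :=
    { r := fun x x' => ∃ m : ℤ, x' = g ^ m • x
      iseqv := ⟨fun x => ⟨0, by simp⟩, by
          rintro x x' ⟨m, rfl⟩; exact ⟨-m, by simp⟩, by
          rintro x x' x'' ⟨m, rfl⟩ ⟨m', rfl⟩; exact ⟨m' + m, by rw [zpow_add, mul_smul]⟩⟩ }
  let f : (Raag G ⧸ par G (G.neighborSet y)) → Quotient r := Quotient.mk r
  have hrel : ∀ x x', f x = f x' ↔ ∃ m : ℤ, x' = g ^ m • x := by
    intro x x'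
    exact Quotient.eq
  let wb : Quotient r → Quotient r := Quotient.map (fun x => w • x) (by
    rintro x x' ⟨m, rfl⟩
    refine ⟨m, ?_⟩
    show w • _ = g ^ m • w • x
    rw [← mul_smul, ← mul_smul, (h.zpow_left m).eq])
  have hwb : ∀ x, wb (f x) = f (w • x) := fun x => rfl
  have hfg : ∀ n : (Raag G ⧸ par G (G.neighborSet y)) →₀ ℤ,
      Finsupp.mapDomain f (act g n) = Finsupp.mapDomain f n := by
    intro n
    rw [act_def, ← Finsupp.mapDomain_comp]
    congr 1
    funext x
    refine ((hrel _ _).2 ⟨1, ?_⟩).symm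
    simp
  have hfw : ∀ n : (Raag G ⧸ par G (G.neighborSet y)) →₀ ℤ,
      Finsupp.mapDomain f (act w n) = Finsupp.mapDomain wb (Finsupp.mapDomain f n) := by
    intro n
    rw [act_def, ← Finsupp.mapDomain_comp, ← Finsupp.mapDomain_comp]
    rfl
  have hinv : Finsupp.mapDomain wb (Finsupp.mapDomain f (d g)) = Finsupp.mapDomain f (d g) := by
    have e1 := hd g w
    rw [h.eq, hd] at e1
    have e2 := congrArg (Finsupp.mapDomain f) e1
    rw [Finsupp.mapDomain_add, Finsupp.mapDomain_add, hfg, hfw, add_comm] at e2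
    exact add_right_cancel e2
  have hne : Finsupp.mapDomain f (d g) ≠ 0 := by
    intro h0
    have := aug_crossed hd h1 h2 g
    rw [hg, ← aug_mapDomain f, h0] at this
    simp at this
  obtain ⟨xb, -, i, i', hii, hx⟩ := exists_cycle _ _ hne hinv
  induction xb using Quotient.inductionOn with
  | h x =>
  have hit : ∀ n : ℕ, wb^[n] (f x) = f (w ^ n • x) := by
    intro n
    induction n with
    | zero => simp
    | succ m ih => rw [Function.iterate_succ_apply', ih, hwb, pow_succ', mul_smul]
  change wb^[i] (f x) = wb^[i'] (f x) at hx
  rw [hit, hit, hrel] at hx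
  obtain ⟨m, hm⟩ := hx
  induction x using QuotientGroup.induction_on with
  | H k =>
    have hx' : ((w ^ i' * k : Raag G) : Raag G ⧸ par G (G.neighborSet y)) = (g ^ m * (w ^ i * k) : Raag G) := hm
    rw [QuotientGroup.eq] at hx'
    have := ex_of_par (a := y) (fun hh => G.loopless.irrefl _ hh) hx'
    simp [hw, hg] at this
    subst this
    refine ⟨i' - i, k, by omega, ?_⟩
    have e3 : w ^ i' = w ^ i * w ^ (i' - i) := by rw [← pow_add]; congr 1; omega
    have e4 := inv_mem hx'
    have e5 : ((w ^ i' * k)⁻¹ * (g ^ (0:ℤ) * (w ^ i * k)))⁻¹ = k⁻¹ * w ^ (i' - i) * k := by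
      rw [e3]; group
    rwa [e5] at e4

end Crossed

end RaagPaper

open SimpleGraph

namespace RaagPaper

section Torsion

variable {V : Type} {G : SimpleGraph V}

lemma ker_mapDomain {X Y : Type*} (f : X → Y) (R : AddSubgroup (X →₀ ℤ))
    (hR : ∀ x x', f x = f x' → Finsupp.single x 1 - Finsupp.single x' 1 ∈ R)
    (n : X →₀ ℤ) (hn : Finsupp.mapDomain f n = 0) : n ∈ R := by
  classical
  by_cases hX : Nonempty X
  swap
  · have : IsEmpty X := not_nonempty_iff.1 hX
    rw [Subsingleton.elim n 0]; exact zero_mem _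
  let s : Y → X := Function.invFun f
  have hs : ∀ x, f (s (f x)) = f x := fun x => Function.invFun_eq ⟨x, rfl⟩
  have key : ∀ m : X →₀ ℤ, m - Finsupp.mapDomain s (Finsupp.mapDomain f m) ∈ R := by
    intro m
    induction m using Finsupp.induction_linear with
    | zero => simp
    | add a b ha hb =>
      have := add_mem ha hb
      simp only [Finsupp.mapDomain_add]
      convert this using 1
      abel
    | single x c =>
      simp only [Finsupp.mapDomain_single]
      have := zsmul_mem (hR x (s (f x)) (hs x).symm) c
      simpa [smul_sub] using this
  have := key n
  rw [hn] at this
  simpa using this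

lemma aug_dvd {A Y : Type*} [Group A] [MulAction A Y] {u : A} {p : ℕ}
    (hu : u ^ p = 1) (hp : 0 < p) (hfree : ∀ (y : Y) (i : ℕ), 0 < i → i < p → u ^ i • y ≠ y)
    (I : Y →₀ ℤ) (hI : act u I = I) : (p : ℤ) ∣ aug I := by
  classical
  let r : Setoid Y :=
    { r := fun x x' => ∃ m : ℤ, x' = u ^ m • x
      iseqv := ⟨fun x => ⟨0, by simp⟩, by
          rintro x x' ⟨m, rfl⟩; exact ⟨-m, by simp⟩, by
          rintro x x' x'' ⟨m, rfl⟩ ⟨m', rfl⟩; exact ⟨m' + m, by rw [zpow_add, mul_smul]⟩⟩ }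
  let s : Y → Y := fun y => (Quotient.mk r y).out
  have hs1 : ∀ y, ∃ i : ℕ, i < p ∧ u ^ i • s y = y := by
    intro y
    have : r (s y) y := Quotient.exact (Quotient.out_eq (Quotient.mk r y))
    obtain ⟨m, hm⟩ := this
    have hmod := Int.emod_nonneg m (by omega : (p : ℤ) ≠ 0)
    have hlt := Int.emod_lt_of_pos m (by omega : (0 : ℤ) < p)
    refine ⟨(m % p).toNat, by omega, ?_⟩
    conv_rhs => rw [hm]
    congr 1
    rw [← zpow_natCast, Int.toNat_of_nonneg hmod]
    conv_rhs => rw [← Int.emod_add_mul_ediv m p, zpow_add, zpow_mul, zpow_natCast, hu, one_zpow, mul_one]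
  have hs2 : ∀ y (m : ℕ), s (u ^ m • y) = s y := by
    intro y m
    have : Quotient.mk r (u ^ m • y) = Quotient.mk r y :=
      Quotient.sound (r.iseqv.symm ⟨m, by simp⟩)
    simp only [s, this]
  have hIu : ∀ (m : ℕ) y, I (u ^ m • y) = I y := by
    have h1 : ∀ y, I (u • y) = I y := by
      intro y
      conv_lhs => rw [← hI, act_def]
      exact Finsupp.mapDomain_apply (MulAction.injective u) I y
    intro m
    induction m with
    | zero => simp
    | succ k ih => intro y; rw [pow_succ', mul_smul, h1, ih]
  let J : Y →₀ ℤ := I.filter (fun y => s y = y)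
  have hJ : I = ∑ i ∈ Finset.range p, act (u ^ i) J := by
    ext y
    rw [Finsupp.finsetSum_apply]
    obtain ⟨i₀, hi₀, hy⟩ := hs1 y
    have hss : s (s y) = s y := by
      have := hs2 (s y) i₀
      rw [hy] at this
      exact this.symm
    have hact : ∀ i, act (u ^ i) J (u ^ i • s y) = J (s y) := fun i =>
      Finsupp.mapDomain_apply (MulAction.injective (u ^ i)) J (s y)
    rw [Finset.sum_eq_single i₀]
    · conv_rhs => rw [← hy]
      have e1 : s (u ^ i₀ • s y) = s y := by rw [hs2, hss]
      have := hact i₀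
      rw [this]
      simp only [J, Finsupp.filter_apply, hss, if_true]
      conv_lhs => rw [← hy]
      rw [hIu]
    · intro i hi hne
      have hi' := Finset.mem_range.1 hi
      -- y = u^i • x for x := u^(p-i) • y
      have hyx : y = u ^ i • (u ^ (p - i) • y) := by
        rw [← mul_smul, ← pow_add, show i + (p - i) = p by omega, hu, one_smul]
      rw [hyx]
      have : act (u ^ i) J (u ^ i • (u ^ (p - i) • y)) = J (u ^ (p - i) • y) :=
        Finsupp.mapDomain_apply (MulAction.injective (u ^ i)) J _
      rw [this]
      simp only [J, Finsupp.filter_apply]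
      rw [if_neg]
      rw [hs2]
      intro hc
      have hc2 : u ^ i • s y = y := by rw [hc]; exact hyx.symm
      rw [← hy] at hc2
      rw [hs2, hss] at hc2
      -- u^i • s y = u^i₀ • s y
      rcases lt_or_gt_of_ne hne with h | h
      · apply hfree (s y) (i₀ - i) (by omega) (by omega)
        apply MulAction.injective (u ^ i)
        show u ^ i • _ = u ^ i • _
        rw [hc2]
        rw [← mul_smul, ← pow_add]; congr 2; omega
      · apply hfree (s y) (i - i₀) (by omega) (by omega)
        apply MulAction.injective (u ^ i₀)
        show u ^ i₀ • _ = u ^ i₀ • _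
        rw [← hc2]
        rw [← mul_smul, ← pow_add]; congr 2; omega
    · intro h
      exact absurd (Finset.mem_range.2 hi₀) h
  rw [hJ, map_sum]
  simp only [act_def, aug_mapDomain, Finset.sum_const, Finset.card_range, nsmul_eq_mul]
  exact dvd_mul_right _ _

lemma torsion_step {u : Raag G} {p : ℕ} (hp : p.Prime) (hu : u ^ p = 1) {b : V}
    (hb : ret G {b}ᶜ u = 1) : u = 1 := by
  by_contra hne
  have hord : orderOf u = p := by
    have : Fact p.Prime := ⟨hp⟩
    exact orderOf_eq_prime hu hne
  obtain ⟨d, hd, h1, h2⟩ := exists_vertex_crossed (G := G) b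
  obtain ⟨L, hL1, hL2, hL3⟩ := exists_crossed_L hd h1 h2
  let r : Setoid (Raag G ⧸ par G (G.neighborSet b)) :=
    { r := fun x x' => ∃ m : ℤ, x' = u ^ m • x
      iseqv := ⟨fun x => ⟨0, by simp⟩, by
          rintro x x' ⟨m, rfl⟩; exact ⟨-m, by simp⟩, by
          rintro x x' x'' ⟨m, rfl⟩ ⟨m', rfl⟩; exact ⟨m' + m, by rw [zpow_add, mul_smul]⟩⟩ }
  let f : (Raag G ⧸ par G (G.neighborSet b)) → Quotient r := Quotient.mk r
  have hfu : ∀ n : (Raag G ⧸ par G (G.neighborSet b)) →₀ ℤ,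
      Finsupp.mapDomain f (act u n) = Finsupp.mapDomain f n := by
    intro n
    rw [act_def, ← Finsupp.mapDomain_comp]
    congr 1
    funext x
    exact Quotient.sound (r.iseqv.symm ⟨1, by simp⟩)
  have hpow : ∀ i : ℕ, Finsupp.mapDomain f (d (u ^ i)) = i • Finsupp.mapDomain f (d u) := by
    intro i
    induction i with
    | zero => simp [crossed_one hd]
    | succ k ih => rw [pow_succ', hd, Finsupp.mapDomain_add, hfu, ih, succ_nsmul, add_comm]
  have hzero : Finsupp.mapDomain f (d u) = 0 := by
    have := hpow p
    rw [hu, crossed_one hd, Finsupp.mapDomain_zero] at this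
    exact (smul_eq_zero.1 this.symm).resolve_left hp.ne_zero
  let D : ((Raag G ⧸ par G (G.neighborSet b)) →₀ ℤ) →+ ((Raag G ⧸ par G (G.neighborSet b)) →₀ ℤ) :=
    act u - AddMonoidHom.id _
  have hmem : d u ∈ D.range := by
    apply ker_mapDomain f _ _ _ hzero
    have hnat : ∀ (i : ℕ) x, Finsupp.single (u ^ i • x) 1 - Finsupp.single x 1 ∈ D.range := by
      intro i x
      induction i with
      | zero => simp
      | succ k ih =>
        have e : Finsupp.single (u ^ (k + 1) • x) 1 - Finsupp.single (u ^ k • x) 1 ∈ D.range := by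
          refine ⟨Finsupp.single (u ^ k • x) 1, ?_⟩
          simp only [D, AddMonoidHom.sub_apply, act_single, AddMonoidHom.id_apply]
          rw [← mul_smul, ← pow_succ']
        have := add_mem e ih
        simpa using this
    intro x x' hxx
    obtain ⟨m, hm⟩ : ∃ m : ℤ, x' = u ^ m • x := Quotient.exact hxx
    rcases Int.eq_nat_or_neg m with ⟨k, rfl | rfl⟩
    · rw [hm, ← neg_sub, zpow_natCast]
      exact neg_mem (hnat k x)
    · have : x = u ^ k • x' := by rw [hm]; simp
      rw [this]
      exact hnat k x'
  obtain ⟨m, hm⟩ := hmem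
  have hinv : act u (Finsupp.single ((1 : Raag G) : Raag G ⧸ par G ({b}ᶜ : Set V)) 1 - L m) =
      Finsupp.single ((1 : Raag G) : Raag G ⧸ par G ({b}ᶜ : Set V)) 1 - L m := by
    have e := hL3 u
    rw [← hm] at e
    simp only [D, AddMonoidHom.sub_apply, AddMonoidHom.id_apply, map_sub, hL1] at e
    rw [map_sub, act_single]
    have e2 : u • ((1 : Raag G) : Raag G ⧸ par G ({b}ᶜ : Set V)) = (u : Raag G ⧸ par G ({b}ᶜ : Set V)) := by
      show ((u * 1 : Raag G) : Raag G ⧸ par G ({b}ᶜ : Set V)) = _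
      rw [mul_one]
    rw [e2]
    have e3 := sub_eq_sub_iff_add_eq_add.1 e
    rw [sub_eq_sub_iff_add_eq_add, ← e3, add_comm]
  have hdvd := aug_dvd hu hp.pos ?_ _ hinv
  · rw [map_sub, aug_single, hL2] at hdvd
    have := Int.natCast_dvd_natCast.1 (by simpa using hdvd : (p : ℤ) ∣ ((1 : ℕ) : ℤ))
    exact hp.one_lt.ne' (Nat.dvd_one.1 this)
  · intro y i hi hip hfix
    induction y using QuotientGroup.induction_on with
    | H k =>
      have hx' : ((u ^ i * k : Raag G) : Raag G ⧸ par G ({b}ᶜ : Set V)) = (k : Raag G) := hfix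
      rw [QuotientGroup.eq, mem_par] at hx'
      simp [hb] at hx'
      have h3 : u ^ i = 1 := by
        first
        | exact hx'
        | (have h4 : k⁻¹ * (u ^ i)⁻¹ * k = 1 := by rw [← hx']
           have h5 : (u ^ i)⁻¹ = 1 := by
             have := congrArg (fun z => k * z * k⁻¹) h4
             simpa [mul_assoc] using this
           simpa using h5)
      have := orderOf_dvd_of_pow_eq_one h3
      rw [hord] at this
      exact absurd (Nat.le_of_dvd hi this) (by omega)

lemma torsion_prime [Finite V] {u : Raag G} {p : ℕ} (hp : p.Prime) (hu : u ^ p = 1) : u = 1 := by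
  have key : ∀ F : Set V, F.Finite → ret G F u = 1 := by
    intro F hF
    induction F, hF using Set.Finite.induction_on with
    | empty => exact ret_empty u
    | @insert a s ha hs ih =>
      apply torsion_step hp (b := a)
      · rw [← map_pow, hu, map_one]
      · rw [ret_ret]
        have : ({a}ᶜ ∩ insert a s : Set V) = s := by
          ext x; simp only [Set.mem_inter_iff, Set.mem_compl_iff, Set.mem_singleton_iff, Set.mem_insert_iff]
          constructor
          · rintro ⟨h, h' | h'⟩
            · exact absurd h' h
            · exact h'
          · intro h
            exact ⟨by rintro rfl; exact ha h, Or.inr h⟩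
        rw [this, ih]
  rw [← ret_univ u]
  exact key _ (Set.toFinite _)

lemma torsion_free [Finite V] {j : ℕ} (hj : 1 ≤ j) : ∀ {u : Raag G}, u ^ j = 1 → u = 1 := by
  induction j using Nat.recOnMul with
  | zero => omega
  | one => intro u hu; simpa using hu
  | prime p hp => intro u hu; exact torsion_prime hp hu
  | mul a b ha hb =>
    intro u hu
    have ha' : 1 ≤ a := Nat.pos_of_ne_zero (by rintro rfl; simp at hj)
    have hb' : 1 ≤ b := Nat.pos_of_ne_zero (by rintro rfl; simp at hj)
    rw [pow_mul] at hu
    exact ha ha' (hb hb' hu)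

lemma star_eq (v : V) : star G v = {v} ∪ G.neighborSet v := rfl

lemma ret_star (v : V) (t : Raag G) : ret G (star G v) t = gen G v ^ ex v t * ret G (G.neighborSet v) t := by
  rw [star_eq, ret_join, ret_singleton]
  rintro u rfl w hw
  exact hw

/-- uniqueness of roots of powers of generators -/
lemma root_gen [Finite V] {v : V} {t : Raag G} {j : ℕ} (hj : 1 ≤ j) (h : t ^ j = gen G v ^ j) :
    t = gen G v := by
  have hc : Commute t (gen G v ^ j) := by rw [← h]; exact Commute.self_pow t j
  have ht := mem_par_star_of_commute_pow hj hc
  have e : ex v t = 1 := by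
    have := congrArg (ex v) h
    simp only [ex_pow, ex_gen_self] at this
    exact mul_left_cancel₀ (by exact_mod_cast (by omega : j ≠ 0)) this
  rw [mem_par, ret_star, e, zpow_one] at ht
  have hcomm : Commute (gen G v) (ret G (G.neighborSet v) t) := by
    refine par_commute (T₁ := {v}) (T₂ := G.neighborSet v) ?_ (gen_mem_par rfl) (ret_mem_par _ _)
    rintro u rfl w hw
    exact hw
  have hu : (ret G (G.neighborSet v) t) ^ j = 1 := by
    rw [← ht, hcomm.mul_pow] at h
    simpa using h
  have := torsion_free hj hu
  rw [this, mul_one] at ht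
  exact ht.symm

lemma root_conj_gen [Finite V] {v : V} {t k : Raag G} {j : ℕ} (hj : 1 ≤ j)
    (h : t ^ j = k⁻¹ * gen G v ^ j * k) : t = k⁻¹ * gen G v * k := by
  have : (k * t * k⁻¹) ^ j = gen G v ^ j := by
    rw [conj_pow, h]; group
  have := root_gen hj this
  rw [← this]; group

end Torsion

end RaagPaper

open SimpleGraph

namespace RaagPaper

section Support

variable {V : Type} {G : SimpleGraph V}

/-- vertices whose link contains the link of `v` -/
def upSet (G : SimpleGraph V) (v : V) : Set V := {s | G.neighborSet v ⊆ G.neighborSet s}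

lemma self_mem_upSet (v : V) : v ∈ upSet G v := fun _ h => h

lemma not_adj_of_mem_upSet {v s : V} (h : s ∈ upSet G v) : ¬ G.Adj v s := fun hh =>
  G.loopless.irrefl s (h hh)

lemma support_lemma [Finite V] {φ : MulAut (Raag G)} (hφ : IsIA φ) (v : V) :
    ∃ (j : ℕ) (k : Raag G), 1 ≤ j ∧ k⁻¹ * φ (gen G v) ^ j * k ∈ par G (upSet G v) := by
  let P : Set V → Prop := fun S => ∃ (j : ℕ) (k : Raag G), 1 ≤ j ∧ k⁻¹ * φ (gen G v) ^ j * k ∈ par G S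
  have hne : {S | P S}.Nonempty := ⟨Set.univ, 1, 1, le_rfl, by rw [par_univ]; trivial⟩
  obtain ⟨S, hS⟩ := (Set.toFinite {S | P S}).exists_minimal hne
  obtain ⟨j, k, hj, hk⟩ := hS.1
  refine ⟨j, k, hj, par_mono ?_ hk⟩
  intro s hs y hy
  have hPy : P (G.neighborSet y ∩ S) := by
    have hyv : y ≠ v := by rintro rfl; exact G.loopless.irrefl _ hy
    have hc : Commute (k⁻¹ * φ (gen G y) * k) (k⁻¹ * φ (gen G v) ^ j * k) := by
      have h1 : Commute (φ (gen G y)) (φ (gen G v) ^ j) :=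
        Commute.pow_right ((gen_comm (G := G) hy).symm.map φ) j
      have h2 := h1.map (MulAut.conj k⁻¹)
      simpa [MulAut.conj_apply] using h2
    obtain ⟨i, l, hi, hl⟩ := lemmaC (y := y) hc (by
      simp [hφ y, ex_gen_ne hyv.symm]) (by simp [hφ y])
    have e1 := mem_par.1 hl
    refine ⟨j * i, k * l * (ret G (G.neighborSet y) l)⁻¹, Nat.mul_pos hj hi, ?_⟩
    have e2 : (k * l * (ret G (G.neighborSet y) l)⁻¹)⁻¹ * φ (gen G v) ^ (j * i) *
        (k * l * (ret G (G.neighborSet y) l)⁻¹) =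
        ret G (G.neighborSet y) ((k⁻¹ * φ (gen G v) ^ j * k) ^ i) := by
      have e3 : (k⁻¹ * φ (gen G v) ^ j * k) ^ i = k⁻¹ * φ (gen G v) ^ (j * i) * k := by
        have := conj_pow (a := k⁻¹) (b := φ (gen G v) ^ j) (i := i)
        rw [inv_inv] at this
        rw [this, pow_mul]
      rw [e3] at e1 ⊢
      simp only [map_mul, map_inv] at e1 ⊢
      set r := ret G (G.neighborSet y) l
      set X := ret G (G.neighborSet y) k
      set Y := ret G (G.neighborSet y) (φ (gen G v) ^ (j * i))
      calc _ = r * (l⁻¹ * (k⁻¹ * φ (gen G v) ^ (j * i) * k) * l) * r⁻¹ := by group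
        _ = _ := by rw [← e1]; group
    rw [e2]
    exact ret_mem_par_inter (pow_mem hk i)
  have hle : (G.neighborSet y ∩ S) ≤ S := Set.inter_subset_right
  have := hS.2 hPy hle
  exact (this hs).1.symm

lemma reachable_isolated {W : Type*} {H : SimpleGraph W} {u w : W} (hu : ∀ x, ¬ H.Adj u x)
    (h : H.Reachable u w) : u = w := by
  obtain ⟨p⟩ := h
  cases p with
  | nil => rfl
  | cons h' _ => exact absurd h' (hu _)

lemma upSet_clique (hno : HasNoSIL G) {v s s' : V} (hs : s ∈ upSet G v) (hs' : s' ∈ upSet G v)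
    (hsv : s ≠ v) (hsv' : s' ≠ v) (hss : s ≠ s') : G.Adj s s' := by
  by_contra hadj
  refine hno s s' v ⟨hss, hsv, hsv', hadj, fun h => not_adj_of_mem_upSet hs h.symm,
    fun h => not_adj_of_mem_upSet hs' h.symm, ?_⟩
  rintro C ⟨x, rfl⟩ ⟨hv, hvx⟩
  have hiso : ∀ z, ¬ (G.induce ((G.neighborSet s ∩ G.neighborSet s')ᶜ)).Adj ⟨v, hv⟩ z := by
    rintro ⟨z, hz⟩ hadj'
    apply hz
    have : G.Adj v z := hadj'
    exact ⟨hs this, hs' this⟩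
  have hx := reachable_isolated hiso hvx
  subst hx
  constructor
  · rintro ⟨h, hr⟩
    have := reachable_isolated hiso hr.symm
    exact hsv (congrArg Subtype.val this).symm
  · rintro ⟨h, hr⟩
    have := reachable_isolated hiso hr.symm
    exact hsv' (congrArg Subtype.val this).symm

end Support

end RaagPaper

open SimpleGraph

namespace RaagPaper

section Alt

variable {K : Type*} [Group K]

/-- product of a list of pairs -/
def pp (L : List (K × K)) : K := (L.map (fun p => p.1 * p.2)).prod

@[simp] lemma pp_nil : pp ([] : List (K × K)) = 1 := rfl
@[simp] lemma pp_cons (p : K × K) (L : List (K × K)) : pp (p :: L) = p.1 * p.2 * pp L := by simp [pp]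
@[simp] lemma pp_append (L L' : List (K × K)) : pp (L ++ L') = pp L * pp L' := by simp [pp]

/-- good lists -/
def GoodL (H₁ H₂ : Subgroup K) (L : List (K × K)) : Prop :=
  ∀ p ∈ L, (p.1 ∈ H₂ ∧ p.1 ≠ 1) ∧ (p.2 ∈ H₁ ∧ p.2 ≠ 1)

lemma alt_form {H₁ H₂ : Subgroup K} {g : K} (hg : g ∈ H₁ ⊔ H₂) :
    ∃ (α : K) (L : List (K × K)) (β : K), α ∈ H₁ ∧ β ∈ H₂ ∧ GoodL H₁ H₂ L ∧ g = α * pp L * β := by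
  classical
  let P : K → Prop := fun g =>
    ∃ (α : K) (L : List (K × K)) (β : K), α ∈ H₁ ∧ β ∈ H₂ ∧ GoodL H₁ H₂ L ∧ g = α * pp L * β
  have h2 : ∀ g h, P g → h ∈ H₂ → P (g * h) := by
    rintro g h ⟨α, L, β, hα, hβ, hL, rfl⟩ hh
    exact ⟨α, L, β * h, hα, mul_mem hβ hh, hL, by simp [mul_assoc]⟩
  have h1 : ∀ g h, P g → h ∈ H₁ → P (g * h) := by
    rintro g h ⟨α, L, β, hα, hβ, hL, rfl⟩ hh
    by_cases hh1 : h = 1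
    · subst hh1; exact ⟨α, L, β, hα, hβ, hL, by simp⟩
    by_cases hβ1 : β = 1
    · subst hβ1
      rcases List.eq_nil_or_concat L with rfl | ⟨L', ⟨b, a⟩, rfl⟩
      · exact ⟨α * h, [], 1, mul_mem hα hh, one_mem _, hL, by simp⟩
      · have hL' : GoodL H₁ H₂ L' := fun p hp => hL p (by simp [hp])
        have hba := hL (b, a) (by simp)
        by_cases hah : a * h = 1
        · refine ⟨α, L', b, hα, hba.1.1, hL', ?_⟩
          simp [mul_assoc, hah]
        · refine ⟨α, L' ++ [(b, a * h)], 1, hα, one_mem _, ?_, by simp [mul_assoc]⟩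
          intro p hp
          rw [List.mem_append, List.mem_singleton] at hp
          rcases hp with hp | rfl
          · exact hL' p hp
          · exact ⟨hba.1, mul_mem hba.2.1 hh, hah⟩
    · refine ⟨α, L ++ [(β, h)], 1, hα, one_mem _, ?_, by simp [mul_assoc]⟩
      intro p hp
      rw [List.mem_append, List.mem_singleton] at hp
      rcases hp with hp | rfl
      · exact hL p hp
      · exact ⟨⟨hβ, hβ1⟩, hh, hh1⟩
  rw [Subgroup.sup_eq_closure] at hg
  show P g
  induction hg using Subgroup.closure_induction_right with
  | one => exact ⟨1, [], 1, one_mem _, one_mem _, fun p hp => absurd hp (by simp), by simp⟩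
  | mul_right x hx y hy ih =>
    rcases hy with hy | hy
    · exact h1 _ _ ih hy
    · exact h2 _ _ ih hy
  | mul_inv_cancel x hx y hy ih =>
    rcases hy with hy | hy
    · exact h1 _ _ ih (inv_mem hy)
    · exact h2 _ _ ih (inv_mem hy)

lemma alt_cyclic_aux {H₁ H₂ : Subgroup K} (n : ℕ) : ∀ (α : K) (L : List (K × K)) (β : K), L.length = n →
    α ∈ H₁ → β ∈ H₂ → GoodL H₁ H₂ L → ∃ g', IsConj (α * pp L * β) g' ∧
      (g' ∈ H₁ ∨ g' ∈ H₂ ∨ ∃ L' : List (K × K), L' ≠ [] ∧ GoodL H₁ H₂ L' ∧ g' = pp L') := by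
  induction n using Nat.strong_induction_on with
  | _ n ih =>
  intro α L β hlen hα hβ hL
  have conj1 : IsConj (α * pp L * β) (pp L * β * α) := isConj_iff.2 ⟨α⁻¹, by group⟩
  have conj2 : IsConj (α * pp L * β) (β * α * pp L) := isConj_iff.2 ⟨β, by group⟩
  by_cases hβ1 : β = 1
  · subst hβ1
    rcases List.eq_nil_or_concat L with rfl | ⟨L', ⟨b, a⟩, rfl⟩
    · exact ⟨α, by simpa using IsConj.refl α, Or.inl hα⟩
    · have hL' : GoodL H₁ H₂ L' := fun p hp => hL p (by simp [hp])
      have hba := hL (b, a) (by simp)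
      by_cases haα : a * α = 1
      · obtain ⟨g', h1, h2⟩ := ih L'.length (by rw [← hlen]; simp) 1 L' b rfl (one_mem _) hba.1.1 hL'
        refine ⟨g', conj1.trans ?_, h2⟩
        convert h1 using 1
        simp [mul_assoc, haα]
      · refine ⟨pp (L' ++ [(b, a * α)]), ?_, Or.inr (Or.inr ⟨_, by simp, ?_, rfl⟩)⟩
        · convert conj1 using 1
          simp [mul_assoc]
        · intro p hp
          rw [List.mem_append, List.mem_singleton] at hp
          rcases hp with hp | rfl
          · exact hL' p hp
          · exact ⟨hba.1, mul_mem hba.2.1 hα, haα⟩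
  · by_cases hα1 : α = 1
    · subst hα1
      cases L with
      | nil => exact ⟨β, by simpa using IsConj.refl β, Or.inr (Or.inl hβ)⟩
      | cons p L' =>
        have hL' : GoodL H₁ H₂ L' := fun q hq => hL q (by simp [hq])
        have hp := hL p (by simp)
        by_cases hβp : β * p.1 = 1
        · obtain ⟨g', h1, h2⟩ := ih L'.length (by rw [← hlen]; simp) p.2 L' 1 rfl hp.2.1 (one_mem _) hL'
          refine ⟨g', conj2.trans ?_, h2⟩
          convert h1 using 1
          simp [← mul_assoc, hβp]
        · refine ⟨pp ((β * p.1, p.2) :: L'), ?_, Or.inr (Or.inr ⟨_, by simp, ?_, rfl⟩)⟩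
          · convert conj2 using 1
            simp [mul_assoc]
          · intro q hq
            rcases List.mem_cons.1 hq with rfl | hq
            · exact ⟨⟨mul_mem hβ hp.1.1, hβp⟩, hp.2⟩
            · exact hL' q hq
    · refine ⟨pp ((β, α) :: L), ?_, Or.inr (Or.inr ⟨_, by simp, ?_, rfl⟩)⟩
      · convert conj2 using 1
        simp [mul_assoc]
      · intro q hq
        rcases List.mem_cons.1 hq with rfl | hq
        · exact ⟨⟨hβ, hβ1⟩, hα, hα1⟩
        · exact hL q hq

lemma alt_cyclic {H₁ H₂ : Subgroup K} {g : K} (hg : g ∈ H₁ ⊔ H₂) : ∃ g', IsConj g g' ∧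
      (g' ∈ H₁ ∨ g' ∈ H₂ ∨ ∃ L' : List (K × K), L' ≠ [] ∧ GoodL H₁ H₂ L' ∧ g' = pp L') := by
  obtain ⟨α, L, β, hα, hβ, hL, rfl⟩ := alt_form hg
  exact alt_cyclic_aux _ α L β rfl hα hβ hL

end Alt

section Lead

open Polynomial Matrix

/-- leading matrix -/
def Lead (M : Matrix (Fin 2) (Fin 2) ℤ[X]) (d : ℕ) (E : Matrix (Fin 2) (Fin 2) ℤ) : Prop :=
  (∀ i j, (M i j).natDegree ≤ d) ∧ ∀ i j, (M i j).coeff d = E i j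

lemma Lead.mul {M N : Matrix (Fin 2) (Fin 2) ℤ[X]} {d e : ℕ} {E E' : Matrix (Fin 2) (Fin 2) ℤ}
    (h : Lead M d E) (h' : Lead N e E') : Lead (M * N) (d + e) (E * E') := by
  constructor
  · intro i j
    rw [Matrix.mul_apply]
    apply Polynomial.natDegree_sum_le_of_forall_le
    intro k _
    exact (Polynomial.natDegree_mul_le).trans (add_le_add (h.1 i k) (h'.1 k j))
  · intro i j
    rw [Matrix.mul_apply, Matrix.mul_apply, Polynomial.finsetSum_coeff]
    apply Finset.sum_congr rfl
    intro k _
    rw [Polynomial.coeff_mul_add_eq_of_natDegree_le (h.1 i k) (h'.1 k j), h.2, h'.2]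

lemma Lead.trace {M : Matrix (Fin 2) (Fin 2) ℤ[X]} {d : ℕ} {E : Matrix (Fin 2) (Fin 2) ℤ}
    (h : Lead M d E) (hE : E.trace ≠ 0) : M.trace.natDegree = d := by
  rw [Matrix.trace_fin_two] at hE ⊢
  apply le_antisymm
  · exact (Polynomial.natDegree_add_le _ _).trans (max_le (h.1 0 0) (h.1 1 1))
  · apply Polynomial.le_natDegree_of_ne_zero
    rw [Polynomial.coeff_add, h.2, h.2]
    exact hE

/-- SL2 over Z[T] -/
abbrev SL := Matrix.SpecialLinearGroup (Fin 2) ℤ[X]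

noncomputable def mU : SL := ⟨!![X, -1; 1, 0], by simp [Matrix.det_fin_two]⟩
noncomputable def mg : SL := ⟨!![2, 1; 1, 1], by simp [Matrix.det_fin_two]; norm_num⟩

def cg : Matrix (Fin 2) (Fin 2) ℤ := !![2, 1; 1, 1]
def cgi : Matrix (Fin 2) (Fin 2) ℤ := !![1, -1; -1, 2]
def ce (s : Fin 2) : Matrix (Fin 2) (Fin 2) ℤ := fun i j => if i = s ∧ j = s then 1 else 0

lemma ce_idem (s : Fin 2) : ce s * ce s = ce s := by
  fin_cases s <;> decide

lemma lead_mg : Lead (mg : SL).1 0 cg := by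
  constructor <;> intro i j <;> fin_cases i <;> fin_cases j <;> simp [mg, cg]

lemma lead_mgi : Lead (mg⁻¹ : SL).1 0 cgi := by
  rw [Matrix.SpecialLinearGroup.coe_inv]
  constructor <;> intro i j <;> fin_cases i <;> fin_cases j <;> simp [mg, cgi, Matrix.adjugate_fin_two]

lemma lead_mU : Lead (mU : SL).1 1 (ce 0) := by
  constructor <;> intro i j <;> fin_cases i <;> fin_cases j <;> simp [mU, ce, Polynomial.coeff_one]

lemma lead_mUi : Lead (mU⁻¹ : SL).1 1 (ce 1) := by
  rw [Matrix.SpecialLinearGroup.coe_inv]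
  constructor <;> intro i j <;> fin_cases i <;> fin_cases j <;>
    simp [mU, ce, Polynomial.coeff_one, Matrix.adjugate_fin_two]

lemma lead_pow {A : SL} {s : Fin 2} (h : Lead A.1 1 (ce s)) (n : ℕ) :
    Lead (A ^ (n + 1)).1 (n + 1) (ce s) := by
  induction n with
  | zero => simpa using h
  | succ k ih =>
    have := ih.mul h
    rw [ce_idem] at this
    rw [pow_succ]
    exact this

lemma lead_zpow {k : ℤ} (hk : k ≠ 0) : ∃ s, Lead (mU ^ k : SL).1 k.natAbs (ce s) := by
  obtain ⟨n, rfl | rfl⟩ := Int.eq_nat_or_neg k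
  · obtain ⟨m, rfl⟩ : ∃ m, n = m + 1 := ⟨n - 1, by omega⟩
    refine ⟨0, ?_⟩
    have := lead_pow lead_mU m
    rw [zpow_natCast, Int.natAbs_natCast]
    exact this
  · obtain ⟨m, rfl⟩ : ∃ m, n = m + 1 := ⟨n - 1, by omega⟩
    refine ⟨1, ?_⟩
    have := lead_pow lead_mUi m
    rw [_root_.zpow_neg, zpow_natCast, ← inv_pow]
    convert this using 1
    simp only [Int.natAbs_neg, Int.natAbs_natCast]

lemma ce_trace (s : Fin 2) : (ce s).trace = 1 := by fin_cases s <;> decide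

def cE (s t : Fin 2) (c : ℤ) : Matrix (Fin 2) (Fin 2) ℤ := fun i j => if i = s then c * cgi t j else 0

lemma cE_mul (s t s' t' : Fin 2) (c c' : ℤ) :
    cE s t c * cE s' t' c' = cE s t' (c * cgi t s' * c') := by
  ext i j
  rw [Matrix.mul_apply, Fin.sum_univ_two]
  fin_cases s' <;> fin_cases i <;> fin_cases s <;> simp [cE] <;> ring

lemma cE_one (s t : Fin 2) : ce s * (cg * ce t * cgi) = cE s t (cg s t) := by
  fin_cases s <;> fin_cases t <;> decide

lemma cg_ne (s t : Fin 2) : cg s t ≠ 0 := by fin_cases s <;> fin_cases t <;> decide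
lemma cgi_ne (s t : Fin 2) : cgi s t ≠ 0 := by fin_cases s <;> fin_cases t <;> decide

lemma cE_trace (s t : Fin 2) (c : ℤ) : (cE s t c).trace = c * cgi t s := by
  rw [Matrix.trace_fin_two]
  fin_cases s <;> simp [cE]

lemma lead_pair {k m : ℤ} (hk : k ≠ 0) (hm : m ≠ 0) :
    ∃ s t c, c ≠ 0 ∧ Lead (mU ^ k * (mg * mU * mg⁻¹) ^ m : SL).1 (k.natAbs + m.natAbs) (cE s t c) := by
  obtain ⟨s, hs⟩ := lead_zpow hk
  obtain ⟨t, ht⟩ := lead_zpow hm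
  refine ⟨s, t, cg s t, cg_ne s t, ?_⟩
  have h1 := hs.mul ((lead_mg.mul ht).mul lead_mgi)
  rw [cE_one] at h1
  rw [conj_zpow]
  have e : 0 + m.natAbs + 0 = m.natAbs := by omega
  rw [e] at h1
  exact h1

/-- total size of a list of pairs -/
def sz (L : List (ℤ × ℤ)) : ℕ := (L.map (fun p => p.1.natAbs + p.2.natAbs)).sum

lemma lead_list (L : List (ℤ × ℤ)) (hne : L ≠ []) (hL : ∀ p ∈ L, p.1 ≠ 0 ∧ p.2 ≠ 0) :
    ∃ s t c, c ≠ 0 ∧ Lead ((L.map (fun p => mU ^ p.1 * (mg * mU * mg⁻¹) ^ p.2)).prod : SL).1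
      (sz L) (cE s t c) := by
  induction L with
  | nil => exact absurd rfl hne
  | cons p L ih =>
    obtain ⟨s, t, c, hc, h1⟩ := lead_pair (hL p (by simp)).1 (hL p (by simp)).2
    by_cases hLn : L = []
    · subst hLn
      refine ⟨s, t, c, hc, ?_⟩
      simpa [sz] using h1
    · obtain ⟨s', t', c', hc', h2⟩ := ih hLn (fun q hq => hL q (by simp [hq]))
      refine ⟨s, t', c * cgi t s' * c', mul_ne_zero (mul_ne_zero hc (cgi_ne _ _)) hc', ?_⟩
      have := h1.mul h2
      rw [cE_mul] at this
      simpa [sz] using this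

end Lead

end RaagPaper

open SimpleGraph

namespace RaagPaper

section FreeTwo

open Polynomial Matrix

/-- free group of rank two -/
abbrev F2 := FreeGroup (Fin 2)

/-- generators -/
def fx (i : Fin 2) : F2 := FreeGroup.of i

noncomputable def rho : F2 →* SL := FreeGroup.lift (fun i => if i = 0 then mU else mg * mU * mg⁻¹)

lemma rho_x0 : rho (fx 0) = mU := by simp [rho, fx]
lemma rho_x1 : rho (fx 1) = mg * mU * mg⁻¹ := by simp [rho, fx]

/-- trace polynomial -/
noncomputable def trp (w : F2) : ℤ[X] := (rho w).1.trace

/-- translation length -/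
noncomputable def ell (w : F2) : ℕ := (trp w).natDegree

noncomputable def ce2 (i : Fin 2) : F2 →* Multiplicative ℤ :=
  FreeGroup.lift (fun j => if j = i then Multiplicative.ofAdd 1 else 1)

/-- exponent sums -/
noncomputable def fe (i : Fin 2) (w : F2) : ℤ := (ce2 i w).toAdd

@[simp] lemma fe_mul (i : Fin 2) (w w' : F2) : fe i (w * w') = fe i w + fe i w' := by simp [fe]
@[simp] lemma fe_inv (i : Fin 2) (w : F2) : fe i (w⁻¹) = - fe i w := by simp [fe]
@[simp] lemma fe_one (i : Fin 2) : fe i 1 = 0 := by simp [fe]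
@[simp] lemma fe_zpow (i : Fin 2) (w : F2) (n : ℤ) : fe i (w ^ n) = n * fe i w := by simp [fe]
lemma fe_x (i j : Fin 2) : fe i (fx j) = if j = i then 1 else 0 := by
  simp only [fe, ce2, fx, FreeGroup.lift_apply_of]; split_ifs <;> rfl

lemma fe_conj {i : Fin 2} {w w' : F2} (h : IsConj w w') : fe i w = fe i w' := by
  obtain ⟨c, rfl⟩ := isConj_iff.1 h
  simp

/-- class norm -/
noncomputable def hn (w : F2) : ℤ := fe 0 w ^ 2 + fe 1 w ^ 2

lemma trp_conj {w w' : F2} (h : IsConj w w') : trp w = trp w' := by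
  obtain ⟨c, rfl⟩ := isConj_iff.1 h
  simp only [trp, map_mul, map_inv]
  rw [Matrix.SpecialLinearGroup.coe_mul, Matrix.trace_mul_comm, ← Matrix.SpecialLinearGroup.coe_mul]
  simp

lemma ell_conj {w w' : F2} (h : IsConj w w') : ell w = ell w' := by
  rw [ell, ell, trp_conj h]

lemma trp_inv (w : F2) : trp w⁻¹ = trp w := by
  simp only [trp, map_inv, Matrix.SpecialLinearGroup.coe_inv, Matrix.adjugate_fin_two,
    Matrix.trace_fin_two]
  simp [add_comm]

lemma ell_inv (w : F2) : ell w⁻¹ = ell w := by rw [ell, ell, trp_inv]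

lemma trp_comm (a b : F2) : trp (a * b) = trp (b * a) := by
  simp only [trp, map_mul, Matrix.SpecialLinearGroup.coe_mul]
  rw [Matrix.trace_mul_comm]

lemma trp_mul_inv (a b : F2) : trp (a * b⁻¹) = trp a * trp b - trp (a * b) := by
  simp only [trp, map_mul, map_inv, Matrix.SpecialLinearGroup.coe_mul, Matrix.SpecialLinearGroup.coe_inv,
    Matrix.adjugate_fin_two, Matrix.trace_fin_two, Matrix.mul_apply, Fin.sum_univ_two]
  simp
  ring

lemma trp_mul_mul_right (a b : F2) : trp (a * b * b) = trp b * trp (a * b) - trp a := by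
  have := trp_mul_inv (a * b) b
  rw [mul_inv_cancel_right] at this
  rw [this]; ring

lemma trp_mul_mul_left (a b : F2) : trp (a * (a * b)) = trp a * trp (a * b) - trp b := by
  have := trp_mul_inv (b * a) a
  rw [mul_inv_cancel_right] at this
  rw [trp_comm a (a * b), trp_comm a b, this, mul_assoc a b a, trp_comm a (b * a)]; ring

lemma ell_pp_swap (L : List (ℤ × ℤ)) (hne : L ≠ []) (hL : ∀ p ∈ L, p.1 ≠ 0 ∧ p.2 ≠ 0) :
    ell ((L.map (fun p => fx 0 ^ p.1 * fx 1 ^ p.2)).prod) = sz L := by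
  obtain ⟨s, t, c, hc, h⟩ := lead_list L hne hL
  have e : rho ((L.map (fun p => fx 0 ^ p.1 * fx 1 ^ p.2)).prod) =
      (L.map (fun p => mU ^ p.1 * (mg * mU * mg⁻¹) ^ p.2)).prod := by
    rw [map_list_prod, List.map_map]
    congr 1
    apply List.map_congr_left
    intro p _
    simp [rho_x0, rho_x1]
  rw [ell, trp, e]
  apply h.trace
  rw [cE_trace]
  exact mul_ne_zero hc (cgi_ne _ _)

lemma ell_x0_zpow (k : ℤ) : ell (fx 0 ^ k) = k.natAbs := by
  rw [ell, trp, map_zpow, rho_x0]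
  by_cases hk : k = 0
  · subst hk
    simp only [zpow_zero, Matrix.SpecialLinearGroup.coe_one, Matrix.trace_one]
    simp
  · obtain ⟨s, hs⟩ := lead_zpow hk
    apply hs.trace
    rw [ce_trace]; exact one_ne_zero

lemma ell_x1_zpow (k : ℤ) : ell (fx 1 ^ k) = k.natAbs := by
  rw [← ell_x0_zpow, ell, ell, trp, trp, map_zpow, map_zpow, rho_x0, rho_x1, conj_zpow]
  congr 1
  rw [Matrix.SpecialLinearGroup.coe_mul, Matrix.trace_mul_comm, ← Matrix.SpecialLinearGroup.coe_mul]
  simp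

lemma sz_ge (L : List (ℤ × ℤ)) (hL : ∀ p ∈ L, p.1 ≠ 0 ∧ p.2 ≠ 0) : 2 * L.length ≤ sz L := by
  induction L with
  | nil => simp
  | cons p L ih =>
    have h1 := hL p (by simp)
    have h2 := ih (fun q hq => hL q (by simp [hq]))
    have e : sz (p :: L) = p.1.natAbs + p.2.natAbs + sz L := by simp [sz]
    rw [e, List.length_cons]
    omega

/-- products of nontrivial powers of the generators are long -/
lemma ell_pp {L : List (F2 × F2)} (hne : L ≠ [])
    (hL : GoodL (Subgroup.zpowers (fx 1)) (Subgroup.zpowers (fx 0)) L) : 2 * L.length ≤ ell (pp L) := by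
  have : ∃ L' : List (ℤ × ℤ), L'.length = L.length ∧ (∀ p ∈ L', p.1 ≠ 0 ∧ p.2 ≠ 0) ∧
      pp L = (L'.map (fun p => fx 0 ^ p.1 * fx 1 ^ p.2)).prod := by
    clear hne
    induction L with
    | nil => exact ⟨[], rfl, by simp, rfl⟩
    | cons p L ih =>
      obtain ⟨L', h1, h2, h3⟩ := ih (fun q hq => hL q (by simp [hq]))
      obtain ⟨⟨⟨k, hk⟩, hk1⟩, ⟨m, hm⟩, hm1⟩ := hL p (by simp)
      simp only at hk hm
      refine ⟨(k, m) :: L', by simp [h1], ?_, ?_⟩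
      · intro q hq
        rcases List.mem_cons.1 hq with rfl | hq
        · constructor
          · rintro rfl; exact hk1 (by rw [← hk]; simp)
          · rintro rfl; exact hm1 (by rw [← hm]; simp)
        · exact h2 q hq
      · simp [h3, hk, hm]
  obtain ⟨L', h1, h2, h3⟩ := this
  have hne' : L' ≠ [] := by
    rintro rfl
    simp at h1
    exact hne (List.length_eq_zero_iff.1 h1.symm)
  rw [h3, ell_pp_swap L' hne' h2, ← h1]
  exact sz_ge L' h2

lemma F2_sup : Subgroup.zpowers (fx 1) ⊔ Subgroup.zpowers (fx 0) = (⊤ : Subgroup F2) := by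
  rw [eq_top_iff, ← FreeGroup.closure_range_of, Subgroup.closure_le]
  rintro _ ⟨i, rfl⟩
  fin_cases i
  · exact (le_sup_right : _ ≤ Subgroup.zpowers (fx 1) ⊔ Subgroup.zpowers (fx 0)) (Subgroup.mem_zpowers _)
  · exact (le_sup_left : _ ≤ Subgroup.zpowers (fx 1) ⊔ Subgroup.zpowers (fx 0)) (Subgroup.mem_zpowers _)

lemma small_ell {w : F2} (h : ell w ≤ 1) : (∃ i : Fin 2, IsConj w (fx i ^ (ell w : ℤ)) ∨ IsConj w (fx i ^ (-(ell w : ℤ)))) := by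
  obtain ⟨g, hg, h1 | h1 | ⟨L, hL, hL', rfl⟩⟩ := alt_cyclic (K := F2) (H₁ := Subgroup.zpowers (fx 1)) (H₂ := Subgroup.zpowers (fx 0))
    (g := w) (by rw [F2_sup]; trivial)
  · obtain ⟨k, rfl⟩ := h1
    refine ⟨1, ?_⟩
    have e := ell_conj hg
    simp only [ell_x1_zpow] at e
    rcases Int.natAbs_eq k with hk | hk
    · left; rw [e, ← hk]; exact hg
    · right; rw [e, ← hk]; exact hg
  · obtain ⟨k, rfl⟩ := h1
    refine ⟨0, ?_⟩
    have e := ell_conj hg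
    simp only [ell_x0_zpow] at e
    rcases Int.natAbs_eq k with hk | hk
    · left; rw [e, ← hk]; exact hg
    · right; rw [e, ← hk]; exact hg
  · have h2 := ell_pp hL hL'
    rw [← ell_conj hg] at h2
    have := List.length_pos_of_ne_nil hL
    omega

lemma ell_eq_zero {w : F2} (h : ell w = 0) : w = 1 := by
  obtain ⟨i, h1 | h1⟩ := small_ell (w := w) (by omega)
  · rw [h] at h1; simpa using h1
  · rw [h] at h1; simpa using h1

lemma hn_of_ell_one {w : F2} (h : ell w = 1) : hn w = 1 := by
  obtain ⟨i, h1 | h1⟩ := small_ell (w := w) (by omega)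
  · rw [h] at h1
    rw [hn, fe_conj h1, fe_conj h1]
    fin_cases i <;> simp [fe_x]
  · rw [h] at h1
    rw [hn, fe_conj h1, fe_conj h1]
    fin_cases i <;> simp [fe_x]

end FreeTwo

end RaagPaper

open SimpleGraph

namespace RaagPaper

section Gen

open Polynomial Matrix

abbrev Mat := Matrix (Fin 2) (Fin 2) ℤ[X]

def InSp (a b M : Mat) : Prop := ∃ m₀ m₁ m₂ m₃ : ℤ[X], M = m₀ • 1 + m₁ • a + m₂ • b + m₃ • (a * b)

lemma sl_sq (a : SL) : a.1 * a.1 = a.1.trace • a.1 - 1 := by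
  have h := a.2
  rw [Matrix.det_fin_two] at h
  apply Matrix.ext; intro i j
  fin_cases i <;> fin_cases j <;>
    simp [Matrix.mul_apply, Matrix.trace_fin_two, Fin.sum_univ_two] <;>
    first
    | ring1
    | linear_combination (-1 : ℤ[X]) * h
    | linear_combination h

lemma sl_inv (a : SL) : (a⁻¹).1 = a.1.trace • 1 - a.1 := by
  rw [Matrix.SpecialLinearGroup.coe_inv, Matrix.adjugate_fin_two]
  apply Matrix.ext; intro i j
  fin_cases i <;> fin_cases j <;>
    simp [Matrix.trace_fin_two]

lemma sl_ba (a b : SL) : b.1 * a.1 = - (a.1 * b.1) + b.1.trace • a.1 + a.1.trace • b.1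
    + ((a.1 * b.1).trace - a.1.trace * b.1.trace) • 1 := by
  apply Matrix.ext; intro i j
  fin_cases i <;> fin_cases j <;>
    simp [Matrix.mul_apply, Matrix.trace_fin_two, Fin.sum_univ_two] <;> ring

lemma sl_aba (a b : SL) : a.1 * b.1 * a.1 = b.1 - b.1.trace • 1 + (a.1 * b.1).trace • a.1 := by
  rw [mul_assoc, sl_ba]
  simp only [mul_add, mul_neg, ← mul_assoc, mul_smul_comm, sl_sq, mul_one, sub_mul, one_mul, smul_mul_assoc]
  module

lemma inSp_mul_a (a b : SL) {M : Mat} (h : InSp a.1 b.1 M) : InSp a.1 b.1 (M * a.1) := by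
  obtain ⟨m₀, m₁, m₂, m₃, rfl⟩ := h
  refine ⟨-m₁ + m₂ * ((a.1 * b.1).trace - a.1.trace * b.1.trace) - m₃ * b.1.trace,
    m₀ + m₁ * a.1.trace + m₂ * b.1.trace + m₃ * (a.1 * b.1).trace,
    m₂ * a.1.trace + m₃, -m₂, ?_⟩
  simp only [add_mul, smul_mul_assoc, one_mul, sl_sq, sl_aba]
  rw [sl_ba]
  module

lemma inSp_mul_b (a b : SL) {M : Mat} (h : InSp a.1 b.1 M) : InSp a.1 b.1 (M * b.1) := by
  obtain ⟨m₀, m₁, m₂, m₃, rfl⟩ := h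
  refine ⟨-m₂, -m₃, m₀ + m₂ * b.1.trace, m₁ + m₃ * b.1.trace, ?_⟩
  simp only [add_mul, smul_mul_assoc, one_mul, mul_assoc, sl_sq, mul_sub, mul_smul_comm, mul_one]
  module

lemma inSp_smul_sub (a b : Mat) {M N : Mat} (c : ℤ[X]) (h : InSp a b M) (h' : InSp a b N) :
    InSp a b (c • M - N) := by
  obtain ⟨m₀, m₁, m₂, m₃, rfl⟩ := h
  obtain ⟨n₀, n₁, n₂, n₃, rfl⟩ := h'
  exact ⟨c * m₀ - n₀, c * m₁ - n₁, c * m₂ - n₂, c * m₃ - n₃, by module⟩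

/-- generating pairs -/
def GP (a b : F2) : Prop := Subgroup.closure ({a, b} : Set F2) = ⊤

lemma inSp_of_gp {a b : F2} (h : GP a b) (w : F2) : InSp (rho a).1 (rho b).1 (rho w).1 := by
  have hw : w ∈ Subgroup.closure ({a, b} : Set F2) := by rw [h]; trivial
  induction hw using Subgroup.closure_induction_right with
  | one => exact ⟨1, 0, 0, 0, by simp⟩
  | mul_right x hx y hy ih =>
    rcases hy with rfl | rfl
    · rw [map_mul, Matrix.SpecialLinearGroup.coe_mul]; exact inSp_mul_a _ _ ih
    · rw [map_mul, Matrix.SpecialLinearGroup.coe_mul]; exact inSp_mul_b _ _ ih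
  | mul_inv_cancel x hx y hy ih =>
    rcases hy with rfl | rfl
    · rw [map_mul, map_inv, Matrix.SpecialLinearGroup.coe_mul, sl_inv, mul_sub, mul_smul_comm, mul_one]
      exact inSp_smul_sub _ _ _ ih (inSp_mul_a _ _ ih)
    · rw [map_mul, map_inv, Matrix.SpecialLinearGroup.coe_mul, sl_inv, mul_sub, mul_smul_comm, mul_one]
      exact inSp_smul_sub _ _ _ ih (inSp_mul_b _ _ ih)

lemma comm_dvd (a b : SL) {M N : Mat} (h : InSp a.1 b.1 M) (h' : InSp a.1 b.1 N) :
    (a.1 * b.1 - b.1 * a.1).det ∣ (M * N - N * M).det := by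
  obtain ⟨m₀, m₁, m₂, m₃, rfl⟩ := h
  obtain ⟨n₀, n₁, n₂, n₃, rfl⟩ := h'
  set A := a.1 with hA
  set B := b.1 with hB
  have hb : B * B = B.trace • B - 1 := sl_sq b
  have key : B * (A * B) - (A * B) * B = -((B.trace • 1 - B) * (A * B - B * A)) := by
    have e1 : A * B * B = B.trace • (A * B) - A := by
      rw [mul_assoc, hb, mul_sub, mul_smul_comm, mul_one]
    have e2 : B * (B * A) = B.trace • (B * A) - A := by
      rw [← mul_assoc, hb, sub_mul, smul_mul_assoc, one_mul]
    simp only [sub_mul, mul_sub, smul_mul_assoc, one_mul, e1, e2]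
    module
  have e : (m₀ • 1 + m₁ • A + m₂ • B + m₃ • (A * B)) * (n₀ • 1 + n₁ • A + n₂ • B + n₃ • (A * B)) -
      (n₀ • 1 + n₁ • A + n₂ • B + n₃ • (A * B)) * (m₀ • 1 + m₁ • A + m₂ • B + m₃ • (A * B)) =
      (m₁ * n₂ - m₂ * n₁) • (A * B - B * A) + (m₁ * n₃ - m₃ * n₁) • (A * (A * B) - (A * B) * A) +
      (m₂ * n₃ - m₃ * n₂) • (B * (A * B) - (A * B) * B) := by
    simp only [add_mul, mul_add, smul_mul_assoc, mul_smul_comm, one_mul, mul_one, mul_assoc]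
    module
  have e' : (m₁ * n₂ - m₂ * n₁) • (A * B - B * A) + (m₁ * n₃ - m₃ * n₁) • (A * (A * B) - (A * B) * A) +
      (m₂ * n₃ - m₃ * n₂) • (B * (A * B) - (A * B) * B) =
      ((m₁ * n₂ - m₂ * n₁) • 1 + (m₁ * n₃ - m₃ * n₁) • A - (m₂ * n₃ - m₃ * n₂) • (B.trace • 1 - B))
        * (A * B - B * A) := by
    rw [key]
    simp only [sub_mul, add_mul, mul_sub, smul_mul_assoc, one_mul, mul_assoc]
    module
  rw [e, e', Matrix.det_mul]
  exact dvd_mul_left _ _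

/-- Fricke polynomial -/
noncomputable def fr (P Q R : ℤ[X]) : ℤ[X] := P ^ 2 + Q ^ 2 + R ^ 2 - P * Q * R - 4

lemma det_comm (a b : SL) : (a.1 * b.1 - b.1 * a.1).det = - fr a.1.trace b.1.trace (a.1 * b.1).trace := by
  have h1 := a.2
  have h2 := b.2
  rw [Matrix.det_fin_two] at h1 h2
  have e : (a.1 * b.1 - b.1 * a.1).det = - (a.1.trace ^ 2 * (b.1 0 0 * b.1 1 1 - b.1 0 1 * b.1 1 0) +
      b.1.trace ^ 2 * (a.1 0 0 * a.1 1 1 - a.1 0 1 * a.1 1 0) + (a.1 * b.1).trace ^ 2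
      - a.1.trace * b.1.trace * (a.1 * b.1).trace
      - 4 * (a.1 0 0 * a.1 1 1 - a.1 0 1 * a.1 1 0) * (b.1 0 0 * b.1 1 1 - b.1 0 1 * b.1 1 0)) := by
    simp only [Matrix.det_fin_two, Matrix.trace_fin_two, Matrix.sub_apply, Matrix.mul_apply, Fin.sum_univ_two]
    ring
  rw [e, h1, h2, fr]
  ring

lemma fr_gp {a b : F2} (h : GP a b) : (fr (trp a) (trp b) (trp (a * b))).natDegree ≤ 4 := by
  have h1 := comm_dvd (rho a) (rho b) (inSp_of_gp h (fx 0)) (inSp_of_gp h (fx 1))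
  rw [det_comm, det_comm (rho (fx 0)) (rho (fx 1))] at h1
  have e0 : (rho (fx 0)).1.trace = X := by
    rw [rho_x0]; simp [mU, Matrix.trace_fin_two]
  have eX : (rho (fx 1)).1 = !![2 * X + 3, - 2 * X - 5; X + 2, - X - 3] := by
    rw [rho_x1, Matrix.SpecialLinearGroup.coe_mul, Matrix.SpecialLinearGroup.coe_mul,
      Matrix.SpecialLinearGroup.coe_inv, Matrix.adjugate_fin_two]
    apply Matrix.ext; intro i j
    fin_cases i <;> fin_cases j <;>
      simp [mU, mg, Matrix.mul_apply, Fin.sum_univ_two] <;> ring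
  have e1 : (rho (fx 1)).1.trace = X := by
    rw [eX, Matrix.trace_fin_two]; simp; ring
  have e2 : ((rho (fx 0)).1 * (rho (fx 1)).1).trace = 2 * X ^ 2 - 7 := by
    rw [eX, rho_x0, Matrix.trace_fin_two]
    simp [mU, Matrix.mul_apply, Fin.sum_univ_two]
    ring
  rw [e0, e1, e2] at h1
  have e3 : fr X X (2 * X ^ 2 - 7) = 2 * X ^ 4 - 19 * X ^ 2 + 45 := by
    rw [fr]; ring
  rw [e3, neg_dvd, dvd_neg] at h1
  have hne : (2 * X ^ 4 - 19 * X ^ 2 + 45 : ℤ[X]) ≠ 0 := by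
    intro h0
    have := congrArg (Polynomial.eval 0) h0
    simp at this
  have h2 := Polynomial.natDegree_le_of_dvd h1 hne
  have h3 : (2 * X ^ 4 - 19 * X ^ 2 + 45 : ℤ[X]).natDegree ≤ 4 := by compute_degree
  have h4 : trp (a * b) = ((rho a).1 * (rho b).1).trace := by
    rw [trp, map_mul, Matrix.SpecialLinearGroup.coe_mul]
  rw [h4]
  exact h2.trans h3

lemma natDegree_eq_of_sub {p q : ℤ[X]} {n : ℕ} (hp : p.natDegree < n) (hq : (p + q).natDegree < n) :
    q.natDegree < n := by
  have : q = (p + q) - p := by ring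
  rw [this]
  exact (Polynomial.natDegree_sub_le _ _).trans_lt (max_lt hq hp)

lemma tri_max {P Q R : ℤ[X]} (hP : 1 ≤ P.natDegree) (hQ : 1 ≤ Q.natDegree) (hR : 1 ≤ R.natDegree)
    (hn : 4 < P.natDegree + Q.natDegree + R.natDegree) (hPR : P.natDegree ≤ R.natDegree)
    (hQR : Q.natDegree ≤ R.natDegree) (hfr : (fr P Q R).natDegree ≤ 4) :
    R.natDegree = P.natDegree + Q.natDegree ∧ (P * Q - R).natDegree < R.natDegree := by
  have hP0 : P ≠ 0 := by rintro rfl; simp at hP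
  have hQ0 : Q ≠ 0 := by rintro rfl; simp at hQ
  have hR0 : R ≠ 0 := by rintro rfl; simp at hR
  have dPQ : (P * Q).natDegree = P.natDegree + Q.natDegree := Polynomial.natDegree_mul hP0 hQ0
  have dP2 : (P ^ 2).natDegree = 2 * P.natDegree := Polynomial.natDegree_pow P 2
  have dQ2 : (Q ^ 2).natDegree = 2 * Q.natDegree := Polynomial.natDegree_pow Q 2
  have d4 : (4 : ℤ[X]).natDegree = 0 := Polynomial.natDegree_ofNat 4
  -- R * (P Q - R) has small degree
  have hsmall : ∀ n, 4 < n → 2 * P.natDegree < n → 2 * Q.natDegree < n → (R * (P * Q - R)).natDegree < n := by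
    intro n h4 hp hq
    have e : R * (P * Q - R) = P ^ 2 + Q ^ 2 - 4 - fr P Q R := by rw [fr]; ring
    rw [e]
    refine (Polynomial.natDegree_sub_le _ _).trans_lt (max_lt ?_ (by omega))
    refine (Polynomial.natDegree_sub_le _ _).trans_lt (max_lt ?_ (by omega))
    exact (Polynomial.natDegree_add_le _ _).trans_lt (max_lt (by omega) (by omega))
  have hmul : P * Q - R ≠ 0 → (R * (P * Q - R)).natDegree = R.natDegree + (P * Q - R).natDegree :=
    fun h => Polynomial.natDegree_mul hR0 h
  have heq : R.natDegree = P.natDegree + Q.natDegree := by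
    rcases lt_trichotomy R.natDegree (P.natDegree + Q.natDegree) with hlt | heq | hgt
    · exfalso
      have d : (P * Q - R).natDegree = P.natDegree + Q.natDegree := by
        rw [Polynomial.natDegree_sub_eq_left_of_natDegree_lt (by omega), dPQ]
      have hne : P * Q - R ≠ 0 := by intro h; rw [h] at d; simp at d; omega
      have h1 := hsmall (R.natDegree + (P * Q - R).natDegree) (by omega) (by omega) (by omega)
      rw [hmul hne] at h1
      omega
    · exact heq
    · exfalso
      have d : (P * Q - R).natDegree = R.natDegree := by
        rw [Polynomial.natDegree_sub_eq_right_of_natDegree_lt (by omega)]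
      have hne : P * Q - R ≠ 0 := by intro h; rw [h] at d; simp at d; omega
      have h1 := hsmall (R.natDegree + (P * Q - R).natDegree) (by omega) (by omega) (by omega)
      rw [hmul hne] at h1
      omega
  refine ⟨heq, ?_⟩
  by_contra hcon
  have hne : P * Q - R ≠ 0 := by intro h; rw [h] at hcon; simp at hcon; omega
  have h1 := hsmall (R.natDegree + (P * Q - R).natDegree) (by omega) (by omega) (by omega)
  rw [hmul hne] at h1
  omega

lemma tri {P Q R : ℤ[X]} (hP : 1 ≤ P.natDegree) (hQ : 1 ≤ Q.natDegree) (hR : 1 ≤ R.natDegree)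
    (hn : 4 < P.natDegree + Q.natDegree + R.natDegree) (hfr : (fr P Q R).natDegree ≤ 4) :
    (R.natDegree = P.natDegree + Q.natDegree ∧ (P * Q - R).natDegree < R.natDegree) ∨
    (P.natDegree = Q.natDegree + R.natDegree ∧ (Q * R - P).natDegree < P.natDegree) ∨
    (Q.natDegree = P.natDegree + R.natDegree ∧ (P * R - Q).natDegree < Q.natDegree) := by
  by_cases h1 : P.natDegree ≤ R.natDegree ∧ Q.natDegree ≤ R.natDegree
  · exact Or.inl (tri_max hP hQ hR hn h1.1 h1.2 hfr)
  by_cases h2 : Q.natDegree ≤ P.natDegree ∧ R.natDegree ≤ P.natDegree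
  · right; left
    refine tri_max hQ hR hP (by omega) h2.1 h2.2 ?_
    have : fr Q R P = fr P Q R := by rw [fr, fr]; ring
    rw [this]; exact hfr
  · right; right
    refine tri_max hP hR hQ (by omega) (by omega) (by omega) ?_
    have : fr P R Q = fr P Q R := by rw [fr, fr]; ring
    rw [this]; exact hfr

lemma gp_right {a b : F2} (h : GP a b) : GP (a * b) b := by
  rw [GP, eq_top_iff, ← h, Subgroup.closure_le]
  have hb : b ∈ Subgroup.closure ({a * b, b} : Set F2) := Subgroup.subset_closure (by simp)
  have hab : a * b ∈ Subgroup.closure ({a * b, b} : Set F2) := Subgroup.subset_closure (by simp)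
  rintro x (rfl | rfl)
  · have := mul_mem hab (inv_mem hb)
    simpa using this
  · exact hb

lemma gp_left {a b : F2} (h : GP a b) : GP a (a * b) := by
  rw [GP, eq_top_iff, ← h, Subgroup.closure_le]
  have ha : a ∈ Subgroup.closure ({a, a * b} : Set F2) := Subgroup.subset_closure (by simp)
  have hab : a * b ∈ Subgroup.closure ({a, a * b} : Set F2) := Subgroup.subset_closure (by simp)
  rintro x (rfl | rfl)
  · exact ha
  · have := mul_mem (inv_mem ha) hab
    simpa using this

lemma gp_inv {a b : F2} (h : GP a b) : GP a b⁻¹ := by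
  rw [GP, eq_top_iff, ← h, Subgroup.closure_le]
  rintro x (rfl | rfl)
  · exact Subgroup.subset_closure (by simp)
  · have : x⁻¹ ∈ Subgroup.closure ({a, x⁻¹} : Set F2) := Subgroup.subset_closure (by simp)
    simpa using inv_mem this

lemma tri_gp {a b : F2} (h : GP a b) (ha : 1 ≤ ell a) (hb : 1 ≤ ell b) (hab : 1 ≤ ell (a * b))
    (hn : 4 < ell a + ell b + ell (a * b)) :
    (ell (a * b) = ell a + ell b ∧ ell (a * b⁻¹) < ell (a * b)) ∨
    (ell a = ell b + ell (a * b) ∧ ell (a * b * b) < ell a) ∨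
    (ell b = ell a + ell (a * b) ∧ ell (a * (a * b)) < ell b) := by
  have := tri ha hb hab hn (fr_gp h)
  rw [← trp_mul_inv, ← trp_mul_mul_right, ← trp_mul_mul_left] at this
  exact this

lemma hn_pos_ell {w : F2} (h : hn w ≠ 0) : 1 ≤ ell w := by
  by_contra hlt
  have : w = 1 := ell_eq_zero (by omega)
  subst this
  simp [hn] at h

lemma lemmaD (n : ℕ) : ∀ a b : F2, ell a + ell b + ell (a * b) = n → GP a b →
    ell (a * b) < ell a + ell b → hn a < hn (a * b) → hn b < hn (a * b) → 3 ≤ hn (a * b) → False := by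
  induction n using Nat.strong_induction_on with
  | _ n ih =>
  intro a b hsum hgp hlt ha hb h3
  have hr : 1 ≤ ell (a * b) := hn_pos_ell (by omega)
  have hp : 1 ≤ ell a := by
    by_contra h
    have : a = 1 := ell_eq_zero (by omega)
    subst this
    simp at hb
  have hq : 1 ≤ ell b := by
    by_contra h
    have : b = 1 := ell_eq_zero (by omega)
    subst this
    simp at ha
  by_cases h4 : 4 < ell a + ell b + ell (a * b)
  · rcases tri_gp hgp hp hq hr h4 with h | h | h
    · omega
    · have e : hn (a * b * b) = 2 * hn (a * b) + 2 * hn b - hn a := by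
        simp only [hn, fe_mul]; ring
      have hb0 : 0 ≤ hn b := by simp only [hn]; positivity
      exact ih _ (by omega) (a * b) b rfl (gp_right hgp) (by omega) (by omega) (by omega) (by omega)
    · have e : hn (a * (a * b)) = 2 * hn (a * b) + 2 * hn a - hn b := by
        simp only [hn, fe_mul]; ring
      have ha0 : 0 ≤ hn a := by simp only [hn]; positivity
      exact ih _ (by omega) a (a * b) rfl (gp_left hgp) (by omega) (by omega) (by omega) (by omega)
  · have : ell (a * b) = 1 := by omega
    have := hn_of_ell_one this
    omega

/-- The key fact on the free group of rank two. -/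
lemma gp_ell {a b : F2} (h : GP a b) (ha0 : fe 0 a = 1) (ha1 : fe 1 a = 0) (hb0 : fe 0 b = 0)
    (hb1 : fe 1 b = 1) : ell a = 1 ∧ ell b = 1 ∧ ell (a * b) = 2 := by
  have hp : 1 ≤ ell a := hn_pos_ell (by simp [hn, ha0, ha1])
  have hq : 1 ≤ ell b := hn_pos_ell (by simp [hn, hb0, hb1])
  have two : ∀ w, hn w = 2 → 2 ≤ ell w := by
    intro w hw
    have h1 : 1 ≤ ell w := hn_pos_ell (by omega)
    by_contra hcon
    have := hn_of_ell_one (w := w) (by omega)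
    omega
  have hr : 2 ≤ ell (a * b) := two _ (by simp [hn, ha0, ha1, hb0, hb1])
  by_cases h4 : 4 < ell a + ell b + ell (a * b)
  · exfalso
    rcases tri_gp h hp hq (by omega) h4 with h' | h' | h'
    · have hr' : 2 ≤ ell (a * b⁻¹) := two _ (by simp [hn, ha0, ha1, hb0, hb1])
      have hbi := ell_inv b
      rcases tri_gp (gp_inv h) hp (by omega) (by omega) (by omega) with h'' | h'' | h''
      · omega
      · apply lemmaD _ (a * b⁻¹) b⁻¹ rfl (gp_right (gp_inv h)) (by omega)
        all_goals simp [hn, ha0, ha1, hb0, hb1]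
      · apply lemmaD _ a (a * b⁻¹) rfl (gp_left (gp_inv h)) (by omega)
        all_goals simp [hn, ha0, ha1, hb0, hb1]
    · apply lemmaD _ (a * b) b rfl (gp_right h) (by omega)
      all_goals simp [hn, ha0, ha1, hb0, hb1]
    · apply lemmaD _ a (a * b) rfl (gp_left h) (by omega)
      all_goals simp [hn, ha0, ha1, hb0, hb1]
  · omega

end Gen

end RaagPaper

open SimpleGraph

namespace RaagPaper

section Collapse

variable {V : Type} {G : SimpleGraph V}

lemma generic [Fintype V] (x y : V) (F : List (V → ℤ))
    (hF : ∀ e ∈ F, (∃ v, e v ≠ 0) ∧ (x ≠ y → e x = 0 ∨ e y = 0)) :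
    ∃ n : V → ℤ, n x = 1 ∧ n y = 1 ∧ ∀ e ∈ F, ∑ v, n v * e v ≠ 0 := by
  classical
  let idx := Fintype.equivFin V
  let k : V → ℕ := fun v => if v = x ∨ v = y then 0 else (idx v).1 + 1
  let p : (V → ℤ) → Polynomial ℤ := fun e => ∑ v, Polynomial.C (e v) * Polynomial.X ^ k v
  have hp : ∀ e ∈ F, p e ≠ 0 := by
    intro e he h0
    obtain ⟨⟨v, hv⟩, hxy⟩ := hF e he
    have hc : (p e).coeff (k v) = ∑ w, if k w = k v then e w else 0 := by
      simp only [p, Polynomial.finsetSum_coeff, Polynomial.coeff_C_mul_X_pow]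
      refine Finset.sum_congr rfl fun w _ => ?_
      simp [eq_comm]
    rw [h0, Polynomial.coeff_zero] at hc
    by_cases hvx : v = x ∨ v = y
    · have hk : ∀ w, k w = k v ↔ (w = x ∨ w = y) := by
        intro w
        by_cases hw : w = x ∨ w = y <;> simp [k, hw, hvx]
      simp only [hk] at hc
      rw [← Finset.sum_filter] at hc
      have hs : (Finset.univ.filter fun w => w = x ∨ w = y) = {x, y} := by
        ext w; simp
      rw [hs] at hc
      by_cases hne : x = y
      · subst hne
        simp at hc hvx
        subst hvx
        exact hv hc.symm
      · rw [Finset.sum_pair hne] at hc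
        rcases hvx with rfl | rfl <;> rcases hxy hne with h | h <;> omega
    · have hk : ∀ w, k w = k v ↔ w = v := by
        intro w
        constructor
        · intro h
          by_cases hw : w = x ∨ w = y
          · simp [k, hw, hvx] at h
          · simp only [k, hw, hvx, if_false] at h
            apply idx.injective
            apply Fin.ext
            omega
        · rintro rfl; rfl
      simp only [hk] at hc
      simp at hc
      exact hv hc.symm
  let q : Polynomial ℤ := (F.map p).prod
  have hq : q ≠ 0 := by
    apply List.prod_ne_zero
    intro h
    obtain ⟨e, he, h0⟩ := List.mem_map.1 h
    exact hp e he h0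
  obtain ⟨N, hN⟩ : ∃ N : ℤ, ¬ q.IsRoot N := by
    by_contra hcon
    push Not at hcon
    exact hq (Polynomial.funext fun r => by simpa using hcon r)
  refine ⟨fun v => N ^ k v, by simp [k], by simp [k], ?_⟩
  intro e he h0
  apply hN
  have hdvd : p e ∣ q := List.dvd_prod (List.mem_map_of_mem he)
  obtain ⟨c, hc⟩ := hdvd
  rw [hc, Polynomial.IsRoot, Polynomial.eval_mul]
  have : (p e).eval N = 0 := by
    simp only [p, Polynomial.eval_finsetSum, Polynomial.eval_mul, Polynomial.eval_C, Polynomial.eval_pow,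
      Polynomial.eval_X]
    rw [← h0]
    exact Finset.sum_congr rfl fun v _ => mul_comm _ _
  rw [this, zero_mul]

lemma hom_sum [Fintype V] (f : Raag G →* Multiplicative ℤ) (g : Raag G) :
    Multiplicative.toAdd (f g) = ∑ v, Multiplicative.toAdd (f (gen G v)) * ex v g := by
  classical
  have hg : g ∈ Subgroup.closure (Set.range (gen G)) := by rw [closure_gen]; trivial
  induction hg using Subgroup.closure_induction with
  | mem z hz =>
    obtain ⟨w, rfl⟩ := hz
    rw [Finset.sum_eq_single w]
    · simp
    · intro b _ hb
      rw [ex_gen_ne hb.symm, mul_zero]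
    · simp
  | one => simp
  | mul a b _ _ ha hb =>
    rw [map_mul, toAdd_mul, ha, hb, ← Finset.sum_add_distrib]
    exact Finset.sum_congr rfl fun v _ => by rw [ex_mul]; ring
  | inv a _ ha =>
    rw [map_inv, toAdd_inv, ha, ← Finset.sum_neg_distrib]
    exact Finset.sum_congr rfl fun v _ => by rw [ex_inv]; ring

lemma hom_of_ex [Finite V] (f : Raag G →* Multiplicative ℤ) {g g' : Raag G} (h : ∀ a, ex a g = ex a g') :
    f g = f g' := by
  have := Fintype.ofFinite V
  apply Multiplicative.toAdd.injective
  rw [hom_sum, hom_sum f g']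
  exact Finset.sum_congr rfl fun v _ => by rw [h]

lemma gp_of_surj (f : Raag G →* F2) (hf : Function.Surjective f) {a b : F2}
    (h : ∀ v, f (gen G v) ∈ Subgroup.closure ({a, b} : Set F2)) : GP a b := by
  rw [GP, eq_top_iff]
  intro w _
  obtain ⟨g, rfl⟩ := hf w
  have hg : g ∈ Subgroup.closure (Set.range (gen G)) := by rw [closure_gen]; trivial
  induction hg using Subgroup.closure_induction with
  | mem z hz =>
    obtain ⟨w, rfl⟩ := hz
    exact h w
  | one => simp
  | mul a b _ _ ha hb => rw [map_mul]; exact mul_mem (ha trivial) (hb trivial)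
  | inv a _ ha => rw [map_inv]; exact inv_mem (ha trivial)

open Classical in
/-- The collapse of two non-adjacent sets of vertices to the free group of rank two. -/
noncomputable def kap (P P' : Set V) (hPP : ∀ p ∈ P, ∀ q ∈ P', ¬ G.Adj p q) (n : V → ℤ) : Raag G →* F2 :=
  liftHom G (fun v => if v ∈ P then fx 0 ^ n v else if v ∈ P' then fx 1 ^ n v else 1) (by
    intro u v huv
    by_cases hu : u ∈ P <;> by_cases hv : v ∈ P <;> by_cases hu' : u ∈ P' <;> by_cases hv' : v ∈ P' <;>
      simp only [hu, hv, hu', hv', if_true, if_false] <;>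
      first
      | exact Commute.one_left _
      | exact Commute.one_right _
      | exact (Commute.refl _).zpow_zpow _ _
      | exact absurd huv (hPP _ hu _ hv')
      | exact absurd huv.symm (hPP _ hv _ hu'))

lemma kap_left {P P' : Set V} (hPP : ∀ p ∈ P, ∀ q ∈ P', ¬ G.Adj p q) (n : V → ℤ) {v : V} (hv : v ∈ P) :
    kap P P' hPP n (gen G v) = fx 0 ^ n v := by
  rw [kap, liftHom_gen, if_pos hv]

lemma kap_right {P P' : Set V} (hPP : ∀ p ∈ P, ∀ q ∈ P', ¬ G.Adj p q) (n : V → ℤ) {v : V} (hv : v ∉ P)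
    (hv' : v ∈ P') : kap P P' hPP n (gen G v) = fx 1 ^ n v := by
  rw [kap, liftHom_gen, if_neg hv, if_pos hv']

lemma kap_none {P P' : Set V} (hPP : ∀ p ∈ P, ∀ q ∈ P', ¬ G.Adj p q) (n : V → ℤ) {v : V} (hv : v ∉ P)
    (hv' : v ∉ P') : kap P P' hPP n (gen G v) = 1 := by
  rw [kap, liftHom_gen, if_neg hv, if_neg hv']

lemma zpow_wt [Fintype V] {K : Type} [Group K] (f : Raag G →* K) (z : K) (n : V → ℤ) {P : Set V}
    (hf : ∀ v ∈ P, f (gen G v) = z ^ n v) {g : Raag G} (hg : g ∈ par G P) :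
    f g = z ^ (∑ v, n v * ex v g) := by
  classical
  rw [par_eq_closure] at hg
  induction hg using Subgroup.closure_induction with
  | mem y hy =>
    obtain ⟨w, hw, rfl⟩ := hy
    rw [hf w hw, Finset.sum_eq_single w]
    · simp
    · intro b _ hb
      rw [ex_gen_ne hb.symm, mul_zero]
    · simp
  | one => simp
  | mul a b _ _ ha hb =>
    rw [map_mul, ha, hb, ← zpow_add, ← Finset.sum_add_distrib]
    congr 1
    exact Finset.sum_congr rfl fun v _ => by rw [ex_mul]; ring
  | inv a _ ha =>
    rw [map_inv, ha, ← zpow_neg, ← Finset.sum_neg_distrib]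
    congr 1
    exact Finset.sum_congr rfl fun v _ => by rw [ex_inv]; ring

lemma fx_zpow_ne (i : Fin 2) {k : ℤ} (hk : k ≠ 0) : (fx i) ^ k ≠ 1 := by
  intro h
  have := congrArg (fe i) h
  simp [fe_x] at this
  exact hk this

lemma map_pp {K K' : Type} [Group K] [Group K'] (f : K →* K') (L : List (K × K)) :
    f (pp L) = pp (L.map fun p => (f p.1, f p.2)) := by
  induction L with
  | nil => simp
  | cons a L ih => simp [ih]

/-- Existence of a generic collapse. -/
lemma collapse [Finite V] {P P' : Set V} (hPP : ∀ p ∈ P, ∀ q ∈ P', ¬ G.Adj p q) (hdis : Disjoint P P')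
    (hP : G.IsClique P) (hP' : G.IsClique P') {x y : V} (hx : x ∈ P) (hy : y ∈ P')
    (L : List (Raag G × Raag G)) (hL : GoodL (par G P') (par G P) L) :
    ∃ κ : Raag G →* F2, (∀ p ∈ P, ∃ k : ℤ, κ (gen G p) = fx 0 ^ k) ∧
      (∀ p ∈ P', ∃ k : ℤ, κ (gen G p) = fx 1 ^ k) ∧ κ (gen G x) = fx 0 ∧ κ (gen G y) = fx 1 ∧
      (∀ v, v ∉ P → v ∉ P' → κ (gen G v) = 1) ∧ (L ≠ [] → 2 * L.length ≤ ell (κ (pp L))) := by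
  classical
  have := Fintype.ofFinite V
  have hnx : ∀ p ∈ P', p ∉ P := fun p hp hp' => Set.disjoint_left.1 hdis hp' hp
  have hne : x ≠ y := by rintro rfl; exact hnx x hy hx
  have nz : ∀ {Q : Set V}, G.IsClique Q → ∀ {g : Raag G}, g ∈ par G Q → g ≠ 1 → ∃ v, ex v g ≠ 0 := by
    intro Q hQ g hg h1
    by_contra hcon
    push Not at hcon
    apply h1
    have := ret_clique hQ (g := g) (fun q _ => hcon q)
    rw [← this]
    exact (mem_par.1 hg).symm
  obtain ⟨n, n1, n2, hn⟩ := generic x y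
    (L.map (fun p => fun v => ex v p.1) ++ L.map (fun p => fun v => ex v p.2)) (by
      intro e he
      rw [List.mem_append, List.mem_map, List.mem_map] at he
      rcases he with ⟨p, hp, rfl⟩ | ⟨p, hp, rfl⟩
      · obtain ⟨⟨h1, h2⟩, h3, h4⟩ := hL p hp
        exact ⟨nz hP h1 h2, fun _ => Or.inr (ex_of_par (fun h => hnx y hy h) h1)⟩
      · obtain ⟨⟨h1, h2⟩, h3, h4⟩ := hL p hp
        exact ⟨nz hP' h3 h4, fun _ => Or.inl (ex_of_par (fun h => hnx x h hx) h3)⟩)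
  refine ⟨kap P P' hPP n, fun p hp => ⟨_, kap_left hPP n hp⟩, fun p hp => ⟨_, kap_right hPP n (hnx p hp) hp⟩,
    by rw [kap_left hPP n hx, n1, zpow_one], by rw [kap_right hPP n (hnx y hy) hy, n2, zpow_one],
    fun v h1 h2 => kap_none hPP n h1 h2, ?_⟩
  intro hL0
  rw [map_pp]
  have := ell_pp (L := L.map fun p => (kap P P' hPP n p.1, kap P P' hPP n p.2)) (by simpa using hL0) ?_
  · simpa using this
  intro p hp
  obtain ⟨q, hq, rfl⟩ := List.mem_map.1 hp
  obtain ⟨⟨h1, h2⟩, h3, h4⟩ := hL q hq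
  have e1 := zpow_wt (kap P P' hPP n) (fx 0) n (fun v hv => kap_left hPP n hv) h1
  have e2 := zpow_wt (kap P P' hPP n) (fx 1) n (fun v hv => kap_right hPP n (hnx v hv) hv) h3
  have k1 := hn (fun v => ex v q.1) (by
    rw [List.mem_append]; exact Or.inl (List.mem_map.2 ⟨q, hq, rfl⟩))
  have k2 := hn (fun v => ex v q.2) (by
    rw [List.mem_append]; exact Or.inr (List.mem_map.2 ⟨q, hq, rfl⟩))
  dsimp only
  rw [e1, e2]
  exact ⟨⟨Subgroup.zpow_mem_zpowers _ _, fx_zpow_ne 0 k1⟩, Subgroup.zpow_mem_zpowers _ _, fx_zpow_ne 1 k2⟩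

lemma fe_of_ex [Finite V] (κ : Raag G →* F2) (i : Fin 2) {g g' : Raag G} (h : ∀ a, ex a g = ex a g') :
    fe i (κ g) = fe i (κ g') := by
  let f : Raag G →* Multiplicative ℤ :=
    { toFun := fun g => Multiplicative.ofAdd (fe i (κ g))
      map_one' := by simp
      map_mul' := by intro a b; simp [ofAdd_add] }
  have := hom_of_ex f h
  exact Multiplicative.ofAdd.injective this

lemma collapse_surj {κ : Raag G →* F2} {x y : V} (hx : κ (gen G x) = fx 0) (hy : κ (gen G y) = fx 1)
    {T : Set V} (hxT : x ∈ T) (hyT : y ∈ T) (φ : MulAut (Raag G)) :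
    Function.Surjective (κ.comp ((ret G T).comp φ.toMonoidHom)) := by
  rw [← MonoidHom.range_eq_top, eq_top_iff, ← F2_sup, sup_le_iff]
  constructor
  · rw [Subgroup.zpowers_le]
    refine ⟨φ⁻¹ (gen G y), ?_⟩
    simp [hy, ret_gen_mem hyT]
  · rw [Subgroup.zpowers_le]
    refine ⟨φ⁻¹ (gen G x), ?_⟩
    simp [hx, ret_gen_mem hxT]

/-- Rewriting `x * L * y * L⁻¹` as an alternating product. -/
lemma pp_twist {K : Type} [Group K] {H₁ H₂ : Subgroup K} (L : List (K × K)) (hL : GoodL H₁ H₂ L) :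
    ∀ x y : K, x ∈ H₁ → x ≠ 1 → y ∈ H₂ → y ≠ 1 →
      ∃ L', GoodL H₂ H₁ L' ∧ L'.length = 2 * L.length + 1 ∧ x * pp L * y * (pp L)⁻¹ = pp L' := by
  induction L with
  | nil =>
    intro x y hx hx1 hy hy1
    refine ⟨[(x, y)], ?_, rfl, by simp⟩
    intro p hp
    rw [List.mem_singleton] at hp
    subst hp
    exact ⟨⟨hx, hx1⟩, hy, hy1⟩
  | cons q L ih =>
    intro x y hx hx1 hy hy1
    obtain ⟨⟨h1, h2⟩, h3, h4⟩ := hL q (by simp)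
    obtain ⟨L', hL', hlen, he⟩ := ih (fun p hp => hL p (by simp [hp])) q.2 y h3 h4 hy hy1
    refine ⟨(x, q.1) :: (L' ++ [(q.2⁻¹, q.1⁻¹)]), ?_, by simp [hlen]; omega, ?_⟩
    · intro p hp
      rw [List.mem_cons, List.mem_append, List.mem_singleton] at hp
      rcases hp with rfl | hp | rfl
      · exact ⟨⟨hx, hx1⟩, h1, h2⟩
      · exact hL' p hp
      · exact ⟨⟨inv_mem h3, by simpa using h4⟩, inv_mem h1, by simpa using h2⟩
    · simp only [pp_cons, pp_append, ← he, pp_nil]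
      group

end Collapse

end RaagPaper

open SimpleGraph

namespace RaagPaper

section ConjGen

variable {V : Type} {G : SimpleGraph V}

lemma ret_other [Finite V] (hno : HasNoSIL G) {φ : MulAut (Raag G)} (hφ : IsIA φ) {v z : V}
    (hz : z ∉ upSet G v) : ret G (upSet G v) (φ (gen G z)) = 1 := by
  obtain ⟨j, k, hj, hw⟩ := support_lemma hφ z
  set w := k⁻¹ * φ (gen G z) ^ j * k with hwdef
  have h1 : ret G (upSet G v) w = 1 := by
    have h2 := ret_mem_par_inter (S := upSet G v) hw
    have h3 : ret G (upSet G v ∩ upSet G z) w = 1 := by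
      apply ret_clique
      · rintro s ⟨hs, hs'⟩ t ⟨ht, ht'⟩ hst
        exact upSet_clique hno hs' ht' (fun h => hz (h ▸ hs)) (fun h => hz (h ▸ ht)) hst
      · rintro q ⟨hq, _⟩
        have hqz : z ≠ q := fun h => hz (h ▸ hq)
        rw [hwdef]
        simp [hφ q (gen G z), ex_gen_ne hqz]
    rw [← mem_par.1 hw, ret_ret]
    exact h3
  rw [hwdef, map_mul, map_mul, map_inv, map_pow] at h1
  apply torsion_free hj
  have : ret G (upSet G v) (φ (gen G z)) ^ j =
    ret G (upSet G v) k * ((ret G (upSet G v) k)⁻¹ * ret G (upSet G v) (φ (gen G z)) ^ j *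
      ret G (upSet G v) k) * (ret G (upSet G v) k)⁻¹ := by group
  rw [this, h1]
  group

lemma conj_of_ret [Finite V] {φ : MulAut (Raag G)} (hφ : IsIA φ) {v : V}
    (h : IsConj (ret G (upSet G v) (φ (gen G v))) (gen G v)) : ∃ m, φ (gen G v) = m⁻¹ * gen G v * m := by
  obtain ⟨j, k, hj, hw⟩ := support_lemma hφ v
  obtain ⟨c, hc⟩ := isConj_iff.1 h
  have h1 := mem_par.1 hw
  set r := ret G (upSet G v)
  rw [map_mul, map_mul, map_inv, map_pow] at h1
  have e1 : r (φ (gen G v)) = c⁻¹ * gen G v * c := by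
    have e0 : r (φ (gen G v)) = c⁻¹ * (c * r (φ (gen G v)) * c⁻¹) * c := by group
    rw [hc] at e0
    exact e0
  have e2 : r (φ (gen G v)) ^ j = c⁻¹ * gen G v ^ j * c := by
    rw [e1]
    have := conj_pow (a := c⁻¹) (b := gen G v) (i := j)
    rwa [inv_inv] at this
  refine ⟨c * r k * k⁻¹, root_conj_gen hj ?_⟩
  have e3 : φ (gen G v) ^ j = k * (k⁻¹ * φ (gen G v) ^ j * k) * k⁻¹ := by group
  rw [e3, ← h1, e2]
  group

lemma conj_length [Finite V] {v q : V} {Q : Set V} (hQ : G.IsClique Q) (hq : q ∈ Q) (hvQ : v ∉ Q)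
    (hadj : ∀ s ∈ Q, ¬ G.Adj v s) {w : Raag G} (hw : w ∈ par G ({v} ∪ Q)) (hex : ∀ a, ex a w = ex a (gen G v))
    (hgp : ∀ κ : Raag G →* F2, κ (gen G v) = fx 0 → κ (gen G q) = fx 1 →
      (∀ s ∈ Q, ∃ k : ℤ, κ (gen G s) = fx 1 ^ k) → ∃ b, GP (κ w) b ∧ fe 0 b = 0 ∧ fe 1 b = 1) :
    IsConj w (gen G v) := by
  have hsup : w ∈ par G Q ⊔ par G {v} := by
    rw [par_eq_closure, par_eq_closure, ← Subgroup.closure_union, ← Set.image_union, ← par_eq_closure,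
      Set.union_comm]
    exact hw
  have exconj : ∀ {g g' : Raag G}, IsConj g g' → ex v g = ex v g' := by
    intro g g' h
    obtain ⟨c, rfl⟩ := isConj_iff.1 h
    simp
  obtain ⟨g', hc, h | h | ⟨L, hL0, hL, rfl⟩⟩ := alt_cyclic hsup
  · exfalso
    have h1 := exconj hc
    rw [hex, ex_gen_self, ex_of_par hvQ h] at h1
    exact one_ne_zero h1
  · have h1 := exconj hc
    rw [hex, ex_gen_self] at h1
    have h2 := mem_par.1 h
    rw [ret_singleton, ← h1, zpow_one] at h2
    rw [h2]
    exact hc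
  · exfalso
    obtain ⟨κ, -, k2, k3, k4, -, k6⟩ := collapse (G := G) (P := {v}) (P' := Q) (x := v) (y := q)
      (by rintro p rfl s hs; exact hadj s hs) (by simpa using hvQ) (by simp) hQ rfl hq L hL
    obtain ⟨b, hb, b0, b1⟩ := hgp κ k3 k4 k2
    have h1 := k6 hL0
    have hc' : IsConj (κ w) (κ (pp L)) := by
      obtain ⟨c, hc⟩ := isConj_iff.1 hc
      exact isConj_iff.2 ⟨κ c, by rw [← hc]; simp⟩
    rw [← ell_conj hc'] at h1
    have e0 : fe 0 (κ w) = 1 := by rw [fe_of_ex κ 0 hex, k3, fe_x]; simp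
    have e1 : fe 1 (κ w) = 0 := by rw [fe_of_ex κ 1 hex, k3, fe_x]; simp
    have h2 := (gp_ell hb e0 e1 b0 b1).1
    have h3 : 1 ≤ L.length := List.length_pos_iff.2 hL0
    omega

lemma ex_ret_upSet {φ : MulAut (Raag G)} (hφ : IsIA φ) {S : Set V} {q : V} (hq : q ∈ S) (a : V) :
    ex a (ret G S (φ (gen G q))) = ex a (gen G q) := by
  by_cases ha : a ∈ S
  · rw [ex_ret_mem ha, hφ]
  · rw [ex_ret_not_mem ha, ex_gen_ne]
    rintro rfl
    exact ha hq

lemma conj_gen_isolated [Finite V] {φ : MulAut (Raag G)} (hφ : IsIA φ) {v : V} (h : upSet G v ⊆ {v}) :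
    ∃ m, φ (gen G v) = m⁻¹ * gen G v * m := by
  apply conj_of_ret hφ
  have e : upSet G v = {v} := Set.Subset.antisymm h (by rintro x rfl; exact self_mem_upSet x)
  rw [e, ret_singleton, hφ, ex_gen_self, zpow_one]

/-- An automorphism acting trivially on the abelianization sends each generator to a conjugate. -/
lemma conj_gen [Finite V] (hno : HasNoSIL G) {φ : MulAut (Raag G)} (hφ : IsIA φ) (v : V) :
    ∃ m, φ (gen G v) = m⁻¹ * gen G v * m := by
  classical
  set Q : Set V := upSet G v \ {v} with hQdef
  have hS : upSet G v = {v} ∪ Q := by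
    ext z
    by_cases hz : z = v
    · subst hz; simp [self_mem_upSet]
    · simp [hQdef, hz]
  have hvQ : v ∉ Q := by simp [hQdef]
  have hadj : ∀ s ∈ Q, ¬ G.Adj v s := fun s hs => not_adj_of_mem_upSet hs.1
  have hQ : G.IsClique Q := by
    rintro s ⟨hs, hs1⟩ t ⟨ht, ht1⟩ hst
    exact upSet_clique hno hs ht hs1 ht1 hst
  rcases Set.eq_empty_or_nonempty Q with hQe | ⟨q, hq⟩
  · apply conj_gen_isolated hφ
    rw [hS, hQe]; simp
  by_cases hiso : ∀ s ∈ Q, upSet G s ⊆ {s}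
  · obtain ⟨c, hc⟩ := conj_gen_isolated hφ (hiso q hq)
    set ψ : MulAut (Raag G) := MulAut.conj c * φ with hψ
    have hψIA : IsIA ψ := (isIA_conj c).mul hφ
    have hψq : ψ (gen G q) = gen G q := by
      rw [hψ, MulAut.mul_apply, hc, MulAut.conj_apply]; group
    set r := ret G (upSet G v) with hr
    have hrq : ∀ s ∈ Q, r (ψ (gen G s)) = gen G s := by
      intro s hs
      by_cases hsq : s = q
      · rw [hsq, hψq, hr, ret_gen_mem hq.1]
      have hcomm : Commute (r (ψ (gen G s))) (gen G q) := by
        have h1 : Commute (gen G s) (gen G q) := gen_comm (hQ hs hq hsq)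
        have h2 := (h1.map ψ.toMonoidHom).map r
        change Commute (r (ψ (gen G s))) (r (ψ (gen G q))) at h2
        rwa [hψq, hr, ret_gen_mem hq.1] at h2
      have h1 := mem_par_inter (mem_par_star_of_commute hcomm) (ret_mem_par (upSet G v) (ψ (gen G s)))
      have h2 : r (ψ (gen G s)) ∈ par G Q := by
        refine par_mono ?_ h1
        rintro z ⟨hz, hz'⟩
        refine ⟨hz', ?_⟩
        rintro rfl
        rcases hz with h | h
        · exact hvQ (h ▸ hq)
        · exact hadj q hq h.symm
      have h3 : r (ψ (gen G s)) * (gen G s)⁻¹ ∈ par G Q := mul_mem h2 (inv_mem (gen_mem_par hs))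
      have h4 := ret_clique (g := r (ψ (gen G s)) * (gen G s)⁻¹) hQ (by
        intro a _
        rw [ex_mul, ex_inv, hr, ex_ret_upSet hψIA hs.1]; ring)
      rw [mem_par.1 h3] at h4
      exact mul_inv_eq_one.1 h4
    obtain ⟨m, hm⟩ : ∃ m, ψ (gen G v) = m⁻¹ * gen G v * m := by
      apply conj_of_ret hψIA
      refine conj_length hQ hq hvQ hadj (by rw [← hS]; exact ret_mem_par _ _)
        (ex_ret_upSet hψIA (self_mem_upSet v)) ?_
      intro κ k1 k2 k3
      refine ⟨fx 1, ?_, by rw [fe_x]; simp, by rw [fe_x]; simp⟩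
      refine gp_of_surj _ (collapse_surj k1 k2 (self_mem_upSet v) hq.1 ψ) ?_
      intro z
      change κ (r (ψ (gen G z))) ∈ _
      by_cases hzS : z ∈ upSet G v
      · by_cases hzv : z = v
        · subst hzv
          exact Subgroup.subset_closure (by simp [hr])
        · rw [hrq z ⟨hzS, hzv⟩]
          obtain ⟨k, hk⟩ := k3 z ⟨hzS, hzv⟩
          rw [hk]
          exact zpow_mem (Subgroup.subset_closure (by simp)) _
      · rw [hr, ret_other hno hψIA hzS, map_one]
        exact one_mem _
    refine ⟨m * c, ?_⟩
    have e : φ (gen G v) = c⁻¹ * ψ (gen G v) * c := by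
      rw [hψ, MulAut.mul_apply, MulAut.conj_apply]; group
    rw [e, hm]; group
  · push Not at hiso
    obtain ⟨q, hq, hqS⟩ := hiso
    obtain ⟨s, hs, hsq⟩ := Set.not_subset.1 hqS
    have hsS : s ∈ upSet G v := fun z hz => hs (hq.1 hz)
    have hsv : s = v := by
      by_contra hne
      exact not_adj_of_mem_upSet hs (hQ hq ⟨hsS, hne⟩ (fun h => hsq h.symm))
    subst hsv
    have hQq : ∀ t ∈ Q, t = q := by
      intro t ht
      by_contra hne
      exact hadj t ht (hs (hQ hq ht (fun h => hne h.symm)))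
    apply conj_of_ret hφ
    refine conj_length hQ hq hvQ hadj (by rw [← hS]; exact ret_mem_par _ _)
      (ex_ret_upSet hφ (self_mem_upSet s)) ?_
    intro κ k1 k2 k3
    refine ⟨κ (ret G (upSet G s) (φ (gen G q))), ?_, ?_, ?_⟩
    · refine gp_of_surj _ (collapse_surj k1 k2 (self_mem_upSet s) hq.1 φ) ?_
      intro z
      change κ (ret G (upSet G s) (φ (gen G z))) ∈ _
      by_cases hzS : z ∈ upSet G s
      · by_cases hzv : z = s
        · subst hzv
          exact Subgroup.subset_closure (by simp)
        · rw [hQq z ⟨hzS, hzv⟩]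
          exact Subgroup.subset_closure (by simp)
      · rw [ret_other hno hφ hzS, map_one]
        exact one_mem _
    · rw [fe_of_ex κ 0 (ex_ret_upSet hφ hq.1), k2, fe_x]; simp
    · rw [fe_of_ex κ 1 (ex_ret_upSet hφ hq.1), k2, fe_x]; simp

end ConjGen

end RaagPaper

open SimpleGraph

namespace RaagPaper

section Inner

variable {V : Type} {G : SimpleGraph V}

lemma star_symm {u v : V} : u ∈ star G v ↔ v ∈ star G u := by
  simp only [star, Set.mem_insert_iff, mem_neighborSet]
  constructor <;> rintro (h | h)
  · exact Or.inl h.symm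
  · exact Or.inr h.symm
  · exact Or.inl h.symm
  · exact Or.inr h.symm

lemma self_mem_star (v : V) : v ∈ star G v := Or.inl rfl

lemma adj_mem_star {u v : V} (h : G.Adj u v) : v ∈ star G u := Or.inr h

/-- `h` records conjugators for `φ`. -/
def Rec (φ : MulAut (Raag G)) (h : V → Raag G) : Prop := ∀ v, φ (gen G v) = (h v)⁻¹ * gen G v * h v

lemma commute_of_conj_eq {a k k' : Raag G} (h : k⁻¹ * a * k = k'⁻¹ * a * k') : Commute (k * k'⁻¹) a := by
  have e : a * k = k * (k'⁻¹ * a * k') := by rw [← h]; group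
  have : k * k'⁻¹ * a = k * (k'⁻¹ * a * k') * k'⁻¹ := by group
  rw [Commute, SemiconjBy, this, ← e]
  group

lemma rec_edge [Finite V] {φ : MulAut (Raag G)} {h : V → Raag G} (hh : Rec φ h) {u v : V} (huv : G.Adj u v) :
    ∃ p ∈ par G (star G u), ∃ q ∈ par G (star G v), p * h u = q * h v := by
  have h1 : Commute (φ (gen G u)) (φ (gen G v)) := (gen_comm huv).map φ.toMonoidHom
  rw [hh u, hh v] at h1
  set g := h u * (h v)⁻¹ with hg
  have h2 : Commute (g * gen G v * g⁻¹) (gen G u) := by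
    have h3 := h1.map (MulAut.conj (h u)).toMonoidHom
    simp only [MulEquiv.coe_toMonoidHom, MulAut.conj_apply] at h3
    have e1 : h u * ((h u)⁻¹ * gen G u * h u) * (h u)⁻¹ = gen G u := by group
    have e2 : h u * ((h v)⁻¹ * gen G v * h v) * (h u)⁻¹ = g * gen G v * g⁻¹ := by rw [hg]; group
    change Commute (h u * ((h u)⁻¹ * gen G u * h u) * (h u)⁻¹)
      (h u * ((h v)⁻¹ * gen G v * h v) * (h u)⁻¹) at h3
    rw [e1, e2] at h3
    exact h3.symm
  have h3 := mem_par.1 (mem_par_star_of_commute h2)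
  rw [map_mul, map_mul, map_inv, ret_gen_mem (adj_mem_star huv)] at h3
  set s := ret G (star G u) g with hs
  have h4 : Commute (s⁻¹ * g) (gen G v) := by
    rw [Commute, SemiconjBy]
    have : s⁻¹ * g * gen G v = s⁻¹ * (g * gen G v * g⁻¹) * g := by group
    rw [this, ← h3]
    group
  refine ⟨s⁻¹, inv_mem (ret_mem_par _ _), s⁻¹ * g, mem_par_star_of_commute h4, ?_⟩
  rw [hg]; group

lemma rec_ex_edge [Finite V] {φ : MulAut (Raag G)} {h : V → Raag G} (hh : Rec φ h) {u v a : V}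
    (huv : G.Adj u v) (hu : u ∉ star G a) (hv : v ∉ star G a) : ex a (h u) = ex a (h v) := by
  obtain ⟨p, hp, q, hq, e⟩ := rec_edge hh huv
  have := congrArg (ex a) e
  rw [ex_mul, ex_mul, ex_of_par (fun h => hu (star_symm.1 h)) hp, ex_of_par (fun h => hv (star_symm.1 h)) hq] at this
  simpa using this

lemma rec_ex_unique [Finite V] {φ : MulAut (Raag G)} {v a : V} {k k' : Raag G}
    (hk : φ (gen G v) = k⁻¹ * gen G v * k) (hk' : φ (gen G v) = k'⁻¹ * gen G v * k')
    (hv : v ∉ star G a) : ex a k = ex a k' := by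
  have h1 := mem_par_star_of_commute (commute_of_conj_eq (hk.symm.trans hk'))
  have := ex_of_par (fun h => hv (star_symm.1 h)) h1
  rw [ex_mul, ex_inv] at this
  omega

lemma reach_const {S : Set V} {X : Type*} (f : V → X) (hf : ∀ u ∈ S, ∀ v ∈ S, G.Adj u v → f u = f v)
    {u v : S} (h : (G.induce S).Reachable u v) : f u = f v := by
  obtain ⟨p⟩ := h
  induction p with
  | nil => rfl
  | cons h p ih =>
    rw [← ih]
    exact hf _ (Subtype.property _) _ (Subtype.property _) h

/-- The normalised error term. -/
noncomputable def err (G : SimpleGraph V) (T : Set V) (h : V → Raag G) (v : V) : Raag G :=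
  (ret G (T ∩ star G v) (h v))⁻¹ * ret G T (h v)

lemma err_smul {T : Set V} {v : V} {q k : Raag G} (hq : q ∈ par G (star G v)) :
    (ret G (T ∩ star G v) (q * k))⁻¹ * ret G T (q * k) = (ret G (T ∩ star G v) k)⁻¹ * ret G T k := by
  have : ret G T q = ret G (T ∩ star G v) q := by
    conv_lhs => rw [← mem_par.1 hq]
    rw [ret_ret]
  rw [map_mul, map_mul, this]
  group

lemma ret_of_mem_star {T : Set V} {v : V} {k : Raag G} (hk : ret G T k ∈ par G (star G v)) :
    ret G T k = ret G (T ∩ star G v) k := by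
  rw [Set.inter_comm, ← ret_ret]
  exact (mem_par.1 hk).symm

lemma err_ret {T : Set V} {h : V → Raag G}
    (hsub : ∀ T', T' ⊂ T → ∀ v, ret G T' (h v) ∈ par G (star G v)) (v : V) {T' : Set V} (hT' : ¬ T ⊆ T') :
    ret G T' (err G T h v) = 1 := by
  have h1 : T' ∩ T ⊂ T := ⟨Set.inter_subset_right, fun hh => hT' fun t ht => (hh ht).1⟩
  have h2 := ret_of_mem_star (hsub _ h1 v)
  rw [err, map_mul, map_inv, ret_ret, ret_ret, ← Set.inter_assoc, h2]
  group

lemma err_mem (T : Set V) (h : V → Raag G) (v : V) : err G T h v ∈ par G T :=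
  mul_mem (inv_mem (par_mono Set.inter_subset_left (ret_mem_par _ _))) (ret_mem_par _ _)

lemma err_edge [Finite V] {φ : MulAut (Raag G)} {T : Set V} {h : V → Raag G} (hh : Rec φ h)
    (hsub : ∀ T', T' ⊂ T → ∀ v, ret G T' (h v) ∈ par G (star G v)) {u v : V} (hu : ¬ T ⊆ star G u)
    (hv : ¬ T ⊆ star G v) (huv : G.Adj u v) : err G T h u = err G T h v := by
  obtain ⟨p, hp, q, hq, e⟩ := rec_edge hh huv
  rw [err, err, ← err_smul hp, ← err_smul hq (k := h v), e]
  congr 2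
  have ss : ∀ {w : V}, ¬ T ⊆ star G w → T ∩ star G w ⊂ T := fun hw =>
    ⟨Set.inter_subset_left, fun hh => hw fun t ht => (hh ht).2⟩
  have key : ∀ {S : Set V} {w : V} {r : Raag G}, r ∈ par G (star G w) → T ∩ S ⊂ T →
      ret G (T ∩ S) (r * h w) = ret G (T ∩ S ∩ star G w) (r * h w) := by
    intro S w r hr hS
    apply ret_of_mem_star
    rw [map_mul]
    refine mul_mem ?_ (hsub _ hS w)
    exact par_mono Set.inter_subset_right (ret_mem_par_inter hr)
  rw [key hq (ss hu), ← e, key hp (ss hv)]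
  congr 2
  rw [Set.inter_assoc, Set.inter_assoc, Set.inter_comm (star G u)]

lemma err_const {T : Set V} {h : V → Raag G}
    (hsub : ∀ T', T' ⊂ T → ∀ v, ret G T' (h v) ∈ par G (star G v)) {v₀ : V}
    (hc : ∀ v, ¬ T ⊆ star G v → err G T h v = err G T h v₀) :
    ∃ n : Raag G, (∀ T', ¬ T ⊆ T' → ret G T' n = 1) ∧ ∀ v, ret G T (h v * n⁻¹) ∈ par G (star G v) := by
  refine ⟨err G T h v₀, fun T' hT' => err_ret hsub v₀ hT', fun v => ?_⟩
  by_cases hv : T ⊆ star G v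
  · exact par_mono hv (ret_mem_par _ _)
  · rw [map_mul, map_inv, mem_par.1 (err_mem T h v₀), ← hc v hv]
    have : ret G T (h v) * (err G T h v)⁻¹ = ret G (T ∩ star G v) (h v) := by rw [err]; group
    rw [this]
    exact par_mono Set.inter_subset_right (ret_mem_par _ _)

lemma err_one {T : Set V} {h : V → Raag G} {v : V} (hv : ret G T (h v) ∈ par G (star G v)) :
    err G T h v = 1 := by
  rw [err, ← ret_of_mem_star hv]
  group

end Inner

end RaagPaper

open SimpleGraph

namespace RaagPaper

section Inner2

variable {V : Type} {G : SimpleGraph V}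

/-- Reachability inside a set of vertices. -/
def RS (G : SimpleGraph V) (S : Set V) (u v : V) : Prop :=
  ∃ (hu : u ∈ S) (hv : v ∈ S), (G.induce S).Reachable ⟨u, hu⟩ ⟨v, hv⟩

lemma RS.symm {S : Set V} {u v : V} (h : RS G S u v) : RS G S v u := by
  obtain ⟨hu, hv, h⟩ := h
  exact ⟨hv, hu, h.symm⟩

lemma RS.trans {S : Set V} {u v w : V} (h : RS G S u v) (h' : RS G S v w) : RS G S u w := by
  obtain ⟨hu, hv, h⟩ := h
  obtain ⟨hv', hw, h'⟩ := h'
  exact ⟨hu, hw, h.trans h'⟩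

lemma RS.refl {S : Set V} {u : V} (h : u ∈ S) : RS G S u u := ⟨h, h, Reachable.refl _⟩

lemma RS.of_adj {S : Set V} {u v : V} (hu : u ∈ S) (hv : v ∈ S) (h : G.Adj u v) : RS G S u v := by
  refine ⟨hu, hv, Adj.reachable ?_⟩
  exact h

lemma RS.mono {S S' : Set V} (hS : S ⊆ S') {u v : V} (h : RS G S u v) : RS G S' u v := by
  obtain ⟨hu, hv, h⟩ := h
  exact ⟨hS hu, hS hv, h.map (induceHomOfLE G hS).toHom⟩

lemma RS.const {S : Set V} {X : Type*} (f : V → X) (hf : ∀ u ∈ S, ∀ v ∈ S, G.Adj u v → f u = f v)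
    {u v : V} (h : RS G S u v) : f u = f v := by
  obtain ⟨hu, hv, h⟩ := h
  exact reach_const f hf h

/-- Without SILs, two non-adjacent vertices reach everything. -/
lemma reach_of_noSIL (hno : HasNoSIL G) {S : Set V} {x y z : V} (hxy : x ≠ y) (hadj : ¬ G.Adj x y)
    (hxS : x ∈ S) (hyS : y ∈ S) (hzS : z ∈ S) (hS : (G.neighborSet x ∩ G.neighborSet y)ᶜ ⊆ S) :
    RS G S x z ∨ RS G S y z := by
  by_cases hxz : x = z
  · subst hxz; exact Or.inl (RS.refl hxS)
  by_cases hyz : y = z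
  · subst hyz; exact Or.inr (RS.refl hyS)
  by_cases axz : G.Adj x z
  · exact Or.inl (RS.of_adj hxS hzS axz)
  by_cases ayz : G.Adj y z
  · exact Or.inr (RS.of_adj hyS hzS ayz)
  have h := hno x y z
  rw [IsSIL] at h
  have h2 : ¬ ∀ C : Set V, IsCC G ((G.neighborSet x ∩ G.neighborSet y)ᶜ) C → z ∈ C → x ∉ C ∧ y ∉ C :=
    fun h' => h ⟨hxy, hxz, hyz, hadj, axz, ayz, h'⟩
  push Not at h2
  obtain ⟨C, ⟨c, rfl⟩, ⟨hz, hzc⟩, himp⟩ := h2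
  have e : RS G S z c := RS.mono hS ⟨hz, c.2, hzc⟩
  by_cases hx : x ∈ {w : V | ∃ h : w ∈ (G.neighborSet x ∩ G.neighborSet y)ᶜ,
    (G.induce (G.neighborSet x ∩ G.neighborSet y)ᶜ).Reachable ⟨w, h⟩ c}
  · obtain ⟨h3, h4⟩ := hx
    exact Or.inl ((RS.mono hS ⟨h3, c.2, h4⟩).trans e.symm)
  · obtain ⟨h3, h4⟩ := himp hx
    exact Or.inr ((RS.mono hS ⟨h3, c.2, h4⟩).trans e.symm)

/-- The hard case: two cliques. -/
lemma err_two [Finite V] {φ : MulAut (Raag G)} {T P P' : Set V} {h : V → Raag G} (hh : Rec φ h)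
    (hsub : ∀ T', T' ⊂ T → ∀ v, ret G T' (h v) ∈ par G (star G v))
    (hT : T = P ∪ P') (hdis : Disjoint P P') (hP : G.IsClique P) (hP' : G.IsClique P')
    (hPP : ∀ p ∈ P, ∀ q ∈ P', ¬ G.Adj p q) {x y : V} (hx : x ∈ P) (hy : y ∈ P')
    (ex1 : ∀ p ∈ P, err G T h p = err G T h x) (ey1 : ∀ p ∈ P', err G T h p = err G T h y) :
    err G T h x = err G T h y := by
  have hxT : x ∈ T := hT ▸ Or.inl hx
  have hyT : y ∈ T := hT ▸ Or.inr hy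
  have hnP : ∀ p ∈ P', p ∉ P := fun p hp hp' => Set.disjoint_left.1 hdis hp' hp
  have hTP : ¬ T ⊆ P := fun hs => hnP y hy (hs hyT)
  have hTP' : ¬ T ⊆ P' := fun hs => hnP x (hs hxT) hx
  set nx := err G T h x with hnx
  set ny := err G T h y with hny
  set g := nx * ny⁻¹ with hg
  have hret : ∀ z ∈ T, ret G T (φ (gen G z)) = (err G T h z)⁻¹ * gen G z * err G T h z := by
    intro z hz
    have e1 : ret G T (h z) = ret G (T ∩ star G z) (h z) * err G T h z := by rw [err]; group
    have e2 : Commute (ret G (T ∩ star G z) (h z)) (gen G z) :=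
      commute_of_mem_par_star (par_mono Set.inter_subset_right (ret_mem_par _ _))
    rw [hh z, map_mul, map_mul, map_inv, ret_gen_mem hz, e1, mul_inv_rev]
    have e3 : (ret G (T ∩ star G z) (h z))⁻¹ * gen G z * ret G (T ∩ star G z) (h z) = gen G z := by
      rw [mul_assoc, ← e2.eq]; group
    calc _ = (err G T h z)⁻¹ * ((ret G (T ∩ star G z) (h z))⁻¹ * gen G z * ret G (T ∩ star G z) (h z))
        * err G T h z := by group
      _ = _ := by rw [e3]
  have hretn : ∀ z, z ∉ T → ret G T (φ (gen G z)) = 1 := by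
    intro z hz
    rw [hh z, map_mul, map_mul, map_inv, ret_gen_not_mem hz]
    group
  have hgT : g ∈ par G P ⊔ par G P' := by
    rw [par_eq_closure, par_eq_closure, ← Subgroup.closure_union, ← Set.image_union, ← par_eq_closure, ← hT]
    exact mul_mem (err_mem _ _ _) (inv_mem (err_mem _ _ _))
  obtain ⟨α, L, β, hα, hβ, hL, hgL⟩ := alt_form hgT
  have gne : ∀ v : V, gen G v ≠ 1 := by
    intro v hv
    have := congrArg (ex v) hv
    simp at this
  obtain ⟨L', hL', hlen, hLL⟩ := pp_twist L hL (gen G x) (gen G y) (gen_mem_par hx) (gne x)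
    (gen_mem_par hy) (gne y)
  obtain ⟨κ, k1, k2, k3, k4, k5, k6⟩ := collapse hPP hdis hP hP' hx hy L' hL'
  have cx : Commute α (gen G x) := commute_of_mem_par_star (par_mono (fun p hp => by
    by_cases hpx : p = x
    · subst hpx; exact self_mem_star _
    · exact adj_mem_star (hP hx hp (fun h => hpx h.symm))) hα)
  have cy : Commute β (gen G y) := commute_of_mem_par_star (par_mono (fun p hp => by
    by_cases hpx : p = y
    · subst hpx; exact self_mem_star _
    · exact adj_mem_star (hP' hy hp (fun h => hpx h.symm))) hβ)
  have hgp : GP (κ (nx⁻¹ * gen G x * nx)) (κ (ny⁻¹ * gen G y * ny)) := by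
    refine gp_of_surj _ (collapse_surj k3 k4 hxT hyT φ) ?_
    intro z
    change κ (ret G T (φ (gen G z))) ∈ _
    by_cases hz : z ∈ T
    · rw [hret z hz]
      rw [hT] at hz
      rcases hz with hz | hz
      · rw [ex1 z hz]
        obtain ⟨k, hk⟩ := k1 z hz
        have : κ (nx⁻¹ * gen G z * nx) = (κ (nx⁻¹ * gen G x * nx)) ^ k := by
          simp only [map_mul, map_inv, hk, k3]
          have := conj_zpow (a := (κ nx)⁻¹) (b := fx 0) (i := k)
          rw [inv_inv] at this
          exact this.symm
        rw [this]
        exact zpow_mem (Subgroup.subset_closure (by simp)) _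
      · rw [ey1 z hz]
        obtain ⟨k, hk⟩ := k2 z hz
        have : κ (ny⁻¹ * gen G z * ny) = (κ (ny⁻¹ * gen G y * ny)) ^ k := by
          simp only [map_mul, map_inv, hk, k4]
          have := conj_zpow (a := (κ ny)⁻¹) (b := fx 1) (i := k)
          rw [inv_inv] at this
          exact this.symm
        rw [this]
        exact zpow_mem (Subgroup.subset_closure (by simp)) _
    · rw [hretn z hz, map_one]
      exact one_mem _
  have hell := (gp_ell hgp (by simp [k3, fe_x]) (by simp [k3, fe_x]) (by simp [k4, fe_x])
    (by simp [k4, fe_x])).2.2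
  have hconj : IsConj (κ (nx⁻¹ * gen G x * nx) * κ (ny⁻¹ * gen G y * ny)) (κ (pp L')) := by
    rw [← map_mul]
    refine isConj_iff.2 ⟨κ (α⁻¹ * nx), ?_⟩
    rw [← map_inv, ← map_mul, ← map_mul]
    congr 1
    rw [← hLL]
    have e1 : α⁻¹ * nx * (nx⁻¹ * gen G x * nx * (ny⁻¹ * gen G y * ny)) * (α⁻¹ * nx)⁻¹ =
        α⁻¹ * gen G x * g * gen G y * g⁻¹ * α := by rw [hg]; group
    have e2 : α⁻¹ * gen G x = gen G x * α⁻¹ := cx.inv_left.eq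
    have e3 : β * gen G y * β⁻¹ = gen G y := by rw [cy.eq]; group
    rw [e1, e2, hgL]
    calc _ = gen G x * pp L * (β * gen G y * β⁻¹) * (pp L)⁻¹ := by group
      _ = _ := by rw [e3]
  rw [ell_conj hconj] at hell
  have hL0 : L = [] := by
    have h6 := k6 (by intro h0; rw [h0] at hlen; simp at hlen)
    rw [hell, hlen] at h6
    exact List.length_eq_zero_iff.1 (by omega)
  subst hL0
  have hgab : g = α * β := by rw [hgL]; simp
  have r1 : ret G P g = 1 := by
    rw [hg, map_mul, map_inv, err_ret hsub x hTP, err_ret hsub y hTP]; group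
  have r2 : ret G P' g = 1 := by
    rw [hg, map_mul, map_inv, err_ret hsub x hTP', err_ret hsub y hTP']; group
  have i1 : ret G P β = 1 := by
    have := ret_mem_par_inter (S := P) hβ
    rwa [Set.disjoint_iff_inter_eq_empty.1 hdis, mem_par_empty] at this
  have i2 : ret G P' α = 1 := by
    have := ret_mem_par_inter (S := P') hα
    rwa [Set.inter_comm, Set.disjoint_iff_inter_eq_empty.1 hdis, mem_par_empty] at this
  rw [hgab, map_mul, i1, mul_one, mem_par.1 hα] at r1
  rw [hgab, map_mul, i2, one_mul, mem_par.1 hβ] at r2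
  rw [r1, r2, mul_one] at hgab
  exact mul_inv_eq_one.1 hgab

lemma inner_step [Finite V] (hno : HasNoSIL G) {φ : MulAut (Raag G)} (hφ : IsIA φ) {T : Set V}
    {h : V → Raag G} (hh : Rec φ h)
    (hΘ : ∀ a z z', z ∉ star G a → z' ∉ star G a → ex a (h z) = ex a (h z'))
    (hsub : ∀ T', T' ⊂ T → ∀ v, ret G T' (h v) ∈ par G (star G v)) :
    ∃ n : Raag G, (∀ T', ¬ T ⊆ T' → ret G T' n = 1) ∧ ∀ v, ret G T (h v * n⁻¹) ∈ par G (star G v) := by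
  classical
  by_cases hVT : ∃ v₀, ¬ T ⊆ star G v₀
  swap
  · push Not at hVT
    exact ⟨1, fun T' _ => map_one _, fun v => par_mono (hVT v) (ret_mem_par _ _)⟩
  obtain ⟨v₀, hv₀⟩ := hVT
  by_cases hcone : ∃ t ∈ T, ∀ t' ∈ T, t' ≠ t → G.Adj t t'
  · obtain ⟨t, ht, hadj⟩ := hcone
    by_cases hTt : T = {t}
    · subst hTt
      refine err_const hsub (v₀ := v₀) fun v hv => ?_
      have key : ∀ w, ¬ {t} ⊆ star G w → err G {t} h w = gen G t ^ ex t (h w) := by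
        intro w hw
        have : ({t} : Set V) ∩ star G w = ∅ := by
          ext s
          simp only [Set.mem_inter_iff, Set.mem_singleton_iff, Set.mem_empty_iff_false, iff_false, not_and]
          rintro rfl hs
          exact hw (by simpa using hs)
        rw [err, this, ret_empty, ret_singleton]
        group
      rw [key v hv, key v₀ hv₀, hΘ t v v₀]
      · exact fun hs => hv (by simpa using star_symm.1 hs)
      · exact fun hs => hv₀ (by simpa using star_symm.1 hs)
    · refine err_const hsub (v₀ := v₀) fun v _ => ?_
      have key : ∀ w, err G T h w = 1 := by
        intro w
        apply err_one
        have e : T = {t} ∪ (T \ {t}) := by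
          ext s
          by_cases hs : s = t
          · subst hs; simp [ht]
          · simp [hs]
        have j := ret_join (G := G) (T₁ := {t}) (T₂ := T \ {t})
          (by rintro u rfl s ⟨hs, hs'⟩; exact hadj s hs hs') (h w)
        rw [← e] at j
        rw [j]
        refine mul_mem (hsub _ ⟨by simpa using ht, ?_⟩ w) (hsub (T \ {t}) ⟨Set.sdiff_subset, fun hs => (hs ht).2 rfl⟩ w)
        intro hs
        exact hTt (Set.Subset.antisymm hs (by simpa using ht))
      rw [key, key]
  · push Not at hcone
    set S : Set V := {v | ¬ T ⊆ star G v} with hS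
    have hTS : T ⊆ S := by
      intro t ht hs
      obtain ⟨t', ht', hne, hna⟩ := hcone t ht
      rcases hs ht' with h1 | h1
      · exact hne h1
      · exact hna h1
    have hcompl : ∀ x ∈ T, ∀ y ∈ T, (G.neighborSet x ∩ G.neighborSet y)ᶜ ⊆ S := by
      intro x hx y hy w hw
      by_contra hwS
      have hwS' : T ⊆ star G w := by simpa [hS] using hwS
      have key : ∀ x ∈ T, w ∈ G.neighborSet x := by
        intro x hx
        rcases hwS' hx with h1 | h1
        · exact absurd (hTS (h1 ▸ hx)) hwS
        · exact G.adj_symm h1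
      exact hw ⟨key x hx, key y hy⟩
    have hconst : ∀ {u v}, RS G S u v → err G T h u = err G T h v := fun hr =>
      RS.const (fun v => err G T h v) (fun u hu v hv huv => err_edge hh hsub hu hv huv) hr
    obtain ⟨t₀, ht₀⟩ : T.Nonempty := by
      obtain ⟨t, ht, _⟩ := Set.not_subset.1 hv₀
      exact ⟨t, ht⟩
    by_cases hpair : ∃ x ∈ T, ∃ y ∈ T, x ≠ y ∧ ¬ G.Adj x y ∧ RS G S x y
    · obtain ⟨x, hx, y, hy, hne, hna, hr⟩ := hpair
      refine err_const hsub (v₀ := x) fun v hv => ?_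
      rcases reach_of_noSIL hno hne hna (hTS hx) (hTS hy) hv (hcompl x hx y hy) with h1 | h1
      · exact (hconst h1).symm
      · exact (hconst (hr.trans h1)).symm
    · push Not at hpair
      obtain ⟨y, hy, hne, hna⟩ := hcone t₀ ht₀
      have hnr := hpair t₀ ht₀ y hy hne.symm hna
      have hreach := fun {z} (hz : z ∈ S) =>
        reach_of_noSIL hno hne.symm hna (hTS ht₀) (hTS hy) hz (hcompl t₀ ht₀ y hy)
      have hxy : err G T h t₀ = err G T h y := by
        refine err_two hh hsub (P := {t | t ∈ T ∧ RS G S t₀ t}) (P' := {t | t ∈ T ∧ RS G S y t}) ?_ ?_ ?_ ?_ ?_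
          ⟨ht₀, RS.refl (hTS ht₀)⟩ ⟨hy, RS.refl (hTS hy)⟩ ?_ ?_
        · ext t
          constructor
          · intro ht
            rcases hreach (hTS ht) with h1 | h1
            · exact Or.inl ⟨ht, h1⟩
            · exact Or.inr ⟨ht, h1⟩
          · rintro (h1 | h1) <;> exact h1.1
        · rw [Set.disjoint_left]
          rintro t ⟨_, h1⟩ ⟨_, h2⟩
          exact hnr (h1.trans h2.symm)
        · rintro s ⟨hs, h1⟩ t ⟨ht, h2⟩ hst
          by_contra hcon
          exact hpair s hs t ht hst hcon (h1.symm.trans h2)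
        · rintro s ⟨hs, h1⟩ t ⟨ht, h2⟩ hst
          by_contra hcon
          exact hpair s hs t ht hst hcon (h1.symm.trans h2)
        · rintro s ⟨hs, h1⟩ t ⟨ht, h2⟩ hst
          exact hnr ((h1.trans (RS.of_adj (hTS hs) (hTS ht) hst)).trans h2.symm)
        · rintro s ⟨_, h1⟩
          exact (hconst h1).symm
        · rintro s ⟨_, h1⟩
          exact (hconst h1).symm
      refine err_const hsub (v₀ := t₀) fun v hv => ?_
      rcases hreach hv with h1 | h1
      · exact (hconst h1).symm
      · rw [hxy]; exact (hconst h1).symm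

lemma rec_shift {φ : MulAut (Raag G)} {h : V → Raag G} (hh : Rec φ h) (g : Raag G) :
    Rec (MulAut.conj g * φ) (fun v => h v * g⁻¹) := by
  intro v
  rw [MulAut.mul_apply, MulAut.conj_apply, hh v]
  group

lemma inner_family [Finite V] (hno : HasNoSIL G) {φ : MulAut (Raag G)} (hφ : IsIA φ)
    {h : V → Raag G} (hh : Rec φ h)
    (hΘ : ∀ a z z', z ∉ star G a → z' ∉ star G a → ex a (h z) = ex a (h z')) (k : ℕ) :
    ∀ F : Finset (Set V), F.card = k → (∀ T ∈ F, ∀ T', T' ⊆ T → T' ∈ F) →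
      ∃ g : Raag G, ∀ T ∈ F, ∀ v, ret G T (h v * g⁻¹) ∈ par G (star G v) := by
  classical
  induction k with
  | zero =>
    intro F hF _
    rw [Finset.card_eq_zero] at hF
    subst hF
    exact ⟨1, by simp⟩
  | succ k ih =>
    intro F hF hdown
    obtain ⟨T, hT⟩ := F.exists_maximal (Finset.card_pos.1 (by omega))
    have hTF := hT.prop
    have hmax : ∀ T' ∈ F, T ⊆ T' → T' = T := fun T' hT' hs =>
      Set.Subset.antisymm (hT.le_of_ge hT' hs) hs
    obtain ⟨g, hg⟩ := ih (F.erase T) (by rw [Finset.card_erase_of_mem hTF, hF]; rfl) (by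
      intro S hS S' hS'
      rw [Finset.mem_erase] at hS ⊢
      refine ⟨?_, hdown S hS.2 S' hS'⟩
      rintro rfl
      exact hS.1 (hmax S hS.2 hS'))
    obtain ⟨n, hn1, hn2⟩ := inner_step hno ((isIA_conj g).mul hφ) (T := T) (rec_shift hh g)
      (by
        intro a z z' hz hz'
        rw [ex_mul, ex_mul, hΘ a z z' hz hz'])
      (by
        intro T' hT' v
        exact hg T' (Finset.mem_erase.2 ⟨hT'.ne, hdown T hTF T' hT'.subset⟩) v)
    refine ⟨n * g, ?_⟩
    intro S hS v
    have e : h v * (n * g)⁻¹ = h v * g⁻¹ * n⁻¹ := by group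
    rw [e]
    by_cases hST : S = T
    · subst hST; exact hn2 v
    · rw [map_mul, map_inv, hn1 S (fun hs => hST (hmax S hS hs)), inv_one, mul_one]
      exact hg S (Finset.mem_erase.2 ⟨hST, hS⟩) v

/-- Vanishing of the invariants implies that the automorphism is inner. -/
lemma inner_of_zero [Finite V] (hno : HasNoSIL G) {φ : MulAut (Raag G)} (hφ : IsIA φ)
    {h : V → Raag G} (hh : Rec φ h)
    (hΘ : ∀ a z z', z ∉ star G a → z' ∉ star G a → ex a (h z) = ex a (h z')) : φ ∈ Inn (Raag G) := by
  classical
  have := Fintype.ofFinite (Set V)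
  obtain ⟨g, hg⟩ := inner_family hno hφ hh hΘ _ Finset.univ rfl (by simp)
  refine ⟨g⁻¹, ?_⟩
  apply MulEquiv.toMonoidHom_injective
  apply raag_hom_ext
  intro v
  have h1 := hg Set.univ (Finset.mem_univ _) v
  rw [ret_univ] at h1
  have h2 := commute_of_mem_par_star h1
  have e : h v = h v * g⁻¹ * g := by group
  change (MulAut.conj g⁻¹) (gen G v) = φ (gen G v)
  rw [hh v, MulAut.conj_apply, e]
  set m := h v * g⁻¹
  have e2 : m⁻¹ * gen G v * m = gen G v := by rw [mul_assoc, ← h2.eq]; group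
  calc _ = g⁻¹ * gen G v * g := by group
    _ = g⁻¹ * (m⁻¹ * gen G v * m) * g := by rw [e2]
    _ = _ := by group

end Inner2

end RaagPaper

open SimpleGraph

namespace RaagPaper

section Final

variable {V : Type} {G : SimpleGraph V}

/-- Multi-partial conjugations by powers of `a`. -/
def IsPC (a : V) (m : V → ℤ) (φ : MulAut (Raag G)) : Prop :=
  ∀ z, φ (gen G z) = (gen G a ^ m z)⁻¹ * gen G z * gen G a ^ m z

lemma conj_star {a z : V} (hz : z ∈ star G a) (k : ℤ) :
    (gen G a ^ k)⁻¹ * gen G z * gen G a ^ k = gen G z := by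
  have h : Commute (gen G z) (gen G a ^ k) :=
    (commute_of_mem_par_star (gen_mem_par hz)).zpow_right k
  rw [mul_assoc, h.eq]; group

/-- The homomorphism underlying a multi-partial conjugation. -/
noncomputable def pcHom (a : V) (m : V → ℤ)
    (hm : ∀ u v, u ∉ star G a → v ∉ star G a → G.Adj u v → m u = m v) : Raag G →* Raag G :=
  liftHom G (fun z => (gen G a ^ m z)⁻¹ * gen G z * gen G a ^ m z) (by
    have key : ∀ {u v : V}, G.Adj u v → u ∈ star G a → v ∉ star G a →
        Commute ((gen G a ^ m u)⁻¹ * gen G u * gen G a ^ m u) ((gen G a ^ m v)⁻¹ * gen G v * gen G a ^ m v) := by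
      intro u v huv hu hv
      rw [conj_star hu]
      have h : ∀ k : ℤ, Commute (gen G u) (gen G a ^ k) := fun k =>
        (commute_of_mem_par_star (gen_mem_par hu)).zpow_right k
      exact ((h _).inv_right.mul_right (gen_comm huv)).mul_right (h _)
    intro u v huv
    by_cases hu : u ∈ star G a <;> by_cases hv : v ∈ star G a
    · simp only [conj_star hu, conj_star hv]
      exact gen_comm huv
    · exact key huv hu hv
    · exact (key huv.symm hv hu).symm
    · simp only [hm u v hu hv huv]
      have := (gen_comm huv).map (MulAut.conj (gen G a ^ m v)⁻¹).toMonoidHom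
      have e : ∀ w : Raag G, (MulAut.conj (gen G a ^ m v)⁻¹).toMonoidHom w
          = (gen G a ^ m v)⁻¹ * w * gen G a ^ m v := by
        intro w
        change (gen G a ^ m v)⁻¹ * w * ((gen G a ^ m v)⁻¹)⁻¹ = _
        rw [inv_inv]
      rwa [e, e] at this)

lemma pcHom_gen (a : V) (m : V → ℤ)
    (hm : ∀ u v, u ∉ star G a → v ∉ star G a → G.Adj u v → m u = m v) (z : V) :
    pcHom a m hm (gen G z) = (gen G a ^ m z)⁻¹ * gen G z * gen G a ^ m z := by
  rw [pcHom, liftHom_gen]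

lemma exists_pc (a : V) (m : V → ℤ) (hm : ∀ u v, u ∉ star G a → v ∉ star G a → G.Adj u v → m u = m v) :
    ∃ φ : MulAut (Raag G), IsPC a m φ := by
  have hm' : ∀ u v, u ∉ star G a → v ∉ star G a → G.Adj u v → (fun z => - m z) u = (fun z => - m z) v := by
    intro u v hu hv huv
    simp only [hm u v hu hv huv]
  have e1 : (pcHom a _ hm').comp (pcHom a m hm) = MonoidHom.id _ := by
    apply raag_hom_ext
    intro z
    rw [MonoidHom.comp_apply, pcHom_gen]
    simp only [map_mul, map_inv, map_zpow, pcHom_gen, MonoidHom.id_apply, conj_star (self_mem_star a)]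
    group
  have e2 : (pcHom a m hm).comp (pcHom a _ hm') = MonoidHom.id _ := by
    apply raag_hom_ext
    intro z
    rw [MonoidHom.comp_apply, pcHom_gen]
    simp only [map_mul, map_inv, map_zpow, pcHom_gen, MonoidHom.id_apply, conj_star (self_mem_star a)]
    group
  exact ⟨MonoidHom.toMulEquiv _ _ e1 e2, fun z => pcHom_gen a m hm z⟩

lemma mulAut_ext {φ ψ : MulAut (Raag G)} (h : ∀ v, φ (gen G v) = ψ (gen G v)) : φ = ψ := by
  apply MulEquiv.toMonoidHom_injective
  apply raag_hom_ext
  exact h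

lemma IsPC.self {a : V} {m : V → ℤ} {φ : MulAut (Raag G)} (h : IsPC a m φ) : φ (gen G a) = gen G a := by
  rw [h a, conj_star (self_mem_star a)]

lemma IsPC.mul {a : V} {m m' : V → ℤ} {φ φ' : MulAut (Raag G)} (h : IsPC a m φ) (h' : IsPC a m' φ') :
    IsPC a (fun z => m z + m' z) (φ * φ') := by
  intro z
  rw [MulAut.mul_apply, h' z, map_mul, map_mul, map_inv, map_zpow, h.self, h z, zpow_add]
  group

lemma IsPC.inv {a : V} {m : V → ℤ} {φ : MulAut (Raag G)} (h : IsPC a m φ) :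
    IsPC a (fun z => - m z) φ⁻¹ := by
  intro z
  apply φ.injective
  rw [MulAut.apply_inv_self, map_mul, map_mul, map_inv, map_zpow, h.self, h z, zpow_neg]
  group

lemma IsPC.zpow {a : V} {m : V → ℤ} {φ : MulAut (Raag G)} (h : IsPC a m φ) (k : ℤ) :
    IsPC a (fun z => k * m z) (φ ^ k) := by
  induction k using Int.induction_on with
  | zero => intro z; simp
  | succ i ih =>
    have := ih.mul h
    rw [zpow_add_one]
    convert this using 2
    ring
  | pred i ih =>
    have := ih.mul h.inv
    rw [zpow_sub_one]
    convert this using 2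
    ring

lemma isIA_pc {a : V} {m : V → ℤ} {φ : MulAut (Raag G)} (h : IsPC a m φ) : IsIA φ := by
  intro b g
  have : (exHom G b).comp φ.toMonoidHom = exHom G b := by
    apply raag_hom_ext
    intro v
    change exHom G b (φ (gen G v)) = exHom G b (gen G v)
    rw [h v]
    simp [mul_comm]
  exact congrArg Multiplicative.toAdd (DFunLike.congr_fun this g)

/-- The set of images of partial conjugations. -/
def PCset (G : SimpleGraph V) : Set (Out (Raag G)) :=
  {o : Out (Raag G) | ∃ (x : V) (C : Set V) (φ : MulAut (Raag G)),
      IsUnionCC G x C ∧ IsPartialConj G x C φ ∧ o = toOut (Raag G) φ}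

lemma isUnionCC_of_closed {a : V} {D : Set V} (hD : D ⊆ (star G a)ᶜ)
    (hc : ∀ u v, u ∉ star G a → v ∉ star G a → G.Adj u v → (u ∈ D ↔ v ∈ D)) : IsUnionCC G a D := by
  refine ⟨{C | IsCC G (star G a)ᶜ C ∧ C ⊆ D}, fun C hC => hC.1, ?_⟩
  ext z
  constructor
  · intro hz
    refine ⟨_, ⟨⟨⟨z, hD hz⟩, rfl⟩, ?_⟩, ⟨hD hz, Reachable.refl _⟩⟩
    rintro w ⟨hw, hr⟩
    have := reach_const (fun v => v ∈ D) (fun u hu v hv huv => propext (hc u v hu hv huv)) hr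
    dsimp only at this
    rw [this]
    exact hz
  · rintro ⟨C, ⟨_, hC⟩, hz⟩
    exact hC hz

lemma pc_mem_closure [Finite V] (a : V) (s : Finset ℤ) : ∀ (m : V → ℤ) (φ : MulAut (Raag G)),
    (∀ u v, u ∉ star G a → v ∉ star G a → G.Adj u v → m u = m v) → IsPC a m φ →
    (∀ z, z ∉ star G a → m z = 0 ∨ m z ∈ s) → toOut (Raag G) φ ∈ Subgroup.closure (PCset G) := by
  classical
  induction s using Finset.induction_on with
  | empty =>
    intro m φ hm hφ hs
    have : φ = 1 := by
      apply mulAut_ext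
      intro v
      rw [hφ v, MulAut.one_apply]
      by_cases hv : v ∈ star G a
      · exact conj_star hv _
      · have : m v = 0 := by simpa using hs v hv
        rw [this]; simp
    rw [this, map_one]
    exact one_mem _
  | insert c s hcs ih =>
    intro m φ hm hφ hs
    let D : Set V := {z | z ∉ star G a ∧ m z = c}
    let m₁ : V → ℤ := fun z => if z ∈ D then 1 else 0
    let m₂ : V → ℤ := fun z => if z ∈ D then 0 else m z
    have hD : ∀ u v, u ∉ star G a → v ∉ star G a → G.Adj u v → (u ∈ D ↔ v ∈ D) := by
      intro u v hu hv huv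
      simp only [D, Set.mem_setOf_eq, hu, hv, hm u v hu hv huv]
    have h1 : ∀ u v, u ∉ star G a → v ∉ star G a → G.Adj u v → m₁ u = m₁ v := by
      intro u v hu hv huv
      simp only [m₁, hD u v hu hv huv]
    have h2 : ∀ u v, u ∉ star G a → v ∉ star G a → G.Adj u v → m₂ u = m₂ v := by
      intro u v hu hv huv
      simp only [m₂, hD u v hu hv huv, hm u v hu hv huv]
    obtain ⟨φ₁, hφ₁⟩ := exists_pc a m₁ h1
    obtain ⟨φ₂, hφ₂⟩ := exists_pc a m₂ h2
    have e : φ = φ₂ * φ₁ ^ c := by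
      apply mulAut_ext
      intro z
      rw [hφ z, hφ₂.mul (hφ₁.zpow c) z]
      have : m z = m₂ z + c * m₁ z := by
        by_cases hz : z ∈ D
        · simp only [m₁, m₂, hz, if_true]
          rw [hz.2]; ring
        · simp [m₁, m₂, hz]
      rw [this]
    rw [e, map_mul, map_zpow]
    refine mul_mem (ih m₂ φ₂ h2 hφ₂ ?_) (zpow_mem (Subgroup.subset_closure ?_) _)
    · intro z hz
      by_cases hzD : z ∈ D
      · left; simp [m₂, hzD]
      · have hmz : m₂ z = m z := by simp [m₂, hzD]
        rw [hmz]
        rcases hs z hz with h | h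
        · exact Or.inl h
        · rcases Finset.mem_insert.1 h with h | h
          · exact absurd ⟨hz, h⟩ hzD
          · exact Or.inr h
    · refine ⟨a, D, φ₁, isUnionCC_of_closed (fun z hz => hz.1) hD, ⟨?_, ?_⟩, rfl⟩
      · intro v hv
        rw [hφ₁ v]
        simp [m₁, hv]
      · intro v hv
        rw [hφ₁ v]
        simp [m₁, hv]

lemma kill [Finite V] {φ : MulAut (Raag G)} (hφ : IsIA φ) {h : V → Raag G} (hh : Rec φ h) (A : Finset V) :
    ∃ (ψ : MulAut (Raag G)) (h' : V → Raag G), toOut (Raag G) ψ ∈ Subgroup.closure (PCset G) ∧ IsIA ψ ∧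
      Rec (φ * ψ) h' ∧ ∀ b ∈ A, ∀ z, ex b (h' z) = 0 := by
  classical
  have := Fintype.ofFinite V
  induction A using Finset.induction_on with
  | empty =>
    refine ⟨1, h, by rw [map_one]; exact one_mem _, fun a g => rfl, by rwa [mul_one], by simp⟩
  | insert a A ha ih =>
    obtain ⟨ψ, h', h1, h2, h3, h4⟩ := ih
    let m : V → ℤ := fun z => - ex a (h' z)
    have hm : ∀ u v, u ∉ star G a → v ∉ star G a → G.Adj u v → m u = m v := by
      intro u v hu hv huv
      simp only [m, rec_ex_edge h3 huv hu hv]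
    obtain ⟨π, hπ⟩ := exists_pc a m hm
    refine ⟨ψ * π, fun z => h' z * (φ * ψ) (gen G a ^ m z), ?_, h2.mul (isIA_pc hπ), ?_, ?_⟩
    · rw [map_mul]
      exact mul_mem h1 (pc_mem_closure a (Finset.univ.image m) m π hm hπ (fun z _ => Or.inr (by simp)))
    · intro z
      rw [← mul_assoc, MulAut.mul_apply, hπ z, map_mul, map_mul, map_inv, h3 z]
      group
    · intro b hb z
      rw [ex_mul, hφ.mul h2, ex_zpow]
      rcases Finset.mem_insert.1 hb with rfl | hb
      · simp [m]
      · rw [h4 b hb z, ex_gen_ne (by rintro rfl; exact ha hb)]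
        simp

lemma pc_abAut {x : V} {C : Set V} {φ : MulAut (Raag G)} (h : IsPartialConj G x C φ) :
    abAut (Raag G) φ = 1 := by
  apply MulEquiv.toMonoidHom_injective
  apply Abelianization.hom_ext
  apply raag_hom_ext
  intro v
  change Abelianization.of (φ (gen G v)) = Abelianization.of (gen G v)
  by_cases hv : v ∈ C
  · rw [h.1 v hv]
    simp [mul_comm]
  · rw [h.2 v hv]

lemma ker_rep [Finite V] (hno : HasNoSIL G) {o : Out (Raag G)} (ho : o ∈ (rhoOut (Raag G)).ker) :
    ∃ (φ : MulAut (Raag G)) (h : V → Raag G), toOut (Raag G) φ = o ∧ IsIA φ ∧ Rec φ h := by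
  obtain ⟨φ, rfl⟩ := QuotientGroup.mk'_surjective (Inn (Raag G)) o
  have h1 : abAut (Raag G) φ = 1 := ho
  have h2 := isIA_of_abAut h1
  choose h hh using conj_gen hno h2
  exact ⟨φ, h, rfl, h2, hh⟩

lemma toOut_eq_one {φ : MulAut (Raag G)} : toOut (Raag G) φ = 1 ↔ φ ∈ Inn (Raag G) :=
  QuotientGroup.eq_one_iff φ

lemma generation [Finite V] (hno : HasNoSIL G) :
    Subgroup.closure (PCset G) = (rhoOut (Raag G)).ker := by
  have := Fintype.ofFinite V
  apply le_antisymm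
  · rw [Subgroup.closure_le]
    rintro o ⟨x, C, φ, _, h, rfl⟩
    exact pc_abAut h
  · intro o ho
    obtain ⟨φ, h, rfl, h1, h2⟩ := ker_rep hno ho
    obtain ⟨ψ, h', k1, k2, k3, k4⟩ := kill h1 h2 Finset.univ
    have hin := inner_of_zero hno (h1.mul k2) k3 (by
      intro a z z' _ _
      rw [k4 a (Finset.mem_univ _), k4 a (Finset.mem_univ _)])
    have e := toOut_eq_one.2 hin
    rw [map_mul] at e
    rw [eq_inv_of_mul_eq_one_left e]
    exact inv_mem k1

lemma rec_diff [Finite V] {φ φ' : MulAut (Raag G)} {h h' : V → Raag G} (hφ : IsIA φ) (hh : Rec φ h)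
    (hh' : Rec φ' h') (ho : toOut (Raag G) φ = toOut (Raag G) φ') {a z z' : V} (hz : z ∉ star G a)
    (hz' : z' ∉ star G a) : ex a (h z) - ex a (h z') = ex a (h' z) - ex a (h' z') := by
  obtain ⟨g, hg⟩ : φ⁻¹ * φ' ∈ Inn (Raag G) := QuotientGroup.eq.1 ho
  have e : φ' = φ * MulAut.conj g := by rw [hg]; group
  have key : ∀ w, w ∉ star G a → ex a (h' w) = ex a (h w) - ex a g := by
    intro w hw
    have h1 : φ' (gen G w) = (h w * (φ g)⁻¹)⁻¹ * gen G w * (h w * (φ g)⁻¹) := by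
      rw [e, MulAut.mul_apply, MulAut.conj_apply, map_mul, map_mul, map_inv, hh w]
      group
    rw [rec_ex_unique (hh' w) h1 hw, ex_mul, ex_inv, hφ]
    ring
  rw [key z hz, key z' hz']
  ring

lemma free_of_embedding {K M : Type} [Group K] [AddCommGroup M] [Module.Free ℤ M] [Module.Finite ℤ M] (f : K →* Multiplicative M)
    (hf : Function.Injective f) : ∃ ι : Type, Nonempty (K ≃* Multiplicative (ι →₀ ℤ)) := by
  let N : Submodule ℤ M := AddSubgroup.toIntSubmodule (MonoidHom.toAdditiveLeft f).range
  have hN : ∀ k, Multiplicative.toAdd (f k) ∈ N := fun k => ⟨Additive.ofMul k, rfl⟩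
  let g : K →* Multiplicative N :=
    { toFun := fun k => Multiplicative.ofAdd ⟨Multiplicative.toAdd (f k), hN k⟩
      map_one' := by
        apply Multiplicative.toAdd.injective
        apply Subtype.ext
        simp
      map_mul' := by
        intro a b
        apply Multiplicative.toAdd.injective
        apply Subtype.ext
        simp }
  have hg : Function.Bijective g := by
    constructor
    · intro a b hab
      apply hf
      exact congrArg (fun n : Multiplicative N => Multiplicative.ofAdd ((Multiplicative.toAdd n : N) : M)) hab
    · intro n
      obtain ⟨k, hk⟩ := (Multiplicative.toAdd n).2
      refine ⟨Additive.toMul k, ?_⟩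
      apply Multiplicative.toAdd.injective
      apply Subtype.ext
      exact hk
  let b := Module.Free.chooseBasis ℤ N
  exact ⟨_, ⟨(MulEquiv.ofBijective g hg).trans b.repr.toAddEquiv.toMultiplicative⟩⟩

lemma free_ker [Finite V] (hno : HasNoSIL G) :
    ∃ ι : Type, Nonempty ((rhoOut (Raag G)).ker ≃* Multiplicative (ι →₀ ℤ)) := by
  classical
  have := Fintype.ofFinite V
  choose Φ H hΦ hIA hRec using fun o : (rhoOut (Raag G)).ker => ker_rep hno o.2
  let θ : (rhoOut (Raag G)).ker → (V × V × V → ℤ) := fun o p =>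
    if p.2.1 ∉ star G p.1 ∧ p.2.2 ∉ star G p.1 then ex p.1 (H o p.2.1) - ex p.1 (H o p.2.2) else 0
  have hmul : ∀ o o', θ (o * o') = θ o + θ o' := by
    intro o o'
    funext ⟨a, z, z'⟩
    simp only [θ, Pi.add_apply]
    by_cases hz : z ∉ star G a ∧ z' ∉ star G a
    · simp only [hz, not_false_eq_true, and_self, if_true]
      have hr : Rec (Φ o * Φ o') (fun v => H o v * Φ o (H o' v)) := by
        intro v
        rw [MulAut.mul_apply, hRec o' v, map_mul, map_mul, map_inv, hRec o v]
        group
      rw [rec_diff (hIA (o * o')) (hRec (o * o')) hr (by rw [hΦ, map_mul, hΦ, hΦ]; rfl) hz.1 hz.2]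
      rw [ex_mul, ex_mul, hIA, hIA]
      ring
    · simp only [if_neg hz, add_zero]
  let f : (rhoOut (Raag G)).ker →* Multiplicative (V × V × V → ℤ) :=
    MonoidHom.mk' (fun o => Multiplicative.ofAdd (θ o)) (by
      intro o o'
      rw [hmul, ofAdd_add])
  apply free_of_embedding f
  rw [injective_iff_map_eq_one]
  intro o ho
  have h0 : θ o = 0 := Multiplicative.ofAdd.injective ho
  apply Subtype.ext
  rw [← hΦ o]
  apply toOut_eq_one.2
  refine inner_of_zero hno (hIA o) (hRec o) ?_
  intro a z z' hz hz'
  have h1 := congrFun h0 (a, z, z')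
  simp only [θ, hz, hz', not_false_eq_true, and_self, if_true, Pi.zero_apply] at h1
  omega

end Final

end RaagPaper


open RaagPaper in
/-- If `Γ` has no SIL then `IA_Γ` (the kernel of the action of
`Out(A_Γ)` on the abelianization) is generated by the images of all partial
conjugations, and it is a free abelian group. -/
theorem statement5 {V : Type} [Fintype V] (G : SimpleGraph V)
    (hnosil : HasNoSIL G) :
    (Subgroup.closure {o : Out (Raag G) |
        ∃ (x : V) (C : Set V) (φ : MulAut (Raag G)),
          IsUnionCC G x C ∧ IsPartialConj G x C φ ∧ o = toOut (Raag G) φ}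
      = (rhoOut (Raag G)).ker)
    ∧ ∃ ι : Type, Nonempty ((rhoOut (Raag G)).ker ≃* Multiplicative (ι →₀ ℤ)) := by
  exact ⟨generation hnosil, free_ker hnosil⟩
end

section
/- Let s ≥ 0 and c_0,…,c_s, d ≥ 1 be integers, and let G = ℤ^{c_0} ∗ ℤ^{c_1} ∗ ⋯ ∗ ℤ^{c_s} ∗ ℤ^d be the free product of the indicated free abelian groups. Let π : G → ℤ/2ℤ be the homomorphism sending each standard basis element of each factor ℤ^{c_i} to the nontrivial element and each standard basis element of the factor ℤ^d to the identity, and let N = ker π. Conjugation in G induces an action of ℤ/2ℤ ≅ G/N on the ℚ-vector space V = ℚ ⊗_ℤ N^{ab}, where N^{ab} is the abelianization of N. Then: (I) V is isomorphic as a ℚ[ℤ/2ℤ]-module to ℚ^{(c_0+⋯+c_s)−s} ⊕ (ℚ[ℤ/2ℤ])^{d+s}, where ℚ denotes the trivial module; and (II) the (−1)-eigenspace in V of the nontrivial element of ℤ/2ℤ has dimension d+s over ℚ. -/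
namespace Stmt6

/-- The homomorphism sending an automorphism to the induced automorphism of the
abelianization. -/
def abAut (H : Type*) [Group H] : MulAut H →* MulAut (Abelianization H) where
  toFun e := MulEquiv.abelianizationCongr e
  map_one' := by
    apply MulEquiv.toMonoidHom_injective
    apply Abelianization.hom_ext
    ext x
    simp [abelianizationCongr_of]
  map_mul' f g := by
    apply MulEquiv.toMonoidHom_injective
    apply Abelianization.hom_ext
    ext x
    simp [abelianizationCongr_of, MulAut.mul_apply]

/-- The factors of the free product: `ℤ^{c_i}` for `i = 0,…,s` (indexed by
`some i`), and `ℤ^d` (indexed by `none`). -/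
def Fac (s : ℕ) (c : Fin (s + 1) → ℕ) (d : ℕ) : Option (Fin (s + 1)) → Type
  | none => Multiplicative (Fin d → ℤ)
  | some i => Multiplicative (Fin (c i) → ℤ)

instance (s : ℕ) (c : Fin (s + 1) → ℕ) (d : ℕ) (i : Option (Fin (s + 1))) :
    CommGroup (Fac s c d i) := by
  cases i <;> (dsimp [Fac]; infer_instance)

/-- The free product `G = ℤ^{c_0} ∗ ⋯ ∗ ℤ^{c_s} ∗ ℤ^d`. -/
abbrev FP (s : ℕ) (c : Fin (s + 1) → ℕ) (d : ℕ) : Type := Monoid.CoprodI (Fac s c d)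

/-- The homomorphism `ℤ^n → ℤ/2ℤ` sending every standard basis vector to the
nontrivial element (written multiplicatively). -/
def sumHom (n : ℕ) : Multiplicative (Fin n → ℤ) →* Multiplicative (ZMod 2) :=
  AddMonoidHom.toMultiplicative
    ((Int.castAddHom (ZMod 2)).comp
      (AddMonoidHom.mk' (fun x : Fin n → ℤ => ∑ j, x j)
        (fun a b => by simp [Finset.sum_add_distrib])))

/-- The homomorphisms on the factors: nontrivial on each `ℤ^{c_i}` basis element,
trivial on the `ℤ^d` factor. -/
def facHom (s : ℕ) (c : Fin (s + 1) → ℕ) (d : ℕ) :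
    ∀ i, Fac s c d i →* Multiplicative (ZMod 2)
  | none => 1
  | some i => sumHom (c i)

/-- The homomorphism `π : G → ℤ/2ℤ`. -/
def piHom (s : ℕ) (c : Fin (s + 1) → ℕ) (d : ℕ) :
    FP s c d →* Multiplicative (ZMod 2) :=
  Monoid.CoprodI.lift (facHom s c d)

/-- `N = ker π`. -/
abbrev NN (s : ℕ) (c : Fin (s + 1) → ℕ) (d : ℕ) : Subgroup (FP s c d) :=
  (piHom s c d).ker

/-- The `ℚ`-vector space `V = ℚ ⊗_ℤ N^{ab}`. -/
abbrev Vsp (s : ℕ) (c : Fin (s + 1) → ℕ) (d : ℕ) : Type :=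
  TensorProduct ℤ ℚ (Additive (Abelianization (NN s c d)))

/-- The linear action on `V` induced by conjugation by `g ∈ G`. -/
noncomputable def tau (s : ℕ) (c : Fin (s + 1) → ℕ) (d : ℕ) (g : FP s c d) :
    Vsp s c d →ₗ[ℚ] Vsp s c d :=
  LinearMap.baseChange ℚ
    ((MulEquiv.toAdditive
        (abAut (NN s c d) (MulAut.conjNormal g))).toAddMonoidHom.toIntLinearMap)

end Stmt6

namespace Stmt6Aux
open Stmt6 TensorProduct

section Generic

variable {G : Type} [Group G] (π : G →* Multiplicative (ZMod 2))

abbrev W : Type := TensorProduct ℤ ℚ (Additive (Abelianization π.ker))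

noncomputable def T (g : G) : W π →ₗ[ℚ] W π :=
  LinearMap.baseChange ℚ
    ((MulEquiv.toAdditive
        (abAut π.ker (MulAut.conjNormal g))).toAddMonoidHom.toIntLinearMap)

noncomputable def iota (n : π.ker) : W π :=
  (1 : ℚ) ⊗ₜ[ℤ] (Additive.ofMul (Abelianization.of n))

lemma T_iota (g : G) (n : π.ker) : T π g (iota π n) = iota π (MulAut.conjNormal g n) := by
  rfl

lemma iota_mul (m n : π.ker) : iota π (m * n) = iota π m + iota π n := by
  simp [iota, TensorProduct.tmul_add]

lemma W_ext {M : Type} [AddCommGroup M] [Module ℚ M] {f f' : W π →ₗ[ℚ] M}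
    (h : ∀ n, f (iota π n) = f' (iota π n)) : f = f' := by
  apply TensorProduct.AlgebraTensorModule.ext
  intro x y
  obtain ⟨n, hn⟩ := QuotientGroup.mk_surjective (Additive.toMul y)
  have hy : y = Additive.ofMul (Abelianization.of n) := by
    exact congrArg Additive.ofMul hn.symm
  have hx : x ⊗ₜ[ℤ] y = x • iota π n := by
    rw [iota, TensorProduct.smul_tmul', hy]; simp
  rw [hx, map_smul, map_smul, h]

lemma T_mul (g h : G) : T π (g * h) = T π g ∘ₗ T π h := by
  apply W_ext
  intro n
  simp [T_iota]

lemma T_ker (g : G) (hg : π g = 1) : T π g = LinearMap.id := by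
  apply W_ext
  intro n
  rw [T_iota]
  have : (MulAut.conjNormal g n : π.ker) = ⟨g, hg⟩ * n * ⟨g, hg⟩⁻¹ := by
    ext; simp
  rw [this, LinearMap.id_apply]
  have h2 := iota_mul π (⟨g, hg⟩ * n * (⟨g, hg⟩ : π.ker)⁻¹) ⟨g, hg⟩
  rw [inv_mul_cancel_right, iota_mul, add_comm] at h2
  exact (add_right_cancel h2).symm

noncomputable def mkDual (f : π.ker →* Multiplicative ℚ) : Module.Dual ℚ (W π) :=
  TensorProduct.AlgebraTensorModule.lift
    ((LinearMap.toSpanSingleton ℚ _ 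
      ((MonoidHom.toAdditiveLeft (Abelianization.lift f)).toIntLinearMap)))

lemma mkDual_iota (f : π.ker →* Multiplicative ℚ) (n : π.ker) :
    mkDual π f (iota π n) = Multiplicative.toAdd (f n) := by
  simp [mkDual, iota]

/-- crossed homomorphisms -/
def Z1 {H : Type} [Group H] (χ : H →* ℚ) : Submodule ℚ (H → ℚ) where
  carrier := {φ | ∀ g h, φ (g * h) = φ g + χ g * φ h}
  zero_mem' := by intro g h; simp
  add_mem' := by
    intro a b ha hb g h
    simp only [Pi.add_apply, ha g h, hb g h]; ring
  smul_mem' := by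
    intro r a ha g h
    simp only [Pi.smul_apply, smul_eq_mul, ha g h]; ring

variable (ε : Multiplicative (ZMod 2) →* ℚ)

def resHom (φ : Z1 (ε.comp π)) : π.ker →* Multiplicative ℚ :=
  MonoidHom.mk' (fun n => Multiplicative.ofAdd (φ.1 n)) (by
    intro a b
    have := φ.2 a b
    have ha : π a = 1 := a.2
    rw [← ofAdd_add]
    exact congrArg Multiplicative.ofAdd (by simpa [ha] using this))

noncomputable def P : Z1 (ε.comp π) →ₗ[ℚ] Module.Dual ℚ (W π) where
  toFun φ := mkDual π (resHom π ε φ)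
  map_add' a b := by
    apply W_ext
    intro n
    simp [mkDual_iota, resHom]
  map_smul' r a := by
    apply W_ext
    intro n
    simp [mkDual_iota, resHom]

lemma P_iota (φ) (n : π.ker) : P π ε φ (iota π n) = φ.1 n := by
  change mkDual π (resHom π ε φ) _ = _
  rw [mkDual_iota]; rfl

lemma Z1_one {H : Type} [Group H] (χ : H →* ℚ) (φ : Z1 χ) : φ.1 1 = 0 := by
  have := φ.2 1 1
  simpa using this

lemma mz2 : ∀ x y : Multiplicative (ZMod 2), x ≠ 1 → y ≠ 1 → x = y := by decide
lemma mz2' : ∀ x y : Multiplicative (ZMod 2), x ≠ 1 → y ≠ 1 → x * y⁻¹ = 1 := by decide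
lemma mz2'' : ∀ x y : Multiplicative (ZMod 2), x ≠ 1 → y ≠ 1 → x * y = 1 := by decide

lemma eps_sq (x : Multiplicative (ZMod 2)) : ε x * ε x = 1 := by
  rw [← map_mul, show x * x = 1 by revert x; decide, map_one]

lemma P_equiv (t : G) (φ) (v : W π) : P π ε φ (T π t v) = ε (π t) * P π ε φ v := by
  have : P π ε φ ∘ₗ T π t = ε (π t) • P π ε φ := by
    apply W_ext
    intro n
    simp only [LinearMap.comp_apply, T_iota, P_iota, LinearMap.smul_apply, smul_eq_mul]
    rw [MulAut.conjNormal_apply]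
    have hn : π n = 1 := n.2
    rw [φ.2, φ.2]
    have h := φ.2 t t⁻¹
    rw [mul_inv_cancel, Z1_one] at h
    simp only [MonoidHom.comp_apply, map_mul, hn, map_one, mul_one] at h ⊢
    linarith
  exact LinearMap.congr_fun this v

lemma P_surj (t : G) (ht : π t ≠ 1) (f : Module.Dual ℚ (W π))
    (hf : ∀ v, f (T π t v) = ε (π t) * f v) : ∃ φ, P π ε φ = f := by
  classical
  let F : G → ℚ := fun g => if h : π g = 1 then f (iota π ⟨g, h⟩) else 0
  have F1 : ∀ g (h : π g = 1), F g = f (iota π ⟨g, h⟩) := fun g h => by simp [F, h]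
  have Fmul : ∀ g h, π g = 1 → π h = 1 → F (g * h) = F g + F h := by
    intro g h hg hh
    rw [F1 g hg, F1 h hh, F1 (g * h) (by simp [hg, hh]), ← map_add, ← iota_mul]; rfl
  have Fconj : ∀ g, π g = 1 → F (t * g * t⁻¹) = ε (π t) * F g := by
    intro g hg
    rw [F1 g hg, ← hf, T_iota, F1 _ (by simp [hg])]; congr 2
  have Ft2 : ε (π t) * F (t * t) = F (t * t) := by
    rw [← Fconj _ (by simpa using mz2'' _ _ ht ht)]; congr 1; group
  have hE := eps_sq ε (π t)
  let φ : G → ℚ := fun g => if π g = 1 then F g else F (g * t⁻¹) + F (t * t) / 2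
  have hφ : φ ∈ Z1 (ε.comp π) := by
    intro g h
    simp only [φ, MonoidHom.comp_apply]
    by_cases hg : π g = 1 <;> by_cases hh : π h = 1
    · simp [hg, hh, Fmul]
    · have h2 : π (h * t⁻¹) = 1 := by simpa using mz2' _ _ hh ht
      rw [if_neg (by simpa [hg] using hh), if_pos hg, if_neg hh, mul_assoc, Fmul _ _ hg h2, hg]
      simp; ring
    · have h2 : π (g * t⁻¹) = 1 := by simpa using mz2' _ _ hg ht
      rw [if_neg (by simpa [hh] using hg), if_neg hg, if_pos hh,
        show g * h * t⁻¹ = (g * t⁻¹) * (t * h * t⁻¹) by group,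
        Fmul _ _ h2 (by simp [hh]), Fconj _ hh, mz2 _ _ hg ht]
      ring
    · have h2 : π (g * t⁻¹) = 1 := by simpa using mz2' _ _ hg ht
      have h3 : π (h * t⁻¹) = 1 := by simpa using mz2' _ _ hh ht
      have h4 : π (t * t) = 1 := by simpa using mz2'' _ _ ht ht
      rw [if_pos (by simpa using mz2'' _ _ hg hh), if_neg hg, if_neg hh,
        show g * h = (g * t⁻¹) * ((t * (h * t⁻¹) * t⁻¹) * (t * t)) by group,
        Fmul _ _ h2 (by rw [map_mul, h4]; simp [mz2' _ _ hh ht]),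
        Fmul _ _ (by simp [mz2' _ _ hh ht]) h4, Fconj _ h3, mz2 _ _ hg ht]
      linarith
  refine ⟨⟨φ, hφ⟩, ?_⟩
  apply W_ext
  intro n
  have hn : π n = 1 := n.2
  rw [P_iota]
  simp only [φ]
  rw [if_pos hn, F1 _ hn]

end Generic

section Generic2

variable {G : Type} [Group G] (π : G →* Multiplicative (ZMod 2))

def sgn : Multiplicative (ZMod 2) →* ℚ where
  toFun x := if x = 1 then 1 else -1
  map_one' := by simp
  map_mul' x y := by
    by_cases hx : x = 1 <;> by_cases hy : y = 1
    · simp [hx, hy]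
    · simp [hx, hy]
    · simp [hx, hy]
    · simp [hx, hy, mz2'' _ _ hx hy]

lemma sgn_ne (x) (hx : x ≠ 1) : sgn x = -1 := by simp [sgn, hx]

variable (ε : Multiplicative (ZMod 2) →* ℚ)

lemma range_P (t : G) (ht : π t ≠ 1) :
    LinearMap.range (P π ε) = LinearMap.ker (T π t - ε (π t) • LinearMap.id).dualMap := by
  ext f
  simp only [LinearMap.mem_range, LinearMap.mem_ker]
  constructor
  · rintro ⟨φ, rfl⟩
    ext v
    simp [P_equiv]
  · intro h
    apply P_surj π ε t ht
    intro v
    have := LinearMap.congr_fun h v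
    simp only [LinearMap.dualMap_apply, LinearMap.sub_apply, LinearMap.smul_apply, map_sub,
      map_smul, LinearMap.id_apply, smul_eq_mul, LinearMap.zero_apply] at this
    linarith

lemma finrank_ker_dualMap {V : Type} [AddCommGroup V] [Module ℚ V] [Module.Finite ℚ V]
    (f : V →ₗ[ℚ] V) : Module.finrank ℚ (LinearMap.ker f.dualMap) =
      Module.finrank ℚ (LinearMap.ker f) := by
  have h1 := LinearMap.finrank_range_add_finrank_ker f
  have h2 := LinearMap.finrank_range_add_finrank_ker f.dualMap
  rw [LinearMap.finrank_range_dualMap_eq_finrank_range, Subspace.dual_finrank_eq] at h2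
  omega

lemma T_sq (t : G) (ht : π t ≠ 1) (v : W π) : T π t (T π t v) = v := by
  rw [← LinearMap.comp_apply, ← T_mul, T_ker _ _ (by simpa using mz2'' _ _ ht ht)]; rfl

lemma T_eq (t g : G) (ht : π t ≠ 1) (hg : π g ≠ 1) : T π g = T π t := by
  have := T_mul π (g * t⁻¹) t
  rwa [inv_mul_cancel_right, T_ker π (g * t⁻¹) (by simpa using mz2' _ _ hg ht),
    LinearMap.id_comp] at this

lemma W_finite (t : G) (ht : π t ≠ 1)
    [Module.Finite ℚ (Z1 ((1 : Multiplicative (ZMod 2) →* ℚ).comp π))]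
    [Module.Finite ℚ (Z1 (sgn.comp π))] : Module.Finite ℚ (W π) := by
  rw [← Module.finite_dual_iff (K := ℚ)]
  apply Module.Finite.of_surjective
    ((P π 1).coprod (P π sgn))
  intro f
  obtain ⟨a, ha⟩ := P_surj π 1 t ht ((1/2 : ℚ) • (f + f ∘ₗ T π t)) (by
    intro v; simp [T_sq π t ht]; ring)
  obtain ⟨b, hb⟩ := P_surj π sgn t ht ((1/2 : ℚ) • (f - f ∘ₗ T π t)) (by
    intro v; simp [T_sq π t ht, sgn_ne _ ht]; ring)
  refine ⟨(a, b), ?_⟩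
  rw [LinearMap.coprod_apply, ha, hb]
  ext v
  simp; ring

lemma ker_P_one : LinearMap.ker (P π 1) = ⊥ := by
  rw [LinearMap.ker_eq_bot']
  intro φ h
  have h1 : ∀ g, π g = 1 → φ.1 g = 0 := by
    intro g hg
    rw [← P_iota π 1 φ ⟨g, hg⟩, h]; rfl
  ext g
  change φ.1 g = 0
  by_cases hg : π g = 1
  · exact h1 g hg
  · have h2 := φ.2 g g
    rw [h1 (g * g) (by simpa using mz2'' _ _ hg hg)] at h2
    simp at h2
    linarith

lemma finrank_ker_P_sgn (t : G) (ht : π t ≠ 1) :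
    Module.finrank ℚ (LinearMap.ker (P π sgn)) = 1 := by
  have hm : (fun g => 1 - sgn (π g)) ∈ Z1 (sgn.comp π) := by
    intro g h
    simp; ring
  refine finrank_eq_one (R := ℚ) (⟨⟨_, hm⟩, ?_⟩ : LinearMap.ker (P π sgn)) ?_ ?_
  · rw [LinearMap.mem_ker]
    apply W_ext
    intro n
    have hn : π n = 1 := n.2
    rw [P_iota]
    simp [hn]
  · intro h
    have := congrFun (congrArg (fun x => x.1.1) h) t
    simp [sgn_ne _ ht] at this
  · rintro ⟨φ, h⟩
    rw [LinearMap.mem_ker] at h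
    have h1 : ∀ g, π g = 1 → φ.1 g = 0 := by
      intro g hg
      rw [← P_iota π sgn φ ⟨g, hg⟩, h]; rfl
    refine ⟨φ.1 t / 2, ?_⟩
    ext g
    change φ.1 t / 2 * (1 - sgn (π g)) = φ.1 g
    by_cases hg : π g = 1
    · rw [h1 g hg, hg]; simp
    · have h2 := φ.2 (g * t⁻¹) t
      have h3 : π (g * t⁻¹) = 1 := by simpa using mz2' _ _ hg ht
      rw [h1 _ h3, MonoidHom.comp_apply, h3, inv_mul_cancel_right] at h2
      rw [sgn_ne _ hg, h2]; simp; ring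

end Generic2

section Cop

variable {I : Type} {M : I → Type} [∀ i, Group (M i)]
  (χ : Monoid.CoprodI M →* ℚ)

def resZ : Z1 χ →ₗ[ℚ] (∀ i, Z1 (χ.comp (Monoid.CoprodI.of (i := i)))) where
  toFun φ i := ⟨fun m => φ.1 (Monoid.CoprodI.of m), by
    intro g h
    change φ.1 (Monoid.CoprodI.of (g * h)) = _
    rw [map_mul]; exact φ.2 _ _⟩
  map_add' _ _ := rfl
  map_smul' _ _ := rfl

lemma resZ_inj : Function.Injective (resZ χ) := by
  rw [← LinearMap.ker_eq_bot, LinearMap.ker_eq_bot']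
  intro φ h
  ext g
  change φ.1 g = 0
  induction g using Monoid.CoprodI.induction_on with
  | one => exact Z1_one _ _
  | of i m => exact congrFun (congrArg (fun x => (x i).1) h) m
  | mul x y hx hy => rw [φ.2, hx, hy]; simp

lemma resZ_surj : Function.Surjective (resZ χ) := by
  intro ψ
  let F : Monoid.CoprodI M →* Function.End ℚ := Monoid.CoprodI.lift (fun i =>
    { toFun := fun m x => χ (Monoid.CoprodI.of m) * x + (ψ i).1 m
      map_one' := by
        funext x
        rw [map_one, map_one, Z1_one]
        change 1 * x + 0 = x
        ring
      map_mul' := by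
        intro a b
        funext x
        change _ = χ (Monoid.CoprodI.of a) * (χ (Monoid.CoprodI.of b) * x + (ψ i).1 b) + (ψ i).1 a
        rw [(ψ i).2 a b, map_mul, map_mul, MonoidHom.comp_apply]
        ring })
  have hof : ∀ i (m : M i) x, F (Monoid.CoprodI.of m) x =
      χ (Monoid.CoprodI.of m) * x + (ψ i).1 m := by
    intro i m x
    simp only [F, Monoid.CoprodI.lift_of]; rfl
  have hmul : ∀ g h x, F (g * h) x = F g (F h x) := by
    intro g h x
    rw [map_mul]; rfl
  have haff : ∀ g x, F g x = χ g * x + F g 0 := by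
    intro g
    induction g using Monoid.CoprodI.induction_on with
    | one => intro x; rw [map_one, map_one]; change x = 1 * x + 0; ring
    | of i m => intro x; rw [hof, hof]; ring
    | mul a b ha hb =>
      intro x
      rw [hmul, hmul, ha (F b x), ha (F b 0), hb x, map_mul]; ring
  refine ⟨⟨fun g => F g 0, ?_⟩, ?_⟩
  · intro g h
    change F (g * h) 0 = F g 0 + χ g * F h 0
    rw [hmul, haff g (F h 0)]; ring
  · funext i
    ext m
    change F (Monoid.CoprodI.of m) 0 = _
    rw [hof]; ring

noncomputable def equivZ : Z1 χ ≃ₗ[ℚ] (∀ i, Z1 (χ.comp (Monoid.CoprodI.of (i := i)))) :=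
  LinearEquiv.ofBijective (resZ χ) ⟨resZ_inj χ, resZ_surj χ⟩

end Cop

section Ab

variable (n : ℕ)

/-- crossed homs for trivial character on `ℤ^n`. -/
noncomputable def equivAb : Z1 (1 : Multiplicative (Fin n → ℤ) →* ℚ) ≃ₗ[ℚ] (Fin n → ℚ) := by
  refine LinearEquiv.ofBijective
    { toFun := fun φ j => φ.1 (Multiplicative.ofAdd (Pi.single j 1))
      map_add' := fun _ _ => rfl
      map_smul' := fun _ _ => rfl } ⟨?_, ?_⟩
  · rw [← LinearMap.ker_eq_bot, LinearMap.ker_eq_bot']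
    intro φ h
    let f : (Fin n → ℤ) →+ ℚ := AddMonoidHom.mk' (fun x => φ.1 (Multiplicative.ofAdd x)) (by
      intro a b
      have := φ.2 (Multiplicative.ofAdd a) (Multiplicative.ofAdd b)
      rw [ofAdd_add, this]; simp)
    have hf : f = 0 := by
      ext j
      exact congrFun h j
    ext x
    exact DFunLike.congr_fun hf (Multiplicative.toAdd x)
  · intro y
    refine ⟨⟨fun x => ∑ j, (Multiplicative.toAdd x j : ℚ) * y j, ?_⟩, ?_⟩
    · intro a b
      simp [add_mul, Finset.sum_add_distrib]
    · funext k
      simp [Pi.single_apply]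

lemma finrank_sgn {H : Type} [CommGroup H] (χ : H →* ℚ) (e : H) (he : χ e = -1) :
    Module.finrank ℚ (Z1 χ) = 1 := by
  have hm : (fun g => 1 - χ g) ∈ Z1 χ := by
    intro g h
    simp; ring
  refine finrank_eq_one (R := ℚ) (⟨_, hm⟩ : Z1 χ) ?_ ?_
  · intro h
    have := congrFun (congrArg (fun x => x.1) h) e
    simp [he] at this
  · intro φ
    refine ⟨φ.1 e / 2, ?_⟩
    ext g
    change φ.1 e / 2 * (1 - χ g) = φ.1 g
    have h1 := φ.2 g e
    have h2 := φ.2 e g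
    rw [mul_comm, h1, he] at h2
    linarith

end Ab

section LinAlg

variable {V : Type} [AddCommGroup V] [Module ℚ V] [Module.Finite ℚ V]

lemma linalg (τ : V →ₗ[ℚ] V) (hτ : ∀ v, τ (τ v) = v) (a b : ℕ)
    (h1 : Module.finrank ℚ (LinearMap.ker (τ - LinearMap.id)) = a + b)
    (h2 : Module.finrank ℚ (LinearMap.ker (τ + LinearMap.id)) = b) :
    ∃ e : V ≃ₗ[ℚ] (Fin a → ℚ) × (Fin b → ℚ × ℚ),
      ∀ v, e (τ v) = ((e v).1, fun i => ((e v).2 i).swap) := by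
  let A : LinearMap.ker (τ - LinearMap.id) ≃ₗ[ℚ] (Fin a → ℚ) × (Fin b → ℚ) :=
    LinearEquiv.ofFinrankEq _ _ (by simp [h1])
  let B : LinearMap.ker (τ + LinearMap.id) ≃ₗ[ℚ] (Fin b → ℚ) :=
    LinearEquiv.ofFinrankEq _ _ (by simp [h2])
  let p : V →ₗ[ℚ] LinearMap.ker (τ - LinearMap.id) :=
    LinearMap.codRestrict _ (τ + LinearMap.id) (by
      intro v; simp [hτ, add_comm])
  let m : V →ₗ[ℚ] LinearMap.ker (τ + LinearMap.id) :=
    LinearMap.codRestrict _ (LinearMap.id - τ) (by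
      intro v; simp [hτ])
  have hp : ∀ v, p (τ v) = p v := by
    intro v; ext; simp [p, hτ, add_comm]
  have hm : ∀ v, m (τ v) = - m v := by
    intro v; ext; simp [m, hτ]
  let f : V →ₗ[ℚ] (Fin a → ℚ) × (Fin b → ℚ × ℚ) :=
    { toFun := fun v => ((A (p v)).1, fun i => ((A (p v)).2 i + B (m v) i,
        (A (p v)).2 i - B (m v) i))
      map_add' := by
        intro v w
        ext <;> simp <;> ring
      map_smul' := by
        intro r v
        ext <;> simp <;> ring }
  have hf : ∀ v, f (τ v) = ((f v).1, fun i => ((f v).2 i).swap) := by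
    intro v
    simp only [f, LinearMap.coe_mk, AddHom.coe_mk, hp, hm, map_neg]
    ext <;> simp <;> ring
  refine ⟨LinearEquiv.ofBijective f ⟨?_, ?_⟩, hf⟩
  · rw [← LinearMap.ker_eq_bot, LinearMap.ker_eq_bot']
    intro v hv
    have e1 : (A (p v)).1 = 0 := congrArg Prod.fst hv
    have e2 : ∀ i, (A (p v)).2 i + B (m v) i = 0 := fun i =>
      congrArg Prod.fst (congrFun (congrArg Prod.snd hv) i)
    have e3 : ∀ i, (A (p v)).2 i - B (m v) i = 0 := fun i =>
      congrArg Prod.snd (congrFun (congrArg Prod.snd hv) i)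
    have hA : A (p v) = 0 := by
      refine Prod.ext e1 (funext fun i => ?_)
      have := e2 i; have := e3 i
      change (A (p v)).2 i = 0
      linarith
    have hB : B (m v) = 0 := by
      refine funext fun i => ?_
      have := e2 i; have := e3 i
      change B (m v) i = 0
      linarith
    have hA' : τ v + v = 0 := congrArg Subtype.val ((LinearEquiv.map_eq_zero_iff A).1 hA)
    have hB' : v - τ v = 0 := congrArg Subtype.val ((LinearEquiv.map_eq_zero_iff B).1 hB)
    have : (2 : ℚ) • v = 0 := by
      rw [two_smul]
      calc v + v = (τ v + v) + (v - τ v) := by abel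
        _ = 0 := by rw [hA', hB', add_zero]
    exact (smul_eq_zero.1 this).resolve_left (by norm_num)
  · rintro ⟨x, y⟩
    let u := A.symm ((1/2 : ℚ) • x, fun i => ((y i).1 + (y i).2) / 4)
    let w := B.symm (fun i => ((y i).1 - (y i).2) / 4)
    have hu : τ u = (u : V) := sub_eq_zero.1 u.2
    have hw : τ w = -(w : V) := eq_neg_of_add_eq_zero_left w.2
    have e1 : p (u + w) = (2 : ℚ) • u := by
      ext
      simp [p, hu, hw, two_smul]
    have e2 : m (u + w) = (2 : ℚ) • w := by
      ext
      simp [m, hu, hw, two_smul]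
    refine ⟨u + w, ?_⟩
    change ((A (p (u + w))).1, fun i => ((A (p (u + w))).2 i + B (m (u + w)) i,
        (A (p (u + w))).2 i - B (m (u + w)) i)) = _
    rw [e1, e2]
    ext <;> simp [u, w] <;> ring

end LinAlg

section Final

variable (s : ℕ) (c : Fin (s + 1) → ℕ) (d : ℕ) (ε : Multiplicative (ZMod 2) →* ℚ)

lemma comp_of (i : Option (Fin (s + 1))) :
    ((ε.comp (piHom s c d)).comp (Monoid.CoprodI.of (i := i))) = ε.comp (facHom s c d i) := by
  ext x
  simp [piHom]

lemma sumHom_single (n : ℕ) (j : Fin n) :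
    sumHom n (Multiplicative.ofAdd (Pi.single j 1)) ≠ 1 := by
  have : sumHom n (Multiplicative.ofAdd (Pi.single j 1)) =
      Multiplicative.ofAdd ((∑ k, (Pi.single j 1 : Fin n → ℤ) k : ℤ) : ZMod 2) := rfl
  rw [this]
  simp

lemma comp_none : ((ε.comp (piHom s c d)).comp (Monoid.CoprodI.of (i := none))) = 1 := by
  rw [comp_of]
  ext x
  change ε 1 = 1
  simp

noncomputable def equivNone :
    Z1 ((ε.comp (piHom s c d)).comp (Monoid.CoprodI.of (i := none))) ≃ₗ[ℚ] (Fin d → ℚ) :=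
  (LinearEquiv.ofEq _ _ (congrArg Z1 (comp_none s c d ε))).trans (equivAb d)

noncomputable def equivSome (i : Fin (s + 1)) :
    Z1 (((1 : Multiplicative (ZMod 2) →* ℚ).comp (piHom s c d)).comp
      (Monoid.CoprodI.of (i := some i))) ≃ₗ[ℚ] (Fin (c i) → ℚ) :=
  equivAb (c i)

lemma finrank_some (hc : ∀ i, 1 ≤ c i) (i : Fin (s + 1)) :
    Module.finrank ℚ (Z1 ((sgn.comp (piHom s c d)).comp
      (Monoid.CoprodI.of (i := some i)))) = 1 := by
  refine finrank_sgn (H := Fac s c d (some i)) _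
    (Multiplicative.ofAdd (Pi.single ⟨0, hc i⟩ 1 : Fin (c i) → ℤ)) ?_
  rw [comp_of]
  exact sgn_ne _ (sumHom_single (c i) ⟨0, hc i⟩)

lemma fin_one : ∀ i, Module.Finite ℚ
    (Z1 (((1 : Multiplicative (ZMod 2) →* ℚ).comp (piHom s c d)).comp
      (Monoid.CoprodI.of (i := i))))
  | none => Module.Finite.equiv (equivNone s c d 1).symm
  | some i => Module.Finite.equiv (equivSome s c d i).symm

lemma fin_sgn (hc : ∀ i, 1 ≤ c i) : ∀ i, Module.Finite ℚ
    (Z1 ((sgn.comp (piHom s c d)).comp (Monoid.CoprodI.of (i := i))))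
  | none => Module.Finite.equiv (equivNone s c d sgn).symm
  | some i => Module.finite_of_finrank_eq_succ (finrank_some s c d hc i)

lemma Z_one : Module.Finite ℚ (Z1 ((1 : Multiplicative (ZMod 2) →* ℚ).comp (piHom s c d))) ∧
    Module.finrank ℚ (Z1 ((1 : Multiplicative (ZMod 2) →* ℚ).comp (piHom s c d))) =
      d + ∑ i, c i := by
  have := fin_one s c d
  refine ⟨Module.Finite.equiv (equivZ _).symm, ?_⟩
  rw [(equivZ _).finrank_eq, Module.finrank_pi_fintype, Fintype.sum_option,
    (equivNone s c d 1).finrank_eq, Module.finrank_fin_fun]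
  congr 1
  refine Finset.sum_congr rfl fun i _ => ?_
  rw [(equivSome s c d i).finrank_eq, Module.finrank_fin_fun]

lemma Z_sgn (hc : ∀ i, 1 ≤ c i) : Module.Finite ℚ (Z1 (sgn.comp (piHom s c d))) ∧
    Module.finrank ℚ (Z1 (sgn.comp (piHom s c d))) = d + (s + 1) := by
  have := fin_sgn s c d hc
  refine ⟨Module.Finite.equiv (equivZ _).symm, ?_⟩
  rw [(equivZ _).finrank_eq, Module.finrank_pi_fintype, Fintype.sum_option,
    (equivNone s c d sgn).finrank_eq, Module.finrank_fin_fun]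
  congr 1
  rw [Finset.sum_congr rfl fun i _ => finrank_some s c d hc i]
  simp

lemma exists_t (hc : ∀ i, 1 ≤ c i) : ∃ t : FP s c d, piHom s c d t ≠ 1 := by
  refine ⟨Monoid.CoprodI.of (i := some 0)
    (show Fac s c d (some 0) from
      Multiplicative.ofAdd (Pi.single ⟨0, hc 0⟩ 1 : Fin (c 0) → ℤ)), ?_⟩
  rw [piHom, Monoid.CoprodI.lift_of]
  exact sumHom_single (c 0) ⟨0, hc 0⟩

end Final

end Stmt6Aux

open Stmt6 in
/-- For `G = ℤ^{c_0} ∗ ⋯ ∗ ℤ^{c_s} ∗ ℤ^d` and `π : G → ℤ/2ℤ` as above,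
with `N = ker π` and `V = ℚ ⊗ N^{ab}` carrying the conjugation action of
`ℤ/2ℤ ≅ G/N`:
(I) `V ≅ ℚ^{(∑cᵢ)−s} ⊕ ℚ[ℤ/2ℤ]^{d+s}` as `ℚ[ℤ/2ℤ]`-modules, where the copy of
`ℚ[ℤ/2ℤ]` is realised as `ℚ × ℚ` with the nontrivial element acting by swapping the
coordinates and `ℚ` is the trivial module; and
(II) the `(−1)`-eigenspace of the nontrivial element of `ℤ/2ℤ` has dimension `d + s`. -/
theorem statement6 (s : ℕ) (c : Fin (s + 1) → ℕ) (d : ℕ)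
    (hc : ∀ i, 1 ≤ c i) (hd : 1 ≤ d) :
    (∃ e : Vsp s c d ≃ₗ[ℚ] (Fin ((∑ i, c i) - s) → ℚ) × (Fin (d + s) → ℚ × ℚ),
        ∀ (g : FP s c d) (v : Vsp s c d),
          (piHom s c d g = 1 → e (tau s c d g v) = e v) ∧
          (piHom s c d g ≠ 1 →
            e (tau s c d g v) = ((e v).1, fun i => ((e v).2 i).swap))) ∧
    (∀ g : FP s c d, piHom s c d g ≠ 1 →
        Module.finrank ℚ ↥(LinearMap.ker (tau s c d g + LinearMap.id)) = d + s) := by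
  classical
  obtain ⟨t, ht⟩ := Stmt6Aux.exists_t s c d hc
  obtain ⟨f1, r1⟩ := Stmt6Aux.Z_one s c d
  obtain ⟨f2, r2⟩ := Stmt6Aux.Z_sgn s c d hc
  have hfin : Module.Finite ℚ (Stmt6Aux.W (piHom s c d)) :=
    Stmt6Aux.W_finite (piHom s c d) t ht
  have k1 : Module.finrank ℚ (LinearMap.ker
      (Stmt6Aux.T (piHom s c d) t - LinearMap.id)) = d + ∑ i, c i := by
    have h := LinearMap.finrank_range_add_finrank_ker (Stmt6Aux.P (piHom s c d) 1)
    rw [Stmt6Aux.ker_P_one, Stmt6Aux.range_P _ _ t ht, finrank_bot,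
      Stmt6Aux.finrank_ker_dualMap, r1, MonoidHom.one_apply, one_smul] at h
    exact h
  have k2 : Module.finrank ℚ (LinearMap.ker
      (Stmt6Aux.T (piHom s c d) t + LinearMap.id)) = d + s := by
    have h := LinearMap.finrank_range_add_finrank_ker (Stmt6Aux.P (piHom s c d) Stmt6Aux.sgn)
    have hneg : Stmt6Aux.T (piHom s c d) t - (-1 : ℚ) • LinearMap.id =
        Stmt6Aux.T (piHom s c d) t + LinearMap.id := by
      refine LinearMap.ext fun v => ?_
      rw [LinearMap.sub_apply, LinearMap.smul_apply, LinearMap.add_apply, LinearMap.id_apply]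
      module
    rw [Stmt6Aux.finrank_ker_P_sgn _ t ht, Stmt6Aux.range_P _ _ t ht,
      Stmt6Aux.finrank_ker_dualMap, r2, Stmt6Aux.sgn_ne _ ht, hneg] at h
    omega
  have hs : s ≤ ∑ i, c i := by
    have : ∑ i : Fin (s + 1), 1 ≤ ∑ i, c i := Finset.sum_le_sum fun i _ => hc i
    simp at this
    omega
  have htau : ∀ g, tau s c d g = Stmt6Aux.T (piHom s c d) g := fun g => rfl
  refine ⟨?_, ?_⟩
  · obtain ⟨e, he⟩ := Stmt6Aux.linalg (Stmt6Aux.T (piHom s c d) t)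
      (Stmt6Aux.T_sq _ t ht) ((∑ i, c i) - s) (d + s) (by rw [k1]; omega) k2
    refine ⟨e, fun g v => ⟨fun hg => ?_, fun hg => ?_⟩⟩
    · rw [htau, Stmt6Aux.T_ker _ g hg]; rfl
    · rw [htau, Stmt6Aux.T_eq _ t g ht hg]; exact he v
  · intro g hg
    rw [htau, Stmt6Aux.T_eq _ t g ht hg]; exact k2
end
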